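/- On $\mathbb{R}^2$ consider the inhomogeneous incompressible Navier–Stokes system $$\text{(INS2D)}\qquad \partial_t\rho+u\cdot\nabla\rho=0,\qquad \rho\,\partial_t u+\rho\,(u\cdot\nabla)u-\Delta u+\nabla\Pi=0,\qquad \operatorname{div}u=0,\qquad (\rho,u)|_{t=0}=(\rho_0,u_0).$$ A *smooth global solution* is a triple $(\rho,u,\nabla\Pi)$ with $\rho>0$ that satisfies these equations pointwise for all $t\ge 0$, $x\in\mathbb{R}^2$, and such that $\rho-1$, $u$ and $\nabla\Pi$ are smooth on $[0,\infty)\times\mathbb{R}^2$ and belong to $C^\infty([0,\infty);H^k(\mathbb{R}^2))$ for every $k\in\mathbb{N}$. Write $\langle t\rangle_T=e+t/T$ and $$E_0=\int_{\mathbb{R}^2}\rho_0|u_0|^2\,dx,\qquad E_1=\|\nabla u_0\|_{L^2}^2,\qquad U_0=\int_{\mathbb{R}^2}|x|\,|u_0(x)|\,dx,$$ $$T_0=\max\Bigl\{\frac{U_0}{E_0},\ \|\rho_0-1\|_{L^2}^2\Bigr\},\qquad T_1=\max\Bigl\{T_0,\ \frac{E_0}{E_1}\Bigr\}$$ (in the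 trivial case $u_0\equiv 0$, quotients with zero denominator are read as $0$). There is an increasing function $\mathcal{C}:\mathbb{R}\to\mathbb{R}$ such that for every smooth global solution $(\rho,u,\nabla\Pi)$ of (INS2D) whose initial data satisfy $$U_0<\infty,\qquad \int_{\mathbb{R}^2}\rho_0u_0\,dx=0,\qquad \tfrac34\le\rho_0\le\tfrac54,$$ the following holds: for every $T\ge T_0$ and all $t\ge 0$, $$\|u(t)\|_{L^2}^2\le \mathcal{C}(E_0)\,E_0\,\langle t\rangle_T^{-2},$$ and for every $T\ge T_1$ and all $t\ge 0$, $$\|\nabla u(t)\|_{L^2}^2\le \mathcal{C}(E_0)\,E_1\,\langle t\rangle_T^{-3}.$$ -/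

import Mathlib

open MeasureTheory Set
open scoped ENNReal ContDiff

noncomputable section

namespace INS2D

/-- The plane `ℝ²` with its Euclidean norm. -/
abbrev Plane : Type := EuclideanSpace ℝ (Fin 2)

/-- The partial derivative `∂ᵢ f`. -/
def pderiv {V : Type*} [NormedAddCommGroup V] [NormedSpace ℝ V]
    (i : Fin 2) (f : Plane → V) (x : Plane) : V :=
  fderiv ℝ f x (EuclideanSpace.single i 1)

/-- The divergence `∂₁v¹ + ∂₂v²`. -/
def divergence (v : Plane → Plane) (x : Plane) : ℝ := ∑ i, pderiv i v x i

/-- The time derivative of a function of `(t, x) ∈ [0,∞) × ℝ²`, one-sided at `t = 0`. -/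
def timeDeriv {V : Type*} [NormedAddCommGroup V] [NormedSpace ℝ V]
    (f : ℝ → Plane → V) (t : ℝ) (x : Plane) : V :=
  derivWithin (fun s => f s x) (Ici 0) t

/-- `‖f‖²_{L²(ℝ²)}`. -/
def l2Sq {V : Type*} [NormedAddCommGroup V] (f : Plane → V) : ℝ := ∫ x, ‖f x‖ ^ 2

/-- `‖∇v‖²_{L²(ℝ²)} = ∑ᵢⱼ ‖∂ᵢvʲ‖²_{L²(ℝ²)}`. -/
def gradL2Sq (v : Plane → Plane) : ℝ := ∫ x, ∑ i, ‖pderiv i v x‖ ^ 2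

/-- `f` is smooth on `[0,∞) × ℝ²` and belongs to `C^∞([0,∞); H^k(ℝ²))` for every `k`:
for every order `n`, all spatial derivatives of order `n` of `f t` are in `L²(ℝ²)`, and
they depend smoothly on `t ∈ [0,∞)` as elements of `L²(ℝ²)`. -/
structure SmoothSobolev {V : Type*} [NormedAddCommGroup V] [NormedSpace ℝ V]
    (f : ℝ → Plane → V) : Prop where
  smooth : ContDiffOn ℝ ∞ (fun q : ℝ × Plane => f q.1 q.2) (Ici 0 ×ˢ univ)
  sobolev : ∀ n : ℕ, ∃ F : ℝ → Lp (ContinuousMultilinearMap ℝ (fun _ : Fin n => Plane) V) 2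
      (volume : Measure Plane),
    ContDiffOn ℝ ∞ F (Ici 0) ∧ ∀ t, 0 ≤ t → F t =ᵐ[volume] iteratedFDeriv ℝ n (f t)

/-- `(ρ, u, ∇P)` is a global smooth solution of the two-dimensional inhomogeneous
incompressible Navier–Stokes system; only times `t ≥ 0` matter, and the initial data are
`(ρ 0, u 0)`. -/
structure IsSmoothSolution (ρ : ℝ → Plane → ℝ) (u : ℝ → Plane → Plane)
    (P : ℝ → Plane → ℝ) : Prop where
  smooth_density : SmoothSobolev (fun t x => ρ t x - 1)
  smooth_velocity : SmoothSobolev u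
  differentiable_pressure : ∀ t, 0 ≤ t → Differentiable ℝ (P t)
  smooth_pressure : SmoothSobolev (fun t x => gradient (P t) x)
  density_pos : ∀ t, 0 ≤ t → ∀ x, 0 < ρ t x
  mass : ∀ t, 0 ≤ t → ∀ x, timeDeriv ρ t x + fderiv ℝ (ρ t) x (u t x) = 0
  momentum : ∀ t, 0 ≤ t → ∀ x,
    ρ t x • timeDeriv u t x + ρ t x • fderiv ℝ (u t) x (u t x)
      - Laplacian.laplacian (u t) x + gradient (P t) x = 0
  incompressible : ∀ t, 0 ≤ t → ∀ x, divergence (u t) x = 0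

/-- `E₀ = ∫ ρ₀ |u₀|²`. -/
def E₀ (ρ₀ : Plane → ℝ) (u₀ : Plane → Plane) : ℝ := ∫ x, ρ₀ x * ‖u₀ x‖ ^ 2

/-- `E₁ = ‖∇u₀‖²_{L²}`. -/
def E₁ (u₀ : Plane → Plane) : ℝ := gradL2Sq u₀

/-- `U₀ = ∫ |x| |u₀(x)| dx`. -/
def U₀ (u₀ : Plane → Plane) : ℝ := ∫ x, ‖x‖ * ‖u₀ x‖

/-- `T₀ = max {U₀ / E₀, ‖ρ₀ - 1‖²_{L²}}`. -/
def T₀ (ρ₀ : Plane → ℝ) (u₀ : Plane → Plane) : ℝ :=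
  max (U₀ u₀ / E₀ ρ₀ u₀) (l2Sq (fun x => ρ₀ x - 1))

/-- `T₁ = max {T₀, E₀ / E₁}`. -/
def T₁ (ρ₀ : Plane → ℝ) (u₀ : Plane → Plane) : ℝ :=
  max (T₀ ρ₀ u₀) (E₀ ρ₀ u₀ / E₁ u₀)

/-- `⟨t⟩_T = e + t / T`. -/
def bracket (T t : ℝ) : ℝ := Real.exp 1 + t / T

end INS2D

end

open MeasureTheory Set Filter Topology
open scoped ENNReal ContDiff

noncomputable section

namespace INS2D

section calculus

variable {V : Type*} [NormedAddCommGroup V] [NormedSpace ℝ V]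

/-! ### Partial derivatives on the plane -/

lemma sum_smul_single (v : Plane) : ∑ i, v i • EuclideanSpace.single i (1 : ℝ) = v := by
  ext j
  fin_cases j <;> simp [Fin.sum_univ_two]

lemma fderiv_apply_eq_sum (f : Plane → V) (x v : Plane) :
    fderiv ℝ f x v = ∑ i, v i • pderiv i f x := by
  conv_lhs => rw [← sum_smul_single v]
  simp [pderiv]

lemma norm_fderiv_apply_sq_le (f : Plane → V) (x v : Plane) :
    ‖fderiv ℝ f x v‖ ^ 2 ≤ ‖v‖ ^ 2 * ∑ i, ‖pderiv i f x‖ ^ 2 := by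
  rw [fderiv_apply_eq_sum, EuclideanSpace.norm_sq_eq]
  have h : ‖∑ i, v i • pderiv i f x‖ ≤ ∑ i, ‖v i‖ * ‖pderiv i f x‖ :=
    (norm_sum_le _ _).trans_eq (by simp [norm_smul])
  exact (pow_le_pow_left₀ (norm_nonneg _) h 2).trans (Finset.sum_mul_sq_le_sq_mul_sq _ _ _)

lemma norm_fderiv_sq_le (f : Plane → V) (x : Plane) :
    ‖fderiv ℝ f x‖ ^ 2 ≤ ∑ i, ‖pderiv i f x‖ ^ 2 := by
  have h0 : 0 ≤ ∑ i, ‖pderiv i f x‖ ^ 2 := Finset.sum_nonneg fun i _ => sq_nonneg _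
  have : ‖fderiv ℝ f x‖ ≤ √(∑ i, ‖pderiv i f x‖ ^ 2) := by
    refine ContinuousLinearMap.opNorm_le_bound _ (Real.sqrt_nonneg _) fun v => ?_
    have h := norm_fderiv_apply_sq_le f x v
    rw [← abs_of_nonneg (norm_nonneg (fderiv ℝ f x v)), mul_comm]
    refine (Real.abs_le_sqrt h).trans_eq ?_
    rw [Real.sqrt_mul (sq_nonneg _), Real.sqrt_sq (norm_nonneg _)]
  calc _ ≤ √(∑ i, ‖pderiv i f x‖ ^ 2) ^ 2 := pow_le_pow_left₀ (norm_nonneg _) this 2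
    _ = _ := Real.sq_sqrt h0

lemma contDiff_pderiv {f : Plane → V} {n : WithTop ℕ∞} {m : WithTop ℕ∞} (hf : ContDiff ℝ m f)
    (h : n + 1 ≤ m) (i : Fin 2) : ContDiff ℝ n (pderiv i f) :=
  (hf.fderiv_right h).clm_apply contDiff_const

lemma pderiv_pderiv_eq {f : Plane → V} (hf : ContDiff ℝ 2 f) (i j : Fin 2) (x : Plane) :
    pderiv i (pderiv j f) x =
      fderiv ℝ (fderiv ℝ f) x (EuclideanSpace.single i 1) (EuclideanSpace.single j 1) := by
  have h : DifferentiableAt ℝ (fderiv ℝ f) x :=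
    ((hf.fderiv_right (m := 1) (by norm_num)).differentiable (by norm_num)) x
  have := (h.hasFDerivAt.clm_apply (hasFDerivAt_const (EuclideanSpace.single j (1 : ℝ)) x)).fderiv
  unfold pderiv
  rw [this]
  simp

lemma pderiv_comm {f : Plane → V} (hf : ContDiff ℝ 2 f) (i j : Fin 2) (x : Plane) :
    pderiv i (pderiv j f) x = pderiv j (pderiv i f) x := by
  rw [pderiv_pderiv_eq hf, pderiv_pderiv_eq hf]
  exact (hf.contDiffAt.isSymmSndFDerivAt (by simp)).eq _ _

lemma laplacian_eq_sum {f : Plane → V} (hf : ContDiff ℝ 2 f) (x : Plane) :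
    Laplacian.laplacian f x = ∑ i, pderiv i (pderiv i f) x := by
  rw [InnerProductSpace.laplacian_eq_iteratedFDeriv_orthonormalBasis f
    (EuclideanSpace.basisFun (Fin 2) ℝ)]
  simp only [pderiv_pderiv_eq hf, iteratedFDeriv_two_apply]
  simp

lemma pderiv_smul {c : Plane → ℝ} {f : Plane → V} {x : Plane} (hc : DifferentiableAt ℝ c x)
    (hf : DifferentiableAt ℝ f x) (i : Fin 2) :
    pderiv i (fun y => c y • f y) x = c x • pderiv i f x + pderiv i c x • f x := by
  unfold pderiv
  rw [fderiv_fun_smul hc hf]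
  simp

lemma pderiv_add {f g : Plane → V} {x : Plane} (hf : DifferentiableAt ℝ f x)
    (hg : DifferentiableAt ℝ g x) (i : Fin 2) :
    pderiv i (fun y => f y + g y) x = pderiv i f x + pderiv i g x := by
  unfold pderiv
  rw [fderiv_fun_add hf hg]
  rfl

lemma pderiv_mul {c f : Plane → ℝ} {x : Plane} (hc : DifferentiableAt ℝ c x)
    (hf : DifferentiableAt ℝ f x) (i : Fin 2) :
    pderiv i (fun y => c y * f y) x = c x * pderiv i f x + pderiv i c x * f x :=
  pderiv_smul hc hf i

lemma pderiv_apply {f : Plane → Plane} {x : Plane} (hf : DifferentiableAt ℝ f x) (i j : Fin 2) :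
    pderiv i (fun y => f y j) x = pderiv i f x j := by
  unfold pderiv
  have := ((EuclideanSpace.proj (𝕜 := ℝ) j).hasFDerivAt.comp x hf.hasFDerivAt).fderiv
  exact congrArg (fun L => L (EuclideanSpace.single i 1)) this

lemma inner_gradient (p : Plane → ℝ) (x v : Plane) :
    inner ℝ (gradient p x) v = fderiv ℝ p x v := by
  rw [gradient, InnerProductSpace.toDual_symm_apply]

/-! ### Integration by parts on the plane -/

lemma integral_pderiv_eq_zero {h : Plane → ℝ} (i : Fin 2) (hd : Differentiable ℝ h)
    (hi : Integrable h) (hi' : Integrable (pderiv i h)) : ∫ x, pderiv i h x = 0 := by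
  have := integral_mul_fderiv_eq_neg_fderiv_mul_of_integrable (μ := (volume : Measure Plane))
    (f := fun _ => (1 : ℝ)) (g := h) (v := EuclideanSpace.single i 1)
    (by simp) (by simp only [one_mul]; exact hi') (by simpa using hi)
    (fun x _ => by fun_prop) (fun x _ => hd x)
  simpa [pderiv] using this

lemma integral_inner_pderiv {H : Type*} [NormedAddCommGroup H] [InnerProductSpace ℝ H]
    {f g : Plane → H} (i : Fin 2)
    (hf : Differentiable ℝ f) (hg : Differentiable ℝ g)
    (hfg : Integrable (fun x => inner ℝ (f x) (g x)))
    (hfg' : Integrable (fun x => inner ℝ (f x) (pderiv i g x)))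
    (hf'g : Integrable (fun x => inner ℝ (pderiv i f x) (g x))) :
    ∫ x, inner ℝ (f x) (pderiv i g x) = - ∫ x, inner ℝ (pderiv i f x) (g x) :=
  integral_bilinear_fderiv_right_eq_neg_left_of_integrable (B := innerSL ℝ) hf'g hfg' hfg
    (fun x _ => hf x) (fun x _ => hg x)

end calculus

section squareIntegrable

variable {V W : Type*} [NormedAddCommGroup V] [NormedAddCommGroup W]

/-! ### Square-integrable functions -/

lemma memLp_two_iff {f : Plane → V} (hf : AEStronglyMeasurable f volume) :
    MemLp f 2 ↔ Integrable (fun x => ‖f x‖ ^ 2) := by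
  have := integrable_norm_rpow_iff hf (p := 2) (by norm_num) (by norm_num)
  rw [← this]
  simp

lemma integrable_sq {f : Plane → V} (hf : MemLp f 2) : Integrable (fun x => ‖f x‖ ^ 2) :=
  (memLp_two_iff hf.1).1 hf

lemma l2Sq_nonneg (f : Plane → V) : 0 ≤ l2Sq f := integral_nonneg fun _ => by positivity

lemma integrable_norm_mul {f : Plane → V} {g : Plane → W} (hf : MemLp f 2) (hg : MemLp g 2) :
    Integrable (fun x => ‖f x‖ * ‖g x‖) := hf.norm.integrable_mul hg.norm

lemma integral_norm_mul_le {f : Plane → V} {g : Plane → W} (hf : MemLp f 2) (hg : MemLp g 2) :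
    ∫ x, ‖f x‖ * ‖g x‖ ≤ √(l2Sq f) * √(l2Sq g) := by
  have h := integral_mul_le_Lp_mul_Lq_of_nonneg (μ := (volume : Measure Plane))
    Real.HolderConjugate.two_two (f := fun x => ‖f x‖) (g := fun x => ‖g x‖)
    (ae_of_all _ fun _ => norm_nonneg _) (ae_of_all _ fun _ => norm_nonneg _)
    (by simpa using hf.norm) (by simpa using hg.norm)
  simpa [l2Sq, Real.sqrt_eq_rpow] using h

lemma l2Sq_congr {f g : Plane → V} (h : f =ᵐ[volume] g) : l2Sq f = l2Sq g :=
  integral_congr_ae (h.mono fun x hx => by simp only [hx])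

lemma l2Sq_eq_norm_sq (F : Lp V 2 (volume : Measure Plane)) : l2Sq F = ‖F‖ ^ 2 := by
  have h := Lp.norm_def F
  rw [h, (Lp.memLp F).eLpNorm_eq_integral_rpow_norm (by norm_num) (by norm_num)]
  have h0 : 0 ≤ ∫ x, ‖F x‖ ^ 2 := l2Sq_nonneg _
  rw [ENNReal.toReal_ofReal (by positivity)]
  simp only [ENNReal.toReal_ofNat, Real.rpow_two, l2Sq]
  rw [← one_div, ← Real.sqrt_eq_rpow, Real.sq_sqrt h0]

end squareIntegrable

section inner

variable {H : Type*} [NormedAddCommGroup H] [InnerProductSpace ℝ H]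

lemma integrable_inner {f g : Plane → H} (hf : MemLp f 2) (hg : MemLp g 2) :
    Integrable (fun x => inner ℝ (f x) (g x)) :=
  (integrable_norm_mul hf hg).mono' (hf.1.inner hg.1)
    (ae_of_all _ fun _ => norm_inner_le_norm _ _)

lemma abs_integral_inner_le {f g : Plane → H} (hf : MemLp f 2) (hg : MemLp g 2) :
    |∫ x, inner ℝ (f x) (g x)| ≤ √(l2Sq f) * √(l2Sq g) := by
  refine (norm_integral_le_of_norm_le (integrable_norm_mul hf hg)
    (ae_of_all _ fun x => norm_inner_le_norm (𝕜 := ℝ) (f x) (g x))).trans (integral_norm_mul_le hf hg)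

lemma integral_inner_pderiv_of_memLp {f g : Plane → H} (i : Fin 2)
    (hf : Differentiable ℝ f) (hg : Differentiable ℝ g) (hf2 : MemLp f 2) (hg2 : MemLp g 2)
    (hf' : MemLp (pderiv i f) 2) (hg' : MemLp (pderiv i g) 2) :
    ∫ x, inner ℝ (f x) (pderiv i g x) = - ∫ x, inner ℝ (pderiv i f x) (g x) :=
  integral_inner_pderiv i hf hg (integrable_inner hf2 hg2) (integrable_inner hf2 hg')
    (integrable_inner hf' hg2)

end inner

/-! ### Functions smooth in time with values in all Sobolev spaces -/

namespace SmoothSobolev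

variable {V : Type*} [NormedAddCommGroup V] [NormedSpace ℝ V] {f g : ℝ → Plane → V} {t : ℝ}

lemma contDiff (hf : SmoothSobolev f) (ht : 0 ≤ t) : ContDiff ℝ ∞ (f t) := by
  have := hf.smooth.comp (contDiff_prodMk_right t).contDiffOn (s := univ)
    (fun x _ => ⟨ht, trivial⟩)
  exact contDiffOn_univ.1 this

lemma differentiable (hf : SmoothSobolev f) (ht : 0 ≤ t) : Differentiable ℝ (f t) :=
  (hf.contDiff ht).differentiable (by simp)

lemma continuous (hf : SmoothSobolev f) (ht : 0 ≤ t) : Continuous (f t) :=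
  (hf.contDiff ht).continuous

lemma contDiff_two (hf : SmoothSobolev f) (ht : 0 ≤ t) : ContDiff ℝ 2 (f t) :=
  (hf.contDiff ht).of_le ENat.LEInfty.out

lemma continuousOn (hf : SmoothSobolev f) :
    ContinuousOn (fun q : ℝ × Plane => f q.1 q.2) (Ici 0 ×ˢ univ) := hf.smooth.continuousOn

lemma hasDerivAt (hf : SmoothSobolev f) (ht : 0 < t) (x : Plane) :
    HasDerivAt (fun s => f s x) (timeDeriv f t x) t := by
  have h1 : ContDiffOn ℝ ∞ (fun s => f s x) (Ici 0) :=
    hf.smooth.comp (contDiff_prodMk_left x).contDiffOn (fun s hs => ⟨hs, trivial⟩)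
  exact ((h1.differentiableOn (by simp) t ht.le).hasDerivWithinAt).hasDerivAt (Ici_mem_nhds ht)

lemma continuousOn_time (hf : SmoothSobolev f) (x : Plane) :
    ContinuousOn (fun s => f s x) (Ici 0) :=
  hf.continuousOn.comp (f := fun s => (s, x)) (by fun_prop) (fun _ hs => ⟨hs, trivial⟩)

lemma add (hf : SmoothSobolev f) (hg : SmoothSobolev g) :
    SmoothSobolev (fun t x => f t x + g t x) where
  smooth := hf.smooth.add hg.smooth
  sobolev n := by
    obtain ⟨F, hF, hF'⟩ := hf.sobolev n
    obtain ⟨G, hG, hG'⟩ := hg.sobolev n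
    refine ⟨fun t => F t + G t, hF.add hG, fun t ht => ?_⟩
    filter_upwards [hF' t ht, hG' t ht, Lp.coeFn_add (F t) (G t)] with x h1 h2 h3
    rw [h3, Pi.add_apply, h1, h2]
    exact (iteratedFDeriv_add_apply
      ((hf.contDiff ht).of_le (by exact_mod_cast le_top)).contDiffAt
      ((hg.contDiff ht).of_le (by exact_mod_cast le_top)).contDiffAt).symm

lemma pderiv (hf : SmoothSobolev f) (i : Fin 2) :
    SmoothSobolev (fun t x => pderiv i (f t) x) where
  smooth := by
    have hS : UniqueDiffOn ℝ (Ici (0 : ℝ) ×ˢ (univ : Set Plane)) :=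
      (uniqueDiffOn_Ici 0).prod uniqueDiffOn_univ
    have h := (hf.smooth.fderivWithin hS (m := ∞) (by simp)).clm_apply
      (contDiffOn_const (c := ((0 : ℝ), (EuclideanSpace.single i (1 : ℝ) : Plane))))
    refine h.congr fun q hq => ?_
    have h1 := (hf.smooth.differentiableOn (by simp) q hq).hasFDerivWithinAt
    have h2 : HasFDerivWithinAt (fun y : Plane => (q.1, y)) (ContinuousLinearMap.inr ℝ ℝ Plane)
      univ q.2 := (hasFDerivAt_prodMk_right q.1 q.2).hasFDerivWithinAt
    have h0 : MapsTo (fun y : Plane => (q.1, y)) univ (Ici (0 : ℝ) ×ˢ (univ : Set Plane)) :=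
      fun _ _ => ⟨hq.1, trivial⟩
    have h3 := (HasFDerivWithinAt.comp (g := fun q : ℝ × Plane => f q.1 q.2) q.2 h1 h2
      h0).hasFDerivAt univ_mem
    have h4 : fderiv ℝ (f q.1) q.2 = _ := h3.fderiv
    simp [INS2D.pderiv, h4]
  sobolev n := by
    obtain ⟨F, hF, hF'⟩ := hf.sobolev (n + 1)
    let ev : (Plane →L[ℝ] V) →L[ℝ] V :=
      ContinuousLinearMap.apply ℝ V (EuclideanSpace.single i (1 : ℝ) : Plane)
    let A := (ContinuousLinearMap.compContinuousMultilinearMapL ℝ (fun _ : Fin n => Plane)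
      (Plane →L[ℝ] V) V ev).comp
        ((continuousMultilinearCurryRightEquiv' ℝ n Plane V).toContinuousLinearEquiv :
          ContinuousMultilinearMap ℝ (fun _ : Fin n.succ => Plane) V →L[ℝ] _)
    refine ⟨fun t => A.compLpL 2 volume (F t), (A.compLpL 2 volume).contDiff.comp_contDiffOn hF,
      fun t ht => ?_⟩
    filter_upwards [A.coeFn_compLpL (F t), hF' t ht] with x h1 h2
    rw [h1, h2]
    have h3 : ContDiff ℝ ∞ (fderiv ℝ (f t)) := (hf.contDiff ht).fderiv_right (by simp)
    have h4 := ev.iteratedFDeriv_comp_left (i := n) (n := ∞) (x := x) h3.contDiffAt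
      (by exact_mod_cast le_top)
    have h5 : iteratedFDeriv ℝ n (fun x => INS2D.pderiv i (f t) x) x = _ := h4
    rw [h5, iteratedFDeriv_succ_eq_comp_right]
    simp [A]

lemma exists_lp (hf : SmoothSobolev f) : ∃ F : ℝ → Lp V 2 (volume : Measure Plane),
    ContDiffOn ℝ ∞ F (Ici 0) ∧ ∀ t, 0 ≤ t → F t =ᵐ[volume] f t := by
  obtain ⟨F, hF, hF'⟩ := hf.sobolev 0
  let A : ContinuousMultilinearMap ℝ (fun _ : Fin 0 => Plane) V →L[ℝ] V :=
    (continuousMultilinearCurryFin0 ℝ Plane V).toContinuousLinearEquiv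
  refine ⟨fun t => A.compLpL 2 volume (F t), (A.compLpL 2 volume).contDiff.comp_contDiffOn hF,
      fun t ht => ?_⟩
  filter_upwards [A.coeFn_compLpL (F t), hF' t ht] with x h1 h2
  rw [h1, h2]
  simp [A]

lemma memLp (hf : SmoothSobolev f) (ht : 0 ≤ t) : MemLp (f t) 2 := by
  obtain ⟨F, -, hF⟩ := hf.exists_lp
  exact (memLp_congr_ae (hF t ht)).1 (Lp.memLp _)

lemma continuousOn_l2Sq (hf : SmoothSobolev f) :
    ContinuousOn (fun t => l2Sq (f t)) (Ici 0) := by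
  obtain ⟨F, hF, hF'⟩ := hf.exists_lp
  refine (hF.continuousOn.norm.pow 2).congr fun t ht => ?_
  rw [← l2Sq_congr (hF' t ht), l2Sq_eq_norm_sq]
  rfl

lemma exists_l2Sq_le (hf : SmoothSobolev f) (T : ℝ) :
    ∃ M, ∀ t ∈ Icc 0 T, l2Sq (f t) ≤ M := by
  obtain ⟨M, hM⟩ := isCompact_Icc.exists_bound_of_continuousOn (s := Icc 0 T)
    (hf.continuousOn_l2Sq.mono Icc_subset_Ici_self)
  exact ⟨M, fun t ht => (le_abs_self _).trans (hM t ht)⟩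

/-- The difference quotients in time converge both in `L²` and pointwise, to the same limit. -/
lemma hasDerivAt_lp (hf : SmoothSobolev f) {F : ℝ → Lp V 2 (volume : Measure Plane)}
    (hF : ContDiffOn ℝ ∞ F (Ici 0)) (hF' : ∀ t, 0 ≤ t → F t =ᵐ[volume] f t) (ht : 0 < t) :
    ∃ G : Lp V 2 (volume : Measure Plane), HasDerivAt F G t ∧ G =ᵐ[volume] timeDeriv f t := by
  have hd : HasDerivAt F (deriv F t) t :=
    ((hF.differentiableOn (by simp) t ht.le).differentiableAt (Ici_mem_nhds ht)).hasDerivAt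
  refine ⟨deriv F t, hd, ?_⟩
  let h : ℕ → ℝ := fun n => 1 / ((n : ℝ) + 1)
  have hpos : ∀ n, 0 < h n := fun n => by positivity
  have hlim : Tendsto h atTop (𝓝[≠] 0) :=
    tendsto_nhdsWithin_iff.2 ⟨tendsto_one_div_add_atTop_nhds_zero_nat,
      Eventually.of_forall fun n => (hpos n).ne'⟩
  have h1 := hd.tendsto_slope_zero.comp hlim
  obtain ⟨ns, hns, hae⟩ := (tendstoInMeasure_of_tendsto_Lp h1).exists_seq_tendsto_ae
  have hall : ∀ᵐ x, ∀ n, ((h n)⁻¹ • (F (t + h n) - F t) : Lp V 2 (volume : Measure Plane)) x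
      = (h n)⁻¹ • (f (t + h n) x - f t x) := by
    rw [ae_all_iff]
    intro n
    filter_upwards [Lp.coeFn_smul (h n)⁻¹ (F (t + h n) - F t), Lp.coeFn_sub (F (t + h n)) (F t),
      hF' t ht.le, hF' (t + h n) (by linarith [hpos n])] with x a1 a2 a3 a4
    rw [a1, Pi.smul_apply, a2, Pi.sub_apply, a3, a4]
  filter_upwards [hae, hall] with x h2 h3
  have h4 := ((hf.hasDerivAt ht x).tendsto_slope_zero.comp hlim).comp hns.tendsto_atTop
  refine tendsto_nhds_unique h2 (h4.congr fun n => ?_)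
  exact (h3 (ns n)).symm

end SmoothSobolev

/-! ### The Sobolev embedding of `H²` into the bounded functions -/

section embedding

variable {V : Type*} [NormedAddCommGroup V] [NormedSpace ℝ V]

/-- The point of the plane with coordinates `s` and `r`. -/
def point (s r : ℝ) : Plane :=
  s • EuclideanSpace.single 0 (1 : ℝ) + r • EuclideanSpace.single 1 (1 : ℝ)

lemma point_coord (x : Plane) : point (x 0) (x 1) = x := by
  rw [point, ← Fin.sum_univ_two (f := fun i => x i • EuclideanSpace.single i (1 : ℝ))]
  exact sum_smul_single x

lemma continuous_point : Continuous (fun q : ℝ × ℝ => point q.1 q.2) := by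
  unfold point; fun_prop

lemma lintegral_point (F : Plane → ℝ≥0∞) (hF : Measurable F) :
    ∫⁻ s, ∫⁻ r, F (point s r) = ∫⁻ x, F x := by
  have h1 := (volume_preserving_finTwoArrow ℝ).comp
    (EuclideanSpace.volume_preserving_symm_measurableEquiv_toLp (Fin 2))
  have hm : Measurable (fun q : ℝ × ℝ => F (point q.1 q.2)) := hF.comp continuous_point.measurable
  have h2 := h1.lintegral_comp hm
  rw [Measure.volume_eq_prod, lintegral_prod _ hm.aemeasurable] at h2
  rw [← h2]
  refine lintegral_congr fun x => ?_
  exact congrArg F (point_coord x)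

lemma isClosedEmbedding_point_left (r : ℝ) : IsClosedEmbedding (fun s => point s r) := by
  refine (Isometry.of_dist_eq fun a b => ?_).isClosedEmbedding
  simp [point, dist_eq_norm, ← sub_smul, norm_smul]

lemma isClosedEmbedding_point_right (s : ℝ) : IsClosedEmbedding (fun r => point s r) := by
  refine (Isometry.of_dist_eq fun a b => ?_).isClosedEmbedding
  simp [point, dist_eq_norm, ← sub_smul, norm_smul]

lemma enorm_le_lintegral_pderiv_zero {g : Plane → V} (hg : ContDiff ℝ 1 g)
    (hc : HasCompactSupport g) (s r : ℝ) :
    ‖g (point s r)‖ₑ ≤ ∫⁻ s', ‖pderiv 0 g (point s' r)‖ₑ := by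
  have hl : ContDiff ℝ 1 (fun s => g (point s r)) := hg.comp (by unfold point; fun_prop)
  refine ((hc.comp_isClosedEmbedding (isClosedEmbedding_point_left r)).enorm_le_lintegral_Ici_deriv
    hl s).trans ((setLIntegral_le_lintegral _ _).trans_eq (lintegral_congr fun s' => ?_))
  have h1 : HasDerivAt (fun s => point s r) (EuclideanSpace.single 0 (1 : ℝ)) s' := by
    simpa [point] using ((hasDerivAt_id s').smul_const
      (EuclideanSpace.single 0 (1 : ℝ) : Plane)).add_const (r • EuclideanSpace.single 1 (1 : ℝ))
  have := ((hg.differentiable (by norm_num) (point s' r)).hasFDerivAt.comp_hasDerivAt s' h1).deriv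
  exact congrArg _ this

lemma enorm_le_lintegral_pderiv_one {g : Plane → V} (hg : ContDiff ℝ 1 g)
    (hc : HasCompactSupport g) (s r : ℝ) :
    ‖g (point s r)‖ₑ ≤ ∫⁻ r', ‖pderiv 1 g (point s r')‖ₑ := by
  have hl : ContDiff ℝ 1 (fun r => g (point s r)) := hg.comp (by unfold point; fun_prop)
  refine ((hc.comp_isClosedEmbedding (isClosedEmbedding_point_right s)).enorm_le_lintegral_Ici_deriv
    hl r).trans ((setLIntegral_le_lintegral _ _).trans_eq (lintegral_congr fun r' => ?_))
  have h1 : HasDerivAt (fun r => point s r) (EuclideanSpace.single 1 (1 : ℝ)) r' := by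
    simpa [point] using ((hasDerivAt_id r').smul_const
      (EuclideanSpace.single 1 (1 : ℝ) : Plane)).const_add (s • EuclideanSpace.single 0 (1 : ℝ))
  have := ((hg.differentiable (by norm_num) (point s r')).hasFDerivAt.comp_hasDerivAt r' h1).deriv
  exact congrArg _ this

lemma enorm_le_lintegral_pderiv_pderiv {g : Plane → V} (hg : ContDiff ℝ 2 g)
    (hc : HasCompactSupport g) (x : Plane) :
    ‖g x‖ₑ ≤ ∫⁻ y, ‖pderiv 1 (pderiv 0 g) y‖ₑ := by
  have hg0 : ContDiff ℝ 1 (pderiv 0 g) := contDiff_pderiv hg (by norm_num) 0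
  have hc0 : HasCompactSupport (pderiv 0 g) := hc.fderiv_apply ℝ _
  have hg1 : Continuous (pderiv 1 (pderiv 0 g)) :=
    (contDiff_pderiv (n := 0) hg0 (by norm_num) 1).continuous
  rw [← lintegral_point _ hg1.enorm.measurable]
  rw [← point_coord x]
  exact (enorm_le_lintegral_pderiv_zero (hg.of_le (by norm_num)) hc _ _).trans
    (lintegral_mono fun s => enorm_le_lintegral_pderiv_one hg0 hc0 _ _)

lemma pderiv_comp_add (f : Plane → V) (i : Fin 2) (x y : Plane) :
    pderiv i (fun z => f (x + z)) y = pderiv i f (x + y) := by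
  unfold pderiv
  rw [fderiv_comp_add_left]

/-- A quantitative form of the embedding of `H²(ℝ²)` into `L^∞(ℝ²)`. -/
lemma exists_norm_le_of_memLp : ∃ C : ℝ, ∀ f : Plane → V, ContDiff ℝ 2 f → MemLp f 2 →
    (∀ i, MemLp (pderiv i f) 2) → MemLp (pderiv 1 (pderiv 0 f)) 2 → ∀ x,
    ‖f x‖ ≤ C + (l2Sq f + l2Sq (pderiv 0 f) + l2Sq (pderiv 1 f) +
      l2Sq (pderiv 1 (pderiv 0 f))) := by
  let χ : ContDiffBump (0 : Plane) := ⟨1, 2, by norm_num, by norm_num⟩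
  have hχ : ContDiff ℝ 2 (χ : Plane → ℝ) := χ.contDiff
  have hχc : HasCompactSupport (χ : Plane → ℝ) := χ.hasCompactSupport
  have hχ0 : ∀ i, ContDiff ℝ 1 (pderiv i χ) := fun i => contDiff_pderiv hχ (by norm_num) i
  have hχ0c : ∀ i, HasCompactSupport (pderiv i χ) := fun i => hχc.fderiv_apply ℝ _
  have hχ1 : Continuous (pderiv 1 (pderiv 0 χ)) :=
    (contDiff_pderiv (n := 0) (hχ0 0) (by norm_num) 1).continuous
  have hχ1c : HasCompactSupport (pderiv 1 (pderiv 0 χ)) := (hχ0c 0).fderiv_apply ℝ _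
  let A : Plane → ℝ := fun y => ‖χ y‖ ^ 2 + ‖pderiv 0 χ y‖ ^ 2 + ‖pderiv 1 χ y‖ ^ 2 +
    ‖pderiv 1 (pderiv 0 χ) y‖ ^ 2
  have hA : Integrable A :=
    (((integrable_sq (hχ.continuous.memLp_of_hasCompactSupport hχc)).add
      (integrable_sq ((hχ0 0).continuous.memLp_of_hasCompactSupport (hχ0c 0)))).add
      (integrable_sq ((hχ0 1).continuous.memLp_of_hasCompactSupport (hχ0c 1)))).add
      (integrable_sq (hχ1.memLp_of_hasCompactSupport hχ1c))
  refine ⟨∫ y, A y, fun f hf h0 h1 h2 x => ?_⟩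
  let B : Plane → ℝ := fun y => ‖f y‖ ^ 2 + ‖pderiv 0 f y‖ ^ 2 + ‖pderiv 1 f y‖ ^ 2 +
    ‖pderiv 1 (pderiv 0 f) y‖ ^ 2
  have hB1 : Integrable (fun y => ‖f y‖ ^ 2 + ‖pderiv 0 f y‖ ^ 2) :=
    (integrable_sq h0).add (integrable_sq (h1 0))
  have hB2 : Integrable (fun y => ‖f y‖ ^ 2 + ‖pderiv 0 f y‖ ^ 2 + ‖pderiv 1 f y‖ ^ 2) :=
    hB1.add (integrable_sq (h1 1))
  have hB : Integrable B := hB2.add (integrable_sq h2)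
  have hBint : ∫ y, B y = l2Sq f + l2Sq (pderiv 0 f) + l2Sq (pderiv 1 f) +
      l2Sq (pderiv 1 (pderiv 0 f)) := by
    simp only [B]
    rw [integral_add hB2 (integrable_sq h2), integral_add hB1 (integrable_sq (h1 1)),
      integral_add (integrable_sq h0) (integrable_sq (h1 0))]
    rfl
  let F : Plane → V := fun y => f (x + y)
  have hF : ContDiff ℝ 2 F := hf.comp (by fun_prop)
  have hdχ : Differentiable ℝ χ := hχ.differentiable (by norm_num)
  have hdF : Differentiable ℝ F := hF.differentiable (by norm_num)
  have hFi : ∀ i, ContDiff ℝ 1 (pderiv i F) := fun i => contDiff_pderiv hF (by norm_num) i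
  let g : Plane → V := fun y => χ y • F y
  have hg : ContDiff ℝ 2 g := hχ.smul hF
  have hgc : HasCompactSupport g := hχc.smul_right
  have hexp : ∀ y, pderiv 1 (pderiv 0 g) y = χ y • pderiv 1 (pderiv 0 F) y + pderiv 1 χ y •
      pderiv 0 F y + (pderiv 0 χ y • pderiv 1 F y + pderiv 1 (pderiv 0 χ) y • F y) := by
    intro y
    have : pderiv 0 g = fun y => χ y • pderiv 0 F y + pderiv 0 χ y • F y :=
      funext fun y => pderiv_smul (hdχ y) (hdF y) 0
    rw [this]
    have d0 := (hFi 0).differentiable (by norm_num) y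
    have d1 := (hχ0 0).differentiable (by norm_num) y
    have e1 := pderiv_smul (hdχ y) d0 1
    have e2 := pderiv_smul d1 (hdF y) 1
    rw [← e1, ← e2]
    exact pderiv_add ((hdχ y).smul d0) (d1.smul (hdF y)) 1
  have hle : ∀ y, ‖pderiv 1 (pderiv 0 g) y‖ ≤ A y + B (x + y) := by
    intro y
    rw [hexp]
    have hFe : ∀ i, pderiv i F y = pderiv i f (x + y) := fun i => pderiv_comp_add f i x y
    have hFe2 : pderiv 1 (pderiv 0 F) y = pderiv 1 (pderiv 0 f) (x + y) := by
      have : pderiv 0 F = fun z => pderiv 0 f (x + z) := funext fun z => pderiv_comp_add f 0 x z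
      rw [this, pderiv_comp_add]
    rw [hFe, hFe, hFe2]
    refine ((norm_add_le _ _).trans (add_le_add (norm_add_le _ _) (norm_add_le _ _))).trans ?_
    simp only [norm_smul, A, B, F]
    nlinarith [sq_nonneg (‖χ y‖ - ‖pderiv 1 (pderiv 0 f) (x + y)‖),
      sq_nonneg (‖pderiv 1 χ y‖ - ‖pderiv 0 f (x + y)‖),
      sq_nonneg (‖pderiv 0 χ y‖ - ‖pderiv 1 f (x + y)‖),
      sq_nonneg (‖pderiv 1 (pderiv 0 χ) y‖ - ‖f (x + y)‖),
      sq_nonneg (‖χ y‖), sq_nonneg (‖pderiv 1 (pderiv 0 f) (x + y)‖),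
      sq_nonneg (‖pderiv 1 χ y‖), sq_nonneg (‖pderiv 0 f (x + y)‖),
      sq_nonneg (‖pderiv 0 χ y‖), sq_nonneg (‖pderiv 1 f (x + y)‖),
      sq_nonneg (‖pderiv 1 (pderiv 0 χ) y‖), sq_nonneg (‖f (x + y)‖)]
  have hAB : Integrable (fun y => A y + B (x + y)) := hA.add (hB.comp_add_left x)
  have key : ‖f x‖ₑ ≤ ENNReal.ofReal (∫ y, (A y + B (x + y))) := by
    have e : f x = g 0 := by
      simp [g, F, χ.one_of_mem_closedBall (Metric.mem_closedBall_self zero_le_one)]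
    rw [e, ofReal_integral_eq_lintegral_ofReal hAB
      (ae_of_all _ fun y => (norm_nonneg _).trans (hle y))]
    refine (enorm_le_lintegral_pderiv_pderiv hg hgc 0).trans (lintegral_mono fun y => ?_)
    rw [← ofReal_norm]
    exact ENNReal.ofReal_le_ofReal (hle y)
  rw [integral_add hA (hB.comp_add_left x), integral_add_left_eq_self, hBint] at key
  rw [← ofReal_norm] at key
  refine (ENNReal.ofReal_le_ofReal_iff ?_).1 key
  have hA0 : 0 ≤ ∫ y, A y := integral_nonneg fun y => by positivity
  have := l2Sq_nonneg f
  have := l2Sq_nonneg (pderiv 0 f)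
  have := l2Sq_nonneg (pderiv 1 f)
  have := l2Sq_nonneg (pderiv 1 (pderiv 0 f))
  positivity

lemma SmoothSobolev.exists_norm_le {f : ℝ → Plane → V} (hf : SmoothSobolev f) (T : ℝ) :
    ∃ M, 0 ≤ M ∧ ∀ t ∈ Icc 0 T, ∀ x, ‖f t x‖ ≤ M := by
  obtain ⟨C, hC⟩ := exists_norm_le_of_memLp (V := V)
  obtain ⟨M0, h0⟩ := hf.exists_l2Sq_le T
  obtain ⟨M1, h1⟩ := (hf.pderiv 0).exists_l2Sq_le T
  obtain ⟨M2, h2⟩ := (hf.pderiv 1).exists_l2Sq_le T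
  obtain ⟨M3, h3⟩ := ((hf.pderiv 0).pderiv 1).exists_l2Sq_le T
  refine ⟨max 0 (C + (M0 + M1 + M2 + M3)), le_max_left _ _, fun t ht x => ?_⟩
  have := hC (f t) (hf.contDiff_two ht.1) (hf.memLp ht.1) (fun i => (hf.pderiv i).memLp ht.1)
    (((hf.pderiv 0).pderiv 1).memLp ht.1) x
  have a0 := h0 t ht
  have a1 : l2Sq (INS2D.pderiv 0 (f t)) ≤ M1 := h1 t ht
  have a2 : l2Sq (INS2D.pderiv 1 (f t)) ≤ M2 := h2 t ht
  have a3 : l2Sq (INS2D.pderiv 1 (INS2D.pderiv 0 (f t))) ≤ M3 := h3 t ht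
  exact this.trans ((by linarith : _ ≤ _).trans (le_max_right _ _))

end embedding

/-! ### Translations -/

section translation

variable {V : Type*} [NormedAddCommGroup V] [NormedSpace ℝ V] [CompleteSpace V]

lemma sq_integral_le {a : ℝ → ℝ} (ha : Continuous a) :
    (∫ s in (0 : ℝ)..1, a s) ^ 2 ≤ ∫ s in (0 : ℝ)..1, a s ^ 2 := by
  set m := ∫ s in (0 : ℝ)..1, a s with hm
  have h : 0 ≤ ∫ s in (0 : ℝ)..1, (a s - m) ^ 2 :=
    intervalIntegral.integral_nonneg zero_le_one fun _ _ => sq_nonneg _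
  have e : ∫ s in (0 : ℝ)..1, (a s - m) ^ 2 = (∫ s in (0 : ℝ)..1, a s ^ 2) - m ^ 2 := by
    have : ∀ s, (a s - m) ^ 2 = a s ^ 2 - 2 * m * a s + m ^ 2 := fun s => by ring
    simp only [this]
    rw [intervalIntegral.integral_add, intervalIntegral.integral_sub,
      intervalIntegral.integral_const_mul, ← hm]
    · simp; ring
    all_goals exact Continuous.intervalIntegrable (by fun_prop) _ _
  linarith

lemma norm_translate_sub_sq_le {f : Plane → V} (hf : ContDiff ℝ 1 f) (h x : Plane) :
    ‖f (x + h) - f x‖ ^ 2 ≤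
      ∫ s in (0 : ℝ)..1, ‖h‖ ^ 2 * ∑ i, ‖pderiv i f (x + s • h)‖ ^ 2 := by
  have hc : Continuous (fun s : ℝ => fderiv ℝ f (x + s • h) h) :=
    ((hf.continuous_fderiv (by norm_num)).comp (by fun_prop)).clm_apply continuous_const
  have hp : ∀ i, Continuous (pderiv i f) := fun i =>
    (contDiff_pderiv (n := 0) hf (by norm_num) i).continuous
  have e : ∫ s in (0 : ℝ)..1, fderiv ℝ f (x + s • h) h = f (x + h) - f x := by
    have := intervalIntegral.integral_eq_sub_of_hasDerivAt (a := 0) (b := 1)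
      (f := fun s : ℝ => f (x + s • h)) (f' := fun s : ℝ => fderiv ℝ f (x + s • h) h)
      (fun s _ => by
        have h1 : HasDerivAt (fun s : ℝ => x + s • h) h s := by
          simpa using ((hasDerivAt_id s).smul_const h).const_add x
        exact ((hf.differentiable (by norm_num) _).hasFDerivAt.comp_hasDerivAt s h1))
      (hc.intervalIntegrable _ _)
    simpa using this
  rw [← e]
  calc ‖∫ s in (0 : ℝ)..1, fderiv ℝ f (x + s • h) h‖ ^ 2
      ≤ (∫ s in (0 : ℝ)..1, ‖fderiv ℝ f (x + s • h) h‖) ^ 2 :=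
        pow_le_pow_left₀ (norm_nonneg _)
          (intervalIntegral.norm_integral_le_integral_norm zero_le_one) 2
    _ ≤ ∫ s in (0 : ℝ)..1, ‖fderiv ℝ f (x + s • h) h‖ ^ 2 := sq_integral_le hc.norm
    _ ≤ _ := by
        refine intervalIntegral.integral_mono zero_le_one
          ((hc.norm.pow 2).intervalIntegrable _ _)
          (Continuous.intervalIntegrable (by fun_prop) _ _) fun s => ?_
        exact norm_fderiv_apply_sq_le f _ h

lemma translate_sub_memLp {f : Plane → V} (hf : ContDiff ℝ 1 f)
    (hf' : ∀ i, MemLp (pderiv i f) 2) (h : Plane) :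
    MemLp (fun x => f (x + h) - f x) 2 ∧
    l2Sq (fun x => f (x + h) - f x) ≤ ‖h‖ ^ 2 * ∫ x, ∑ i, ‖pderiv i f x‖ ^ 2 := by
  have hp : ∀ i, Continuous (pderiv i f) := fun i =>
    (contDiff_pderiv (n := 0) hf (by norm_num) i).continuous
  have hDi : Integrable (fun x => ∑ i, ‖pderiv i f x‖ ^ 2) :=
    integrable_finsetSum _ fun i _ => integrable_sq (hf' i)
  set D : Plane → ℝ := fun x => ∑ i, ‖pderiv i f x‖ ^ 2 with hD
  have hDc : Continuous D := by fun_prop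
  have hD0 : ∀ x, 0 ≤ D x := fun x => Finset.sum_nonneg fun i _ => sq_nonneg _
  have hfc : Continuous f := hf.continuous
  have hm : Continuous (fun x => f (x + h) - f x) := by fun_prop
  have hle : ∀ x, ENNReal.ofReal (‖f (x + h) - f x‖ ^ 2) ≤
      ∫⁻ s in Ioc (0 : ℝ) 1, ENNReal.ofReal (‖h‖ ^ 2 * D (x + s • h)) := by
    intro x
    have := norm_translate_sub_sq_le hf h x
    rw [intervalIntegral.integral_of_le zero_le_one] at this
    refine (ENNReal.ofReal_le_ofReal this).trans_eq ?_
    refine ofReal_integral_eq_lintegral_ofReal ?_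
      (ae_of_all _ fun s => mul_nonneg (sq_nonneg _) (hD0 _))
    exact (Continuous.integrableOn_Icc (by fun_prop)).mono_set Ioc_subset_Icc_self
  have hmain : ∫⁻ x, ENNReal.ofReal (‖f (x + h) - f x‖ ^ 2) ≤
      ENNReal.ofReal (‖h‖ ^ 2 * ∫ x, D x) := by
    calc _ ≤ ∫⁻ x, ∫⁻ s in Ioc (0 : ℝ) 1, ENNReal.ofReal (‖h‖ ^ 2 * D (x + s • h)) :=
          lintegral_mono hle
      _ = ∫⁻ s in Ioc (0 : ℝ) 1, ∫⁻ x, ENNReal.ofReal (‖h‖ ^ 2 * D (x + s • h)) := by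
          refine lintegral_lintegral_swap (Continuous.aemeasurable ?_)
          exact ENNReal.continuous_ofReal.comp (by fun_prop)
      _ = ∫⁻ s in Ioc (0 : ℝ) 1, ENNReal.ofReal (‖h‖ ^ 2 * ∫ x, D x) := by
          refine lintegral_congr fun s => ?_
          rw [lintegral_add_right_eq_self (fun x => ENNReal.ofReal (‖h‖ ^ 2 * D x)) (s • h),
            ← integral_const_mul, ofReal_integral_eq_lintegral_ofReal (hDi.const_mul _)
              (ae_of_all _ fun s => mul_nonneg (sq_nonneg _) (hD0 _))]
      _ = _ := by simp
  have hint : Integrable (fun x => ‖f (x + h) - f x‖ ^ 2) := by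
    refine ⟨(hm.norm.pow 2).aestronglyMeasurable, ?_⟩
    rw [hasFiniteIntegral_iff_ofReal (ae_of_all _ fun x => sq_nonneg _)]
    exact hmain.trans_lt ENNReal.ofReal_lt_top
  refine ⟨(memLp_two_iff hm.aestronglyMeasurable).2 hint, ?_⟩
  have h0 : 0 ≤ ∫ x, D x := integral_nonneg hD0
  rw [← ofReal_integral_eq_lintegral_ofReal hint (ae_of_all _ fun x => sq_nonneg _)] at hmain
  exact (ENNReal.ofReal_le_ofReal_iff (by positivity)).1 hmain

end translation

/-! ### Gradients are orthogonal to divergence-free fields -/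

lemma tendsto_l2Sq_indicator {V : Type*} [NormedAddCommGroup V] {f : Plane → V}
    (hf : MemLp f 2) :
    Tendsto (fun n : ℕ => l2Sq ({x : Plane | (n : ℝ) < ‖x‖}.indicator f)) atTop (𝓝 0) := by
  have h := tendsto_integral_of_dominated_convergence (μ := (volume : Measure Plane))
    (F := fun (n : ℕ) x => ‖({x : Plane | (n : ℝ) < ‖x‖}.indicator f) x‖ ^ 2) (f := fun _ => 0)
    (fun x => ‖f x‖ ^ 2)
    (fun n => ((hf.1.indicator
      (measurableSet_lt measurable_const measurable_norm)).norm.pow 2))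
    (integrable_sq hf)
    (fun n => ae_of_all _ fun x => by
      rw [Real.norm_of_nonneg (by positivity)]
      exact pow_le_pow_left₀ (norm_nonneg _) (norm_indicator_le_norm_self _ _) 2)
    (ae_of_all _ fun x => by
      obtain ⟨N, hN⟩ := exists_nat_ge ‖x‖
      refine tendsto_const_nhds.congr' ?_
      filter_upwards [eventually_ge_atTop N] with n hn
      have : ¬ ((n : ℝ) < ‖x‖) := by
        have : (N : ℝ) ≤ n := by exact_mod_cast hn
        linarith
      simp [this])
  simpa [l2Sq] using h

lemma l2Sq_comp_add {V : Type*} [NormedAddCommGroup V] (f : Plane → V) (h : Plane) :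
    l2Sq (fun x => f (x + h)) = l2Sq f :=
  integral_add_right_eq_self (fun x => ‖f x‖ ^ 2) h

lemma memLp_comp_add {V : Type*} [NormedAddCommGroup V] {f : Plane → V} (hf : MemLp f 2)
    (h : Plane) : MemLp (fun x => f (x + h)) 2 :=
  hf.comp_measurePreserving (measurePreserving_add_right volume h)

/-- A square-integrable pairing that is invariant under all translations of one factor vanishes. -/
lemma integral_inner_eq_zero_of_translate {v q : Plane → Plane} (hv : MemLp v 2) (hq : MemLp q 2)
    (h : ∀ a, ∫ x, inner ℝ (v x) (q (x + a)) = ∫ x, inner ℝ (v x) (q x)) :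
    ∫ x, inner ℝ (v x) (q x) = 0 := by
  have hs : ∀ n : ℕ, MeasurableSet {x : Plane | (n : ℝ) < ‖x‖} := fun n =>
    measurableSet_lt measurable_const measurable_norm
  have key : ∀ n : ℕ, |∫ x, inner ℝ (v x) (q x)| ≤
      √(l2Sq ({x : Plane | (n : ℝ) < ‖x‖}.indicator v)) * √(l2Sq q) +
      √(l2Sq v) * √(l2Sq ({x : Plane | (n : ℝ) < ‖x‖}.indicator q)) := by
    intro n
    set S := {x : Plane | (n : ℝ) < ‖x‖} with hS
    let a : Plane := EuclideanSpace.single 0 (2 * (n : ℝ) + 1)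
    have ha : ‖a‖ = 2 * n + 1 := by
      simp only [a]
      rw [PiLp.norm_single]
      exact Real.norm_of_nonneg (by positivity)
    have hv' : MemLp (S.indicator v) 2 := hv.indicator (hs n)
    have hq' : MemLp (fun x => S.indicator q (x + a)) 2 :=
      memLp_comp_add (f := S.indicator q) (hq.indicator (hs n)) a
    have hqa : MemLp (fun x => q (x + a)) 2 := memLp_comp_add (f := q) hq a
    rw [← h a, ← l2Sq_comp_add q a, ← l2Sq_comp_add (S.indicator q) a]
    refine le_trans ?_ (add_le_add (integral_norm_mul_le hv' hqa) (integral_norm_mul_le hv hq'))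
    rw [← integral_add (integrable_norm_mul hv' hqa) (integrable_norm_mul hv hq')]
    rw [← Real.norm_eq_abs]
    refine norm_integral_le_of_norm_le
      ((integrable_norm_mul hv' hqa).add (integrable_norm_mul hv hq')) (ae_of_all _ fun x => ?_)
    refine (norm_inner_le_norm (𝕜 := ℝ) (v x) (q (x + a))).trans ?_
    by_cases hx : x ∈ S
    · rw [indicator_of_mem hx]
      exact le_add_of_nonneg_right (by positivity)
    · have hxa : x + a ∈ S := by
        simp only [hS, mem_ofPred_eq, not_lt] at hx ⊢
        have := norm_sub_le (x + a) x
        rw [add_sub_cancel_left, ha] at this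
        linarith
      rw [indicator_of_mem hxa]
      exact le_add_of_nonneg_left (by positivity)
  have h1 := ((tendsto_l2Sq_indicator hv).sqrt.mul_const √(l2Sq q)).add
    ((tendsto_l2Sq_indicator hq).sqrt.const_mul √(l2Sq v))
  simp only [Real.sqrt_zero, zero_mul, mul_zero, add_zero] at h1
  exact abs_eq_zero.1 (le_antisymm (ge_of_tendsto' h1 key) (abs_nonneg _))

lemma contDiff_one_of_gradient {p : Plane → ℝ} (hp : Differentiable ℝ p)
    (hc : Continuous (gradient p)) : ContDiff ℝ 1 p := by
  rw [contDiff_one_iff_fderiv]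
  refine ⟨hp, ?_⟩
  have : fderiv ℝ p = fun x => InnerProductSpace.toDual ℝ Plane (gradient p x) := by
    funext x
    simp [gradient]
  rw [this]
  exact (LinearIsometryEquiv.continuous _).comp hc

lemma pderiv_eq_gradient (p : Plane → ℝ) (i : Fin 2) (x : Plane) :
    pderiv i p x = gradient p x i := by
  rw [pderiv, ← inner_gradient, EuclideanSpace.inner_single_right]
  simp

lemma integral_inner_gradient_eq_zero_of_memLp {v : Plane → Plane} {p : Plane → ℝ}
    (hv : Differentiable ℝ v) (hv2 : MemLp v 2) (hv' : ∀ i, MemLp (pderiv i v) 2)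
    (hdiv : ∀ x, divergence v x = 0) (hp : Differentiable ℝ p) (hp2 : MemLp p 2)
    (hp' : ∀ i, MemLp (pderiv i p) 2) :
    ∫ x, ∑ i, v x i * pderiv i p x = 0 := by
  have hvi : ∀ i, MemLp (fun x => v x i) 2 := fun i =>
    (EuclideanSpace.proj (𝕜 := ℝ) i).comp_memLp' hv2
  have hvd : ∀ i, Differentiable ℝ (fun x => v x i) := fun i =>
    (EuclideanSpace.proj (𝕜 := ℝ) i).differentiable.comp hv
  have hvi' : ∀ i, MemLp (pderiv i (fun x => v x i)) 2 := fun i => by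
    have : pderiv i (fun x => v x i) = fun x => pderiv i v x i :=
      funext fun x => pderiv_apply (hv x) i i
    rw [this]
    exact (EuclideanSpace.proj (𝕜 := ℝ) i).comp_memLp' (hv' i)
  have hI : ∀ i, Integrable (fun x => v x i * pderiv i p x) := fun i =>
    (hvi i).integrable_mul (hp' i)
  have hI' : ∀ i, Integrable (fun x => pderiv i v x i * p x) := fun i =>
    ((EuclideanSpace.proj (𝕜 := ℝ) i).comp_memLp' (hv' i)).integrable_mul hp2
  have e : ∀ i, ∫ x, v x i * pderiv i p x = - ∫ x, pderiv i v x i * p x := fun i => by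
    have := integral_inner_pderiv_of_memLp i hp (hvd i) hp2 (hvi i) (hp' i) (hvi' i)
    simp only [RCLike.inner_apply, conj_trivial] at this
    have h2 : ∀ x, pderiv i (fun x => v x i) x = pderiv i v x i := fun x => pderiv_apply (hv x) i i
    simp only [h2] at this
    linarith
  rw [integral_finsetSum _ fun i _ => hI i]
  simp only [e]
  rw [Finset.sum_neg_distrib, ← integral_finsetSum _ fun i _ => hI' i]
  have : ∀ x, ∑ i, pderiv i v x i * p x = 0 := fun x => by
    rw [← Finset.sum_mul]
    have := hdiv x
    rw [divergence] at this
    rw [this, zero_mul]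
  simp [this]

/-- A square-integrable gradient is orthogonal to divergence-free `H¹` fields. -/
lemma integral_inner_gradient_eq_zero {v : Plane → Plane} {p : Plane → ℝ}
    (hv : Differentiable ℝ v) (hv2 : MemLp v 2) (hv' : ∀ i, MemLp (pderiv i v) 2)
    (hdiv : ∀ x, divergence v x = 0) (hp : Differentiable ℝ p) (hc : Continuous (gradient p))
    (hp' : MemLp (gradient p) 2) :
    ∫ x, inner ℝ (v x) (gradient p x) = 0 := by
  have hpi : ∀ i, MemLp (pderiv i p) 2 := fun i => by
    have : pderiv i p = fun x => gradient p x i := funext fun x => pderiv_eq_gradient p i x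
    rw [this]
    exact (EuclideanSpace.proj (𝕜 := ℝ) i).comp_memLp' hp'
  refine integral_inner_eq_zero_of_translate hv2 hp' fun a => ?_
  have hda : Differentiable ℝ (fun x => p (x + a)) := hp.comp (by fun_prop)
  have hpa : ∀ i x, pderiv i (fun x => p (x + a)) x = pderiv i p (x + a) := fun i x => by
    unfold pderiv; rw [fderiv_comp_add_right]
  have hsub : ∀ i x, pderiv i (fun x => p (x + a) - p x) x
      = pderiv i p (x + a) - pderiv i p x := fun i x => by
    rw [← hpa]; unfold pderiv; rw [fderiv_fun_sub (hda x) (hp x)]; rfl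
  have h := integral_inner_gradient_eq_zero_of_memLp hv hv2 hv' hdiv (hda.sub hp)
    (translate_sub_memLp (contDiff_one_of_gradient hp hc) hpi a).1
    (fun i => by
      have : pderiv i ((fun x => p (x + a)) - p) = fun x => pderiv i p (x + a) - pderiv i p x :=
        funext fun x => hsub i x
      rw [this]
      exact (memLp_comp_add (hpi i) a).sub (hpi i))
  rw [← sub_eq_zero, ← integral_sub (integrable_inner hv2 (memLp_comp_add hp' a))
    (integrable_inner hv2 hp'), ← h]
  refine integral_congr_ae (ae_of_all _ fun x => ?_)
  simp only
  rw [← inner_sub_right, PiLp.inner_apply]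
  refine Finset.sum_congr rfl fun i _ => ?_
  have : pderiv i ((fun x => p (x + a)) - p) x = pderiv i p (x + a) - pderiv i p x := hsub i x
  rw [this, pderiv_eq_gradient, pderiv_eq_gradient]
  simp [mul_comm]

/-! ### Ladyzhenskaya's inequality -/

lemma exists_cutoff : ∃ (χ : ℕ → Plane → ℝ) (M : ℝ), 0 ≤ M ∧ (∀ n, ContDiff ℝ 1 (χ n)) ∧
    (∀ n, HasCompactSupport (χ n)) ∧ (∀ n x, |χ n x| ≤ 1) ∧
    (∀ n x, ‖fderiv ℝ (χ n) x‖ ≤ M / (n + 1)) ∧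
    ∀ x, ∀ᶠ n in atTop, χ n x = 1 := by
  let b : ContDiffBump (0 : Plane) := ⟨1, 2, by norm_num, by norm_num⟩
  have hb : ContDiff ℝ 1 (b : Plane → ℝ) := b.contDiff
  obtain ⟨M, hM⟩ := (hb.continuous_fderiv (by norm_num)).bounded_above_of_compact_support
    (b.hasCompactSupport.fderiv ℝ)
  have hM0 : 0 ≤ M := (norm_nonneg _).trans (hM 0)
  refine ⟨fun n x => b (((n : ℝ) + 1)⁻¹ • x), M, hM0, fun n => hb.comp (by fun_prop), fun n => ?_,
    fun n x => ?_, fun n x => ?_, fun x => ?_⟩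
  · exact b.hasCompactSupport.comp_smul (by positivity)
  · rw [abs_of_nonneg b.nonneg]
    exact b.le_one
  · have h1 : HasFDerivAt (fun x : Plane => ((n : ℝ) + 1)⁻¹ • x)
        (((n : ℝ) + 1)⁻¹ • ContinuousLinearMap.id ℝ Plane) x :=
      HasFDerivAt.fun_const_smul (f := fun y : Plane => y) (hasFDerivAt_id (𝕜 := ℝ) x) _
    have h2 := (((hb.differentiable (by norm_num)) (((n : ℝ) + 1)⁻¹ • x)).hasFDerivAt.comp x
      h1).fderiv
    have h3 : fderiv ℝ (fun x => b (((n : ℝ) + 1)⁻¹ • x)) x = _ := h2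
    rw [h3]
    have : ‖(((n : ℝ) + 1)⁻¹ • ContinuousLinearMap.id ℝ Plane)‖ ≤ ((n : ℝ) + 1)⁻¹ := by
      rw [norm_smul, Real.norm_of_nonneg (by positivity)]
      exact mul_le_of_le_one_right (by positivity) ContinuousLinearMap.norm_id_le
    refine (ContinuousLinearMap.opNorm_comp_le _ _).trans ?_
    rw [div_eq_mul_inv]
    exact mul_le_mul (hM _) this (norm_nonneg _) hM0
  · obtain ⟨N, hN⟩ := exists_nat_ge ‖x‖
    filter_upwards [eventually_ge_atTop N] with n hn
    refine b.one_of_mem_closedBall ?_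
    rw [mem_closedBall_zero_iff, norm_smul, Real.norm_of_nonneg (by positivity), inv_mul_le_iff₀
      (by positivity)]
    have : (N : ℝ) ≤ n := by exact_mod_cast hn
    show ‖x‖ ≤ (n + 1) * 1
    linarith

/-- The embedding of `W^{1,1}(ℝ²)` into `L²(ℝ²)`. -/
lemma exists_lintegral_sq_le : ∃ C : ℝ, 0 ≤ C ∧ ∀ g : Plane → ℝ, ContDiff ℝ 1 g → Integrable g →
    Integrable (fun x => ‖fderiv ℝ g x‖) →
    ∫⁻ x, ENNReal.ofReal (g x ^ 2) ≤ ENNReal.ofReal (C * (∫ x, ‖fderiv ℝ g x‖) ^ 2) := by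
  obtain ⟨χ, M, hM0, hχ, hχc, hχ1, hχ', hχlim⟩ := exists_cutoff
  set C : NNReal := lintegralPowLePowLIntegralFDerivConst (volume : Measure Plane) 2
  refine ⟨C, C.2, fun g hg hgi hgi' => ?_⟩
  have hdim : ((Module.finrank ℝ Plane : ℕ) : ℝ).HolderConjugate 2 := by
    rw [finrank_euclideanSpace_fin]
    exact_mod_cast Real.HolderConjugate.two_two
  set I := ∫ x, ‖fderiv ℝ g x‖
  set J := ∫ x, |g x|
  have hI0 : 0 ≤ I := integral_nonneg fun x => norm_nonneg _
  have hJ0 : 0 ≤ J := integral_nonneg fun x => abs_nonneg _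
  have hn : ∀ n : ℕ, ∫⁻ x, ENNReal.ofReal ((χ n x * g x) ^ 2) ≤
      ENNReal.ofReal (C * (I + M / (n + 1) * J) ^ 2) := by
    intro n
    have hG : ContDiff ℝ 1 (fun x => χ n x * g x) := (hχ n).mul hg
    have hGc : HasCompactSupport (fun x => χ n x * g x) := (hχc n).mul_right
    have h1 := lintegral_pow_le_pow_lintegral_fderiv (volume : Measure Plane) hG hGc hdim
    have h2 : ∫⁻ x, ‖fderiv ℝ (fun x => χ n x * g x) x‖ₑ ≤
        ENNReal.ofReal (I + M / (n + 1) * J) := by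
      have hint : Integrable (fun x => ‖fderiv ℝ g x‖ + M / (n + 1) * |g x|) :=
        hgi'.add (hgi.abs.const_mul _)
      have e : I + M / (n + 1) * J = ∫ x, (‖fderiv ℝ g x‖ + M / (n + 1) * |g x|) := by
        rw [integral_add hgi' (hgi.abs.const_mul _), integral_const_mul]
      rw [e, ofReal_integral_eq_lintegral_ofReal hint (ae_of_all _ fun x => by positivity)]
      refine lintegral_mono fun x => ?_
      rw [← ofReal_norm]
      refine ENNReal.ofReal_le_ofReal ?_
      rw [fderiv_fun_mul ((hχ n).differentiable (by norm_num) x)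
        (hg.differentiable (by norm_num) x)]
      refine (norm_add_le _ _).trans ?_
      rw [norm_smul, norm_smul, Real.norm_eq_abs, Real.norm_eq_abs, mul_comm (|g x|)]
      refine add_le_add ?_ (mul_le_mul_of_nonneg_right (hχ' n x) (abs_nonneg _))
      exact mul_le_of_le_one_left (norm_nonneg _) (hχ1 n x)
    calc ∫⁻ x, ENNReal.ofReal ((χ n x * g x) ^ 2) = ∫⁻ x, ‖χ n x * g x‖ₑ ^ (2 : ℝ) := by
          refine lintegral_congr fun x => ?_
          rw [← ofReal_norm, ENNReal.ofReal_rpow_of_nonneg (norm_nonneg _) (by norm_num)]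
          congr 1
          simp [← abs_mul]
      _ ≤ C * (∫⁻ x, ‖fderiv ℝ (fun x => χ n x * g x) x‖ₑ) ^ (2 : ℝ) := h1
      _ ≤ C * (ENNReal.ofReal (I + M / (n + 1) * J)) ^ (2 : ℝ) := by gcongr
      _ = _ := by
          rw [ENNReal.ofReal_rpow_of_nonneg (by positivity) (by norm_num),
            ENNReal.ofReal_mul (NNReal.coe_nonneg C)]
          simp
  have hlim : Tendsto (fun n : ℕ => ENNReal.ofReal (C * (I + M / ((n : ℝ) + 1) * J) ^ 2)) atTop
      (𝓝 (ENNReal.ofReal (C * I ^ 2))) := by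
    refine ENNReal.tendsto_ofReal ?_
    have h0 : Tendsto (fun n : ℕ => M / ((n : ℝ) + 1)) atTop (𝓝 0) := by
      simpa [div_eq_mul_inv] using tendsto_one_div_add_atTop_nhds_zero_nat.const_mul M
    simpa using (((h0.mul_const J).const_add I).pow 2).const_mul (C : ℝ)
  calc ∫⁻ x, ENNReal.ofReal (g x ^ 2)
      = ∫⁻ x, liminf (fun n => ENNReal.ofReal ((χ n x * g x) ^ 2)) atTop := by
        refine lintegral_congr fun x => ?_
        refine (Tendsto.liminf_eq ?_).symm
        refine tendsto_const_nhds.congr' ?_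
        filter_upwards [hχlim x] with n h
        rw [h, one_mul]
    _ ≤ liminf (fun n => ∫⁻ x, ENNReal.ofReal ((χ n x * g x) ^ 2)) atTop :=
        lintegral_liminf_le' fun n => ((((hχ n).continuous.mul hg.continuous).pow
          2).measurable.ennreal_ofReal).aemeasurable
    _ ≤ liminf (fun n : ℕ => ENNReal.ofReal (C * (I + M / ((n : ℝ) + 1) * J) ^ 2)) atTop :=
        liminf_le_liminf (Eventually.of_forall hn)
    _ = _ := hlim.liminf_eq

lemma gradL2Sq_nonneg (v : Plane → Plane) : 0 ≤ gradL2Sq v :=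
  integral_nonneg fun _ => Finset.sum_nonneg fun _ _ => sq_nonneg _

lemma integrable_sum_sq {v : Plane → Plane} (hv : ∀ i, MemLp (pderiv i v) 2) :
    Integrable (fun x => ∑ i, ‖pderiv i v x‖ ^ 2) :=
  integrable_finsetSum _ fun i _ => integrable_sq (hv i)

/-- Ladyzhenskaya's inequality. -/
lemma exists_integral_pow_four_le : ∃ C : ℝ, 0 < C ∧ ∀ f : Plane → Plane, ContDiff ℝ 1 f →
    MemLp f 2 → (∀ i, MemLp (pderiv i f) 2) →
    Integrable (fun x => ‖f x‖ ^ 4) ∧ ∫ x, ‖f x‖ ^ 4 ≤ C * (l2Sq f * gradL2Sq f) := by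
  obtain ⟨C, hC, h⟩ := exists_lintegral_sq_le
  refine ⟨4 * C + 1, by positivity, fun f hf hf2 hf' => ?_⟩
  have hd : Differentiable ℝ f := hf.differentiable (by norm_num)
  have hg : ContDiff ℝ 1 (fun x => ‖f x‖ ^ 2) := hf.norm_sq ℝ
  have hfd : Continuous (fderiv ℝ f) := hf.continuous_fderiv (by norm_num)
  have hfd2 : MemLp (fderiv ℝ f) 2 := by
    rw [memLp_two_iff hfd.aestronglyMeasurable]
    exact (integrable_sum_sq hf').mono' (hfd.norm.pow 2).aestronglyMeasurable
      (ae_of_all _ fun x => by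
        rw [Real.norm_of_nonneg (by positivity)]; exact norm_fderiv_sq_le f x)
  have hfdl : l2Sq (fderiv ℝ f) ≤ gradL2Sq f :=
    integral_mono (integrable_sq hfd2) (integrable_sum_sq hf') fun x => norm_fderiv_sq_le f x
  have hle : ∀ x, ‖fderiv ℝ (fun x => ‖f x‖ ^ 2) x‖ ≤ 2 * (‖f x‖ * ‖fderiv ℝ f x‖) := by
    intro x
    refine ContinuousLinearMap.opNorm_le_bound _ (by positivity) fun w => ?_
    have := ((hd x).hasFDerivAt.norm_sq).fderiv
    rw [this]
    simp only [_root_.smul_apply, ContinuousLinearMap.comp_apply, innerSL_apply_apply]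
    rw [nsmul_eq_mul, norm_mul]
    have h1 := norm_inner_le_norm (𝕜 := ℝ) (f x) (fderiv ℝ f x w)
    have h2 := (fderiv ℝ f x).le_opNorm w
    have h3 : ‖f x‖ * ‖fderiv ℝ f x w‖ ≤ ‖f x‖ * (‖fderiv ℝ f x‖ * ‖w‖) :=
      mul_le_mul_of_nonneg_left h2 (norm_nonneg _)
    have e : ‖((2 : ℕ) : ℝ)‖ = 2 := by simp
    rw [e]
    nlinarith
  have hi2 : Integrable (fun x => 2 * (‖f x‖ * ‖fderiv ℝ f x‖)) :=
    (integrable_norm_mul hf2 hfd2).const_mul 2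
  have hgi' : Integrable (fun x => ‖fderiv ℝ (fun x => ‖f x‖ ^ 2) x‖) :=
    hi2.mono' (hg.continuous_fderiv (by norm_num)).norm.aestronglyMeasurable
      (ae_of_all _ fun x => by rw [norm_norm]; exact hle x)
  have h1 := h _ hg (integrable_sq hf2) hgi'
  have hI : ∫ x, ‖fderiv ℝ (fun x => ‖f x‖ ^ 2) x‖ ≤ 2 * (√(l2Sq f) * √(gradL2Sq f)) := by
    refine (integral_mono hgi' hi2 hle).trans ?_
    rw [integral_const_mul]
    have h3 := integral_norm_mul_le hf2 hfd2
    have h4 : √(l2Sq f) * √(l2Sq (fderiv ℝ f)) ≤ √(l2Sq f) * √(gradL2Sq f) := by gcongr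
    linarith
  have hI0 : 0 ≤ ∫ x, ‖fderiv ℝ (fun x => ‖f x‖ ^ 2) x‖ := integral_nonneg fun x => norm_nonneg _
  have e4 : ∀ x, (‖f x‖ ^ 2) ^ 2 = ‖f x‖ ^ 4 := fun x => by ring
  simp only [e4] at h1
  have hint : Integrable (fun x => ‖f x‖ ^ 4) := by
    refine ⟨(hf.continuous.norm.pow 4).aestronglyMeasurable, ?_⟩
    rw [hasFiniteIntegral_iff_ofReal (ae_of_all _ fun x => by positivity)]
    exact h1.trans_lt ENNReal.ofReal_lt_top
  refine ⟨hint, ?_⟩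
  rw [← ofReal_integral_eq_lintegral_ofReal hint (ae_of_all _ fun x => by positivity),
    ENNReal.ofReal_le_ofReal_iff (by positivity)] at h1
  have hl := l2Sq_nonneg f
  have hgr := gradL2Sq_nonneg f
  have h5 : (∫ x, ‖fderiv ℝ (fun x => ‖f x‖ ^ 2) x‖) ^ 2 ≤ 4 * (l2Sq f * gradL2Sq f) := by
    refine (pow_le_pow_left₀ hI0 hI 2).trans_eq ?_
    rw [mul_pow, mul_pow, Real.sq_sqrt hl, Real.sq_sqrt hgr]
    ring
  have h6 : 0 ≤ l2Sq f * gradL2Sq f := mul_nonneg hl hgr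
  nlinarith

/-! ### Differentiation under the integral sign -/

lemma integral_sub_eq_integral_integral {g g' : ℝ → Plane → ℝ} {s t : ℝ} (hst : s ≤ t)
    (hg : ∀ x, ContinuousOn (fun r => g r x) (Icc s t))
    (hd : ∀ x, ∀ r ∈ Ioo s t, HasDerivAt (fun r => g r x) (g' r x) r)
    (hi : Integrable (fun q : ℝ × Plane => g' q.1 q.2) ((volume.restrict (Ioc s t)).prod volume))
    (hs : Integrable (g s)) (ht : Integrable (g t)) :
    (∫ x, g t x) - ∫ x, g s x = ∫ r in s..t, ∫ x, g' r x := by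
  rw [intervalIntegral.integral_of_le hst, integral_integral_swap hi, ← integral_sub ht hs]
  refine integral_congr_ae ?_
  filter_upwards [hi.prod_left_ae] with x hx
  rw [← intervalIntegral.integral_of_le hst]
  exact (intervalIntegral.integral_eq_sub_of_hasDerivAt_of_le hst (hg x) (hd x)
    ((intervalIntegrable_iff_integrableOn_Ioc_of_le hst).2 hx)).symm

lemma aestronglyMeasurable_prod_of_continuousOn {V : Type*} [NormedAddCommGroup V]
    {f : ℝ × Plane → V} {s t : ℝ} (hf : ContinuousOn f (Ioc s t ×ˢ univ)) :
    AEStronglyMeasurable f ((volume.restrict (Ioc s t)).prod volume) := by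
  have : (volume.restrict (Ioc s t)).prod (volume : Measure Plane) =
      (volume.prod volume).restrict (Ioc s t ×ˢ univ) := by
    rw [← Measure.prod_restrict, Measure.restrict_univ]
  rw [this]
  exact hf.aestronglyMeasurable (measurableSet_Ioc.prod MeasurableSet.univ)

lemma integrable_prod_sq {V : Type*} [NormedAddCommGroup V] {f : ℝ → Plane → V} {s t M : ℝ}
    (hf : ContinuousOn (fun q : ℝ × Plane => f q.1 q.2) (Ioc s t ×ˢ univ))
    (h2 : ∀ r ∈ Ioc s t, MemLp (f r) 2) (hM : ∀ r ∈ Ioc s t, l2Sq (f r) ≤ M) :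
    Integrable (fun q : ℝ × Plane => ‖f q.1 q.2‖ ^ 2) ((volume.restrict (Ioc s t)).prod volume) := by
  have hm : AEStronglyMeasurable (fun q : ℝ × Plane => ‖f q.1 q.2‖ ^ 2)
      ((volume.restrict (Ioc s t)).prod volume) :=
    aestronglyMeasurable_prod_of_continuousOn (hf.norm.pow 2)
  rw [integrable_prod_iff hm]
  refine ⟨?_, ?_⟩
  · filter_upwards [ae_restrict_mem measurableSet_Ioc] with r hr
    exact integrable_sq (h2 r hr)
  · refine Integrable.mono' (g := fun _ => M) (integrable_const M)
      hm.norm.integral_prod_right' ?_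
    filter_upwards [ae_restrict_mem measurableSet_Ioc] with r hr
    have h0 : ∫ x, ‖‖f r x‖ ^ 2‖ = l2Sq (f r) := by simp [l2Sq]
    rw [h0, Real.norm_of_nonneg (l2Sq_nonneg _)]
    exact hM r hr

lemma SmoothSobolev.integrable_prod {V : Type*} [NormedAddCommGroup V] [NormedSpace ℝ V]
    {f : ℝ → Plane → V} (hf : SmoothSobolev f) {s t : ℝ} (hs : 0 ≤ s) :
    Integrable (fun q : ℝ × Plane => ‖f q.1 q.2‖ ^ 2) ((volume.restrict (Ioc s t)).prod volume) := by
  obtain ⟨M, hM⟩ := hf.exists_l2Sq_le t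
  exact integrable_prod_sq
    (hf.continuousOn.mono (prod_mono (fun r hr => hs.trans hr.1.le) subset_rfl))
    (fun r hr => hf.memLp (hs.trans hr.1.le)) (fun r hr => hM r ⟨hs.trans hr.1.le, hr.2⟩)

/-! ### Transport by a divergence-free field -/

lemma norm_fderiv_apply_le {V : Type*} [NormedAddCommGroup V] [NormedSpace ℝ V] {f : Plane → V}
    {x : Plane} {M : ℝ} (hM : ∀ i, ‖pderiv i f x‖ ≤ M) (v : Plane) :
    ‖fderiv ℝ f x v‖ ≤ 2 * M * ‖v‖ := by
  rw [fderiv_apply_eq_sum]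
  refine (norm_sum_le _ _).trans ?_
  have h : ∀ i ∈ (Finset.univ : Finset (Fin 2)), ‖v i • pderiv i f x‖ ≤ ‖v‖ * M := fun i _ => by
    rw [norm_smul]
    exact mul_le_mul (PiLp.norm_apply_le v i) (hM i) (norm_nonneg _) (norm_nonneg _)
  refine (Finset.sum_le_sum h).trans_eq ?_
  simp
  ring

lemma integral_fderiv_apply_eq_zero {v : Plane → Plane} {w : Plane → ℝ} {M : ℝ}
    (hv : ContDiff ℝ 1 v) (hM : ∀ x, ‖v x‖ ≤ M) (hM' : ∀ i x, ‖pderiv i v x‖ ≤ M)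
    (hdiv : ∀ x, divergence v x = 0) (hw : Differentiable ℝ w) (hwi : Integrable w)
    (hw' : ∀ i, Integrable (fun x => v x i * pderiv i w x)) :
    ∫ x, fderiv ℝ w x (v x) = 0 := by
  have hd : Differentiable ℝ v := hv.differentiable (by norm_num)
  have hdi : ∀ i, Differentiable ℝ (fun x => v x i) := fun i =>
    (EuclideanSpace.proj (𝕜 := ℝ) i).differentiable.comp hd
  have hp : ∀ i, Continuous (pderiv i v) := fun i =>
    (contDiff_pderiv (n := 0) hv (by norm_num) i).continuous
  have hI1 : ∀ i, Integrable (fun x => v x i * w x) := fun i => by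
    refine (hwi.norm.const_mul M).mono' ((hdi i).continuous.aestronglyMeasurable.mul hwi.1)
      (ae_of_all _ fun x => ?_)
    rw [norm_mul]
    exact mul_le_mul_of_nonneg_right ((PiLp.norm_apply_le _ i).trans (hM x)) (norm_nonneg _)
  have hI2 : ∀ i, Integrable (fun x => pderiv i v x i * w x) := fun i => by
    refine (hwi.norm.const_mul M).mono'
      (((EuclideanSpace.proj (𝕜 := ℝ) i).continuous.comp (hp i)).aestronglyMeasurable.mul hwi.1)
      (ae_of_all _ fun x => ?_)
    rw [norm_mul]
    exact mul_le_mul_of_nonneg_right ((PiLp.norm_apply_le _ i).trans (hM' i x)) (norm_nonneg _)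
  have e : ∀ i x, pderiv i (fun x => v x i * w x) x = v x i * pderiv i w x + pderiv i v x i * w x :=
    fun i x => by rw [pderiv_mul (hdi i x) (hw x), pderiv_apply (hd x)]
  have hz : ∀ i, ∫ x, (v x i * pderiv i w x + pderiv i v x i * w x) = 0 := fun i => by
    rw [← integral_pderiv_eq_zero i ((hdi i).mul hw) (hI1 i)
      (((hw' i).add (hI2 i)).congr (ae_of_all _ fun x => (e i x).symm))]
    exact integral_congr_ae (ae_of_all _ fun x => (e i x).symm)
  have e2 : ∀ x, fderiv ℝ w x (v x) = ∑ i, (v x i * pderiv i w x + pderiv i v x i * w x) := by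
    intro x
    have := hdiv x
    rw [divergence] at this
    rw [Finset.sum_add_distrib, ← Finset.sum_mul, this, fderiv_apply_eq_sum]
    simp
  have hI3 : ∀ i, Integrable (fun x => v x i * pderiv i w x + pderiv i v x i * w x) := fun i =>
    (hw' i).add (hI2 i)
  simp only [e2]
  rw [integral_finsetSum _ fun i _ => hI3 i]
  simp only [hz, Finset.sum_const_zero]

/-- The Laplacian, as the sum of the pure second derivatives. -/
def lap {V : Type*} [NormedAddCommGroup V] [NormedSpace ℝ V] (f : Plane → V) (x : Plane) : V :=
  ∑ i, pderiv i (pderiv i f) x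

lemma SmoothSobolev.lap {V : Type*} [NormedAddCommGroup V] [NormedSpace ℝ V]
    {f : ℝ → Plane → V} (hf : SmoothSobolev f) : SmoothSobolev (fun t x => lap (f t) x) := by
  have := ((hf.pderiv 0).pderiv 0).add ((hf.pderiv 1).pderiv 1)
  simpa only [INS2D.lap, Fin.sum_univ_two] using this

lemma integral_inner_lap {f g : Plane → Plane} (hf : Differentiable ℝ f)
    (hg : ∀ i, Differentiable ℝ (pderiv i g))
    (hf2 : MemLp f 2) (hf' : ∀ i, MemLp (pderiv i f) 2) (hg' : ∀ i, MemLp (pderiv i g) 2)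
    (hg'' : ∀ i, MemLp (pderiv i (pderiv i g)) 2) :
    ∫ x, inner ℝ (f x) (lap g x) = - ∫ x, ∑ i, inner ℝ (pderiv i f x) (pderiv i g x) := by
  have e : ∀ x, inner ℝ (f x) (lap g x) = ∑ i, inner ℝ (f x) (pderiv i (pderiv i g) x) :=
    fun x => by rw [lap, inner_sum]
  simp only [e]
  rw [integral_finsetSum _ fun i _ => integrable_inner hf2 (hg'' i),
    integral_finsetSum _ fun i _ => integrable_inner (hf' i) (hg' i), ← Finset.sum_neg_distrib]
  refine Finset.sum_congr rfl fun i _ => ?_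
  exact integral_inner_pderiv_of_memLp i hf (hg i) hf2 (hg' i) (hf' i) (hg'' i)

namespace IsSmoothSolution

variable {ρ : ℝ → Plane → ℝ} {u : ℝ → Plane → Plane} {P : ℝ → Plane → ℝ} {s t : ℝ}

lemma contDiff_density (h : IsSmoothSolution ρ u P) (ht : 0 ≤ t) : ContDiff ℝ ∞ (ρ t) := by
  simpa using (h.smooth_density.contDiff ht).add (contDiff_const (c := (1 : ℝ)))

lemma differentiable_density (h : IsSmoothSolution ρ u P) (ht : 0 ≤ t) : Differentiable ℝ (ρ t) :=
  (h.contDiff_density ht).differentiable (by simp)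

lemma smooth_pderiv_density (h : IsSmoothSolution ρ u P) (i : Fin 2) :
    SmoothSobolev (fun t x => pderiv i (ρ t) x) := by
  have := h.smooth_density.pderiv i
  simpa only [pderiv, fderiv_sub_const] using this

lemma continuousOn_density (h : IsSmoothSolution ρ u P) :
    ContinuousOn (fun q : ℝ × Plane => ρ q.1 q.2) (Ici 0 ×ˢ univ) := by
  exact (h.smooth_density.continuousOn.add (continuousOn_const (c := (1 : ℝ)))).congr
    fun q _ => (sub_add_cancel _ _).symm

lemma continuousOn_density_time (h : IsSmoothSolution ρ u P) (x : Plane) :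
    ContinuousOn (fun s => ρ s x) (Ici 0) := by
  exact ((h.smooth_density.continuousOn_time x).add (continuousOn_const (c := (1 : ℝ)))).congr
    fun q _ => (sub_add_cancel _ _).symm

lemma hasDerivAt_density (h : IsSmoothSolution ρ u P) (ht : 0 < t) (x : Plane) :
    HasDerivAt (fun s => ρ s x) (-fderiv ℝ (ρ t) x (u t x)) t := by
  have h1 : HasDerivAt (fun s => ρ s x) (timeDeriv (fun t x => ρ t x - 1) t x) t := by
    simpa using (h.smooth_density.hasDerivAt ht x).add_const 1
  have h2 : timeDeriv ρ t x = timeDeriv (fun t x => ρ t x - 1) t x :=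
    h1.hasDerivWithinAt.derivWithin (uniqueDiffOn_Ici 0 t ht.le)
  have h3 := h.mass t ht.le x
  rw [← h2] at h1
  rwa [← eq_neg_of_add_eq_zero_left h3]

lemma momentum' (h : IsSmoothSolution ρ u P) (ht : 0 ≤ t) (x : Plane) :
    ρ t x • timeDeriv u t x =
      lap (u t) x - gradient (P t) x - ρ t x • fderiv ℝ (u t) x (u t x) := by
  have h1 := h.momentum t ht x
  rw [laplacian_eq_sum (h.smooth_velocity.contDiff_two ht)] at h1
  rw [lap, ← sub_eq_zero, ← h1]
  abel

lemma exists_bounds (h : IsSmoothSolution ρ u P) (T : ℝ) : ∃ M, 0 ≤ M ∧ ∀ t ∈ Icc 0 T, ∀ x,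
    |ρ t x - 1| ≤ M ∧ |ρ t x| ≤ M ∧ ‖u t x‖ ≤ M ∧ (∀ i, ‖pderiv i (u t) x‖ ≤ M) ∧
    ∀ i, ‖pderiv i (ρ t) x‖ ≤ M := by
  obtain ⟨M1, h1, H1⟩ := h.smooth_density.exists_norm_le T
  obtain ⟨M2, h2, H2⟩ := h.smooth_velocity.exists_norm_le T
  obtain ⟨M3, h3, H3⟩ := (h.smooth_velocity.pderiv 0).exists_norm_le T
  obtain ⟨M4, h4, H4⟩ := (h.smooth_velocity.pderiv 1).exists_norm_le T
  obtain ⟨M5, h5, H5⟩ := (h.smooth_pderiv_density 0).exists_norm_le T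
  obtain ⟨M6, h6, H6⟩ := (h.smooth_pderiv_density 1).exists_norm_le T
  refine ⟨1 + M1 + M2 + M3 + M4 + M5 + M6, by positivity, fun t ht x => ⟨?_, ?_, ?_, ?_, ?_⟩⟩
  · have := H1 t ht x
    rw [Real.norm_eq_abs] at this
    linarith
  · have := H1 t ht x
    rw [Real.norm_eq_abs, abs_le] at this
    rw [abs_le]
    constructor <;> linarith
  · linarith [H2 t ht x]
  · intro i
    fin_cases i
    · exact (H3 t ht x).trans (by linarith)
    · exact (H4 t ht x).trans (by linarith)
  · intro i
    fin_cases i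
    · exact (H5 t ht x).trans (by linarith)
    · exact (H6 t ht x).trans (by linarith)

lemma continuousOn_fderiv_density (h : IsSmoothSolution ρ u P) : ContinuousOn
    (fun q : ℝ × Plane => fderiv ℝ (ρ q.1) q.2 (u q.1 q.2)) (Ici 0 ×ˢ univ) := by
  simp only [fderiv_apply_eq_sum]
  refine continuousOn_finsetSum _ fun i _ => ?_
  exact ((EuclideanSpace.proj (𝕜 := ℝ) i).continuous.comp_continuousOn
    h.smooth_velocity.continuousOn).smul (h.smooth_pderiv_density i).continuousOn

lemma continuousOn_fderiv_velocity (h : IsSmoothSolution ρ u P) : ContinuousOn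
    (fun q : ℝ × Plane => fderiv ℝ (u q.1) q.2 (u q.1 q.2)) (Ici 0 ×ˢ univ) := by
  simp only [fderiv_apply_eq_sum]
  refine continuousOn_finsetSum _ fun i _ => ?_
  exact ((EuclideanSpace.proj (𝕜 := ℝ) i).continuous.comp_continuousOn
    h.smooth_velocity.continuousOn).smul (h.smooth_velocity.pderiv i).continuousOn

/-- Integrals of functions of the density are conserved. -/
lemma integral_comp_density (h : IsSmoothSolution ρ u P) {F F' : ℝ → ℝ}
    (hF : ∀ z, HasDerivAt F (F' z) z) (hF' : Continuous F')
    (hb : ∀ M : ℝ, ∃ C, 0 ≤ C ∧ ∀ z, |z| ≤ M → |F z| ≤ C * z ^ 2 ∧ |F' z| ≤ C) (ht : 0 ≤ t) :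
    ∫ x, F (ρ t x - 1) = ∫ x, F (ρ 0 x - 1) := by
  obtain ⟨M, hM0, hM⟩ := h.exists_bounds t
  obtain ⟨C, hC0, hC⟩ := hb M
  have hFc : Continuous F := continuous_iff_continuousAt.2 fun z => (hF z).continuousAt
  have hint : ∀ r ∈ Icc 0 t, Integrable (fun x => F (ρ r x - 1)) := fun r hr => by
    refine ((integrable_sq (h.smooth_density.memLp hr.1)).const_mul C).mono'
      (hFc.comp (h.smooth_density.continuous hr.1)).aestronglyMeasurable (ae_of_all _ fun x => ?_)
    simpa using (hC _ (hM r hr x).1).1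
  have hle : ∀ r ∈ Icc 0 t, ∀ x, ∀ i, |u r x i * (F' (ρ r x - 1) * pderiv i (ρ r) x)| ≤
      C * (‖u r x‖ ^ 2 + ‖pderiv i (ρ r) x‖ ^ 2) := fun r hr x i => by
    have h1 := (hC _ (hM r hr x).1).2
    have h2 : |u r x i| ≤ ‖u r x‖ := by
      simpa using PiLp.norm_apply_le (u r x) i
    rw [abs_mul, abs_mul, ← Real.norm_eq_abs (pderiv i (ρ r) x)]
    calc |u r x i| * (|F' (ρ r x - 1)| * ‖pderiv i (ρ r) x‖)
        ≤ ‖u r x‖ * (C * ‖pderiv i (ρ r) x‖) := by gcongr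
      _ ≤ _ := by
        have := two_mul_le_add_sq ‖u r x‖ ‖pderiv i (ρ r) x‖
        nlinarith [mul_nonneg (norm_nonneg (u r x)) (norm_nonneg (pderiv i (ρ r) x))]
  have e : ∀ r x, -(F' (ρ r x - 1) * fderiv ℝ (ρ r) x (u r x)) =
      -∑ i, u r x i * (F' (ρ r x - 1) * pderiv i (ρ r) x) := fun r x => by
    rw [fderiv_apply_eq_sum, Finset.mul_sum]
    simp only [smul_eq_mul, mul_left_comm]
  have key := integral_sub_eq_integral_integral (g := fun r x => F (ρ r x - 1))
    (g' := fun r x => -(F' (ρ r x - 1) * fderiv ℝ (ρ r) x (u r x))) ht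
    (fun x => hFc.comp_continuousOn ((h.smooth_density.continuousOn_time x).mono
      Icc_subset_Ici_self))
    (fun x r hr => by
      have h1 := (h.hasDerivAt_density hr.1 x).sub_const 1
      rw [← mul_neg]
      exact (hF (ρ r x - 1)).comp r h1)
    ?_ (hint 0 ⟨le_rfl, ht⟩) (hint t ⟨ht, le_rfl⟩)
  · have hz : ∀ r ∈ Icc 0 t, ∫ x, -(F' (ρ r x - 1) * fderiv ℝ (ρ r) x (u r x)) = 0 := by
      intro r hr
      have hder : ∀ x, HasFDerivAt (fun x => F (ρ r x - 1))
          (F' (ρ r x - 1) • fderiv ℝ (ρ r) x) x := fun x =>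
        (hF _).comp_hasFDerivAt x ((h.differentiable_density hr.1 x).hasFDerivAt.sub_const 1)
      have hpd : ∀ i x, pderiv i (fun x => F (ρ r x - 1)) x =
          F' (ρ r x - 1) * pderiv i (ρ r) x := fun i x => by
        rw [pderiv, (hder x).fderiv]; rfl
      have := integral_fderiv_apply_eq_zero (v := u r) (w := fun x => F (ρ r x - 1)) (M := M)
        ((h.smooth_velocity.contDiff_two hr.1).of_le (by norm_num)) (fun x => (hM r hr x).2.2.1)
        (fun i x => (hM r hr x).2.2.2.1 i) (h.incompressible r hr.1)
        (fun x => (hder x).differentiableAt) (hint r hr) (fun i => by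
          simp only [hpd]
          refine (((integrable_sq (h.smooth_velocity.memLp hr.1)).add
            (integrable_sq ((h.smooth_pderiv_density i).memLp hr.1))).const_mul C).mono' ?_
            (ae_of_all _ fun x => hle r hr x i)
          have c1 := h.smooth_velocity.continuous hr.1
          have c2 := (h.smooth_pderiv_density i).continuous hr.1
          have c3 := hF'.comp (h.smooth_density.continuous hr.1)
          exact (((EuclideanSpace.proj (𝕜 := ℝ) i).continuous.comp c1).mul
            (c3.mul c2)).aestronglyMeasurable)
      rw [integral_neg, neg_eq_zero, ← this]
      refine integral_congr_ae (ae_of_all _ fun x => ?_)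
      simp [(hder x).fderiv]
    rw [← sub_eq_zero, key]
    refine intervalIntegral.integral_zero_ae (ae_of_all _ fun r hr => hz r ?_)
    rw [uIoc_of_le ht] at hr
    exact Ioc_subset_Icc_self hr
  · have hdom : Integrable (fun q : ℝ × Plane =>
        C * (‖u q.1 q.2‖ ^ 2 + ‖pderiv 0 (ρ q.1) q.2‖ ^ 2) +
        C * (‖u q.1 q.2‖ ^ 2 + ‖pderiv 1 (ρ q.1) q.2‖ ^ 2))
        ((volume.restrict (Ioc 0 t)).prod volume) :=
      (((h.smooth_velocity.integrable_prod le_rfl).add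
        ((h.smooth_pderiv_density 0).integrable_prod le_rfl)).const_mul C).add
      (((h.smooth_velocity.integrable_prod le_rfl).add
        ((h.smooth_pderiv_density 1).integrable_prod le_rfl)).const_mul C)
    refine hdom.mono' (aestronglyMeasurable_prod_of_continuousOn ?_) ?_
    · refine ContinuousOn.mono ?_ (prod_mono (Ioc_subset_Icc_self.trans Icc_subset_Ici_self)
        subset_rfl)
      exact ((hF'.comp_continuousOn h.smooth_density.continuousOn).mul
        h.continuousOn_fderiv_density).neg
    · have : ∀ᵐ q : ℝ × Plane ∂((volume.restrict (Ioc 0 t)).prod volume), q.1 ∈ Ioc 0 t :=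
        Measure.quasiMeasurePreserving_fst.ae (ae_restrict_mem measurableSet_Ioc)
      filter_upwards [this] with q hq
      have hq' := Ioc_subset_Icc_self hq
      rw [e, norm_neg, Fin.sum_univ_two]
      exact (norm_add_le _ _).trans (add_le_add (hle _ hq' _ 0) (hle _ hq' _ 1))

lemma l2Sq_density (h : IsSmoothSolution ρ u P) (ht : 0 ≤ t) :
    l2Sq (fun x => ρ t x - 1) = l2Sq (fun x => ρ 0 x - 1) := by
  have := h.integral_comp_density (F := fun z => z ^ 2) (F' := fun z => 2 * z)
    (fun z => by simpa using hasDerivAt_pow 2 z) (by fun_prop)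
    (fun M => ⟨max 1 (2 * M), le_max_of_le_left zero_le_one, fun z hz => ⟨?_, ?_⟩⟩) ht
  · simpa [l2Sq] using this
  · rw [abs_of_nonneg (sq_nonneg z)]
    nlinarith [sq_nonneg z, le_max_left 1 (2 * M)]
  · rw [abs_mul, abs_two]
    exact (by linarith : 2 * |z| ≤ 2 * M).trans (le_max_right _ _)

lemma hasDerivAt_max_zero_sq (y : ℝ) : HasDerivAt (fun y : ℝ => max y 0 ^ 2) (2 * max y 0) y := by
  rcases lt_trichotomy y 0 with hy | hy | hy
  · rw [max_eq_right hy.le, mul_zero]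
    refine (hasDerivAt_const y (0 : ℝ)).congr_of_eventuallyEq ?_
    filter_upwards [Iio_mem_nhds hy] with z hz
    rw [max_eq_right (le_of_lt hz)]
    norm_num
  · subst hy
    rw [hasDerivAt_iff_isLittleO]
    simp only [max_self, mul_zero, smul_zero, sub_zero]
    refine Asymptotics.IsBigO.trans_isLittleO (g := fun z : ℝ => z ^ 2) ?_ ?_
    · refine Asymptotics.IsBigO.of_bound 1 (Eventually.of_forall fun z => ?_)
      rw [one_mul, Real.norm_eq_abs, Real.norm_eq_abs]
      rcases le_total z 0 with h0 | h0
      · simp [max_eq_right h0, sq_nonneg]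
      · simp [max_eq_left h0]
    · simpa using Asymptotics.isLittleO_pow_pow (𝕜 := ℝ) (m := 1) (n := 2) (by norm_num)
  · rw [max_eq_left hy.le]
    have h2 : HasDerivAt (fun z : ℝ => z ^ 2) (2 * y) y := by simpa using hasDerivAt_pow 2 y
    refine h2.congr_of_eventuallyEq ?_
    filter_upwards [Ioi_mem_nhds hy] with z hz
    rw [max_eq_left (le_of_lt hz)]

/-- The bounds on the density are propagated. -/
lemma abs_density_sub_one_le (h : IsSmoothSolution ρ u P)
    (h0 : ∀ x, 3 / 4 ≤ ρ 0 x ∧ ρ 0 x ≤ 5 / 4) (ht : 0 ≤ t) (x : Plane) :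
    |ρ t x - 1| ≤ 1 / 4 := by
  let F : ℝ → ℝ := fun z => max (z ^ 2 - 1 / 16) 0 ^ 2
  have hFc : Continuous F := by fun_prop
  have hle : ∀ z : ℝ, max (z ^ 2 - 1 / 16) 0 ≤ z ^ 2 := fun z =>
    max_le (by linarith) (sq_nonneg z)
  have hbd : ∀ M : ℝ, ∃ C, 0 ≤ C ∧ ∀ z, |z| ≤ M → |F z| ≤ C * z ^ 2 ∧
      |2 * max (z ^ 2 - 1 / 16) 0 * (2 * z)| ≤ C := fun M => by
    refine ⟨M ^ 2 + 4 * |M| ^ 3, by positivity, fun z hz => ?_⟩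
    have hz0 := abs_nonneg z
    have hM : |M| = M := abs_of_nonneg (hz0.trans hz)
    have hz2 : z ^ 2 ≤ M ^ 2 := by rw [← sq_abs z]; exact pow_le_pow_left₀ hz0 hz 2
    have h1 := hle z
    have h2 : 0 ≤ max (z ^ 2 - 1 / 16) 0 := le_max_right _ _
    constructor
    · rw [abs_of_nonneg (sq_nonneg _)]
      have h3 : max (z ^ 2 - 1 / 16) 0 ^ 2 ≤ (z ^ 2) ^ 2 := pow_le_pow_left₀ h2 h1 2
      have h4 : 0 ≤ 4 * |M| ^ 3 * z ^ 2 := by positivity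
      nlinarith [sq_nonneg z]
    · rw [abs_mul, abs_mul, abs_mul, abs_two, abs_of_nonneg h2, hM]
      have h5 : max (z ^ 2 - 1 / 16) 0 * |z| ≤ M ^ 2 * M :=
        mul_le_mul (h1.trans hz2) hz hz0 (sq_nonneg M)
      nlinarith [sq_nonneg M]
  have key := h.integral_comp_density (F := F) (F' := fun z => 2 * max (z ^ 2 - 1 / 16) 0 * (2 * z))
    (fun z => by
      have h1 : HasDerivAt (fun z : ℝ => z ^ 2 - 1 / 16) (2 * z) z := by
        simpa using (hasDerivAt_pow 2 z).sub_const (1 / 16)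
      exact (hasDerivAt_max_zero_sq (z ^ 2 - 1 / 16)).comp z h1)
    (by fun_prop) hbd ht
  have hz0 : ∀ x, F (ρ 0 x - 1) = 0 := fun x => by
    have := h0 x
    have h2 : (ρ 0 x - 1) ^ 2 - 1 / 16 ≤ 0 := by nlinarith
    simp only [F, max_eq_right h2]
    norm_num
  simp only [hz0, integral_zero] at key
  have hcont : Continuous (fun x => F (ρ t x - 1)) :=
    hFc.comp (h.smooth_density.continuous ht)
  have hint : Integrable (fun x => F (ρ t x - 1)) := by
    obtain ⟨M, hM0, hM⟩ := h.exists_bounds t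
    obtain ⟨C, hC0, hC⟩ := hbd M
    refine ((integrable_sq (h.smooth_density.memLp ht)).const_mul C).mono'
      hcont.aestronglyMeasurable (ae_of_all _ fun x => ?_)
    simpa using (hC _ (hM t ⟨ht, le_rfl⟩ x).1).1
  have hae := (integral_eq_zero_iff_of_nonneg (fun x => sq_nonneg _) hint).1 key
  have hall := (Continuous.ae_eq_iff_eq volume hcont continuous_const).1 hae
  have hx : F (ρ t x - 1) = 0 := congrFun hall x
  have h3 : max ((ρ t x - 1) ^ 2 - 1 / 16) 0 = 0 := pow_eq_zero_iff (two_ne_zero) |>.1 hx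
  have h4 : (ρ t x - 1) ^ 2 - 1 / 16 ≤ 0 := by rw [← h3]; exact le_max_left _ _
  exact abs_le_of_sq_le_sq (by linarith) (by norm_num)

end IsSmoothSolution

lemma divergence_pderiv {v : Plane → Plane} (hv : ContDiff ℝ 2 v) (hdiv : ∀ x, divergence v x = 0)
    (j : Fin 2) (x : Plane) : divergence (pderiv j v) x = 0 := by
  have hi : ∀ i, ContDiff ℝ 1 (pderiv i v) := fun i => contDiff_pderiv hv (by norm_num) i
  have hd : ∀ i x, DifferentiableAt ℝ (pderiv i v) x := fun i x =>
    (hi i).differentiable (by norm_num) x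
  have hd' : ∀ i x, DifferentiableAt ℝ (fun x => pderiv i v x i) x := fun i x =>
    (EuclideanSpace.proj (𝕜 := ℝ) i).differentiableAt.comp x (hd i x)
  have e : pderiv j (fun x => pderiv 0 v x 0 + pderiv 1 v x 1) x = 0 := by
    have : (fun x => pderiv 0 v x 0 + pderiv 1 v x 1) = fun _ => 0 := by
      funext y
      have := hdiv y
      rwa [divergence, Fin.sum_univ_two] at this
    rw [this]
    simp [pderiv]
  rw [pderiv_add (hd' 0 x) (hd' 1 x), pderiv_apply (hd 0 x), pderiv_apply (hd 1 x),
    pderiv_comm hv, pderiv_comm hv j 1] at e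
  rw [divergence, Fin.sum_univ_two, e]

/-- The `L²` norms of the Hessian and of the Laplacian agree. -/
lemma sum_gradL2Sq_pderiv {v : Plane → Plane} (hv : ContDiff ℝ 3 v)
    (h1 : ∀ i, MemLp (pderiv i v) 2) (h2 : ∀ i j, MemLp (pderiv i (pderiv j v)) 2)
    (h3 : ∀ i j k, MemLp (pderiv i (pderiv j (pderiv k v))) 2) :
    ∑ i, gradL2Sq (pderiv i v) = l2Sq (lap v) := by
  have c1 : ∀ i, ContDiff ℝ 2 (pderiv i v) := fun i => contDiff_pderiv hv (by norm_num) i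
  have c2 : ∀ i j, ContDiff ℝ 1 (pderiv i (pderiv j v)) := fun i j =>
    contDiff_pderiv (c1 j) (by norm_num) i
  have hv2 : ContDiff ℝ 2 v := hv.of_le (by norm_num)
  have d1 : ∀ i, Differentiable ℝ (pderiv i v) := fun i => (c1 i).differentiable (by norm_num)
  have d2 : ∀ i j, Differentiable ℝ (pderiv i (pderiv j v)) := fun i j =>
    (c2 i j).differentiable (by norm_num)
  have key : ∀ i j, ∫ x, inner ℝ (pderiv j (pderiv j v) x) (pderiv i (pderiv i v) x)
      = ∫ x, ‖pderiv j (pderiv i v) x‖ ^ 2 := fun i j => by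
    rw [integral_inner_pderiv_of_memLp i (d2 j j) (d1 i) (h2 j j) (h1 i) (h3 i j j) (h2 i i)]
    have e : ∀ x, pderiv i (pderiv j (pderiv j v)) x = pderiv j (pderiv i (pderiv j v)) x :=
      fun x => pderiv_comm (c1 j) i j x
    simp only [e]
    have := integral_inner_pderiv_of_memLp j (d2 i j) (d1 i) (h2 i j) (h1 i) (h3 j i j) (h2 j i)
    rw [← this]
    refine integral_congr_ae (ae_of_all _ fun x => ?_)
    simp only
    rw [pderiv_comm hv2 i j, real_inner_self_eq_norm_sq]
  have e1 : ∀ i, gradL2Sq (pderiv i v) = ∑ j, ∫ x, ‖pderiv j (pderiv i v) x‖ ^ 2 := fun i =>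
    integral_finsetSum _ fun j _ => integrable_sq (h2 j i)
  have e2 : l2Sq (lap v) =
      ∑ i, ∑ j, ∫ x, inner ℝ (pderiv j (pderiv j v) x) (pderiv i (pderiv i v) x) := by
    have : ∀ x, ‖lap v x‖ ^ 2 =
        ∑ i, ∑ j, inner ℝ (pderiv j (pderiv j v) x) (pderiv i (pderiv i v) x) := fun x => by
      rw [← real_inner_self_eq_norm_sq, lap, inner_sum]
      simp only [sum_inner]
    simp only [l2Sq, this]
    rw [integral_finsetSum _ fun i _ => integrable_finsetSum _ fun j _ =>
      integrable_inner (h2 j j) (h2 i i)]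
    exact Finset.sum_congr rfl fun i _ => integral_finsetSum _ fun j _ =>
      integrable_inner (h2 j j) (h2 i i)
  rw [e2]
  simp only [e1, key]

namespace IsSmoothSolution

variable {ρ : ℝ → Plane → ℝ} {u : ℝ → Plane → Plane} {P : ℝ → Plane → ℝ} {s t : ℝ}

lemma integral_inner_gradient_pressure (h : IsSmoothSolution ρ u P) (ht : 0 ≤ t)
    {v : Plane → Plane} (hv : Differentiable ℝ v) (hv2 : MemLp v 2)
    (hv' : ∀ i, MemLp (pderiv i v) 2) (hdiv : ∀ x, divergence v x = 0) :
    ∫ x, inner ℝ (v x) (gradient (P t) x) = 0 :=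
  integral_inner_gradient_eq_zero hv hv2 hv' hdiv (h.differentiable_pressure t ht)
    (h.smooth_pressure.continuous ht) (h.smooth_pressure.memLp ht)

lemma integrable_energy (h : IsSmoothSolution ρ u P) (ht : 0 ≤ t) :
    Integrable (fun x => ρ t x * ‖u t x‖ ^ 2) := by
  obtain ⟨M, hM0, hM⟩ := h.exists_bounds t
  refine ((integrable_sq (h.smooth_velocity.memLp ht)).const_mul M).mono'
    ((h.contDiff_density ht).continuous.mul
      ((h.smooth_velocity.continuous ht).norm.pow 2)).aestronglyMeasurable
    (ae_of_all _ fun x => ?_)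
  rw [norm_mul, Real.norm_of_nonneg (sq_nonneg ‖u t x‖)]
  exact mul_le_mul_of_nonneg_right (hM t ⟨ht, le_rfl⟩ x).2.1 (sq_nonneg _)

lemma gradL2Sq_eq (h : IsSmoothSolution ρ u P) (ht : 0 ≤ t) :
    gradL2Sq (u t) = ∑ i, l2Sq (pderiv i (u t)) :=
  integral_finsetSum _ fun i _ => integrable_sq ((h.smooth_velocity.pderiv i).memLp ht)

lemma continuousOn_gradL2Sq (h : IsSmoothSolution ρ u P) :
    ContinuousOn (fun t => gradL2Sq (u t)) (Ici 0) := by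
  refine ContinuousOn.congr (f := fun t => ∑ i, l2Sq (pderiv i (u t))) ?_
    fun t ht => h.gradL2Sq_eq ht
  exact continuousOn_finsetSum _ fun i _ => (h.smooth_velocity.pderiv i).continuousOn_l2Sq

lemma integral_inner_lap_velocity (h : IsSmoothSolution ρ u P) (ht : 0 ≤ t) :
    ∫ x, inner ℝ (u t x) (lap (u t) x) = -gradL2Sq (u t) := by
  have hu := h.smooth_velocity
  rw [integral_inner_lap (hu.differentiable ht) (fun i => (hu.pderiv i).differentiable ht)
    (hu.memLp ht) (fun i => (hu.pderiv i).memLp ht) (fun i => (hu.pderiv i).memLp ht)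
    (fun i => ((hu.pderiv i).pderiv i).memLp ht)]
  simp only [real_inner_self_eq_norm_sq]
  rfl

lemma energy_identity (h : IsSmoothSolution ρ u P) (hs : 0 ≤ s) (hst : s ≤ t) :
    E₀ (ρ t) (u t) - E₀ (ρ s) (u s) = ∫ r in s..t, -2 * gradL2Sq (u r) := by
  obtain ⟨M, hM0, hM⟩ := h.exists_bounds t
  have hu := h.smooth_velocity
  have hI : Icc s t ⊆ Icc 0 t := Icc_subset_Icc_left hs
  have hle : ∀ r ∈ Icc s t, ∀ x, |fderiv ℝ (ρ r) x (u r x) * ‖u r x‖ ^ 2 +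
      2 * (ρ r x * inner ℝ (u r x) (fderiv ℝ (u r) x (u r x)))| ≤ 6 * M ^ 2 * ‖u r x‖ ^ 2 := by
    intro r hr x
    obtain ⟨-, b1, b2, b3, b4⟩ := hM r (hI hr) x
    have c1 := norm_fderiv_apply_le b4 (u r x)
    have c2 := norm_fderiv_apply_le b3 (u r x)
    have c3 := norm_inner_le_norm (𝕜 := ℝ) (u r x) (fderiv ℝ (u r) x (u r x))
    rw [Real.norm_eq_abs] at c1 c3
    refine (abs_add_le _ _).trans ?_
    rw [abs_mul, abs_mul, abs_mul, abs_two, abs_of_nonneg (sq_nonneg ‖u r x‖)]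
    have n0 := norm_nonneg (u r x)
    have d1 : |fderiv ℝ (ρ r) x (u r x)| * ‖u r x‖ ^ 2 ≤ (2 * M * M) * ‖u r x‖ ^ 2 := by
      refine mul_le_mul_of_nonneg_right (c1.trans ?_) (sq_nonneg _)
      exact mul_le_mul_of_nonneg_left b2 (by positivity)
    have d2 : |inner ℝ (u r x) (fderiv ℝ (u r) x (u r x))| ≤ 2 * M * ‖u r x‖ ^ 2 := by
      refine c3.trans ((mul_le_mul_of_nonneg_left c2 n0).trans_eq (by ring))
    have d3 : |ρ r x| * |inner ℝ (u r x) (fderiv ℝ (u r) x (u r x))| ≤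
        M * (2 * M * ‖u r x‖ ^ 2) := mul_le_mul b1 d2 (abs_nonneg _) hM0
    nlinarith
  have hmom : ∀ r, 0 ≤ r → ∀ x, ρ r x * inner ℝ (u r x) (timeDeriv u r x) =
      inner ℝ (u r x) (lap (u r) x) - inner ℝ (u r x) (gradient (P r) x) -
        ρ r x * inner ℝ (u r x) (fderiv ℝ (u r) x (u r x)) := fun r hr x => by
    have := congrArg (fun z => inner ℝ (u r x) z) (h.momentum' hr x)
    simpa only [inner_sub_right, inner_smul_right] using this
  let w : ℝ → Plane → ℝ := fun r x => fderiv ℝ (ρ r) x (u r x) * ‖u r x‖ ^ 2 +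
      2 * (ρ r x * inner ℝ (u r x) (fderiv ℝ (u r) x (u r x)))
  let g' : ℝ → Plane → ℝ := fun r x => 2 * inner ℝ (u r x) (lap (u r) x)
    - 2 * inner ℝ (u r x) (gradient (P r) x) - w r x
  have hcw : ContinuousOn (fun q : ℝ × Plane => w q.1 q.2) (Ici 0 ×ˢ univ) := by
    have c1 := h.continuousOn_fderiv_density
    have c2 := h.continuousOn_fderiv_velocity
    have c3 := h.continuousOn_density
    have c4 := hu.continuousOn
    exact (c1.mul (c4.norm.pow 2)).add (continuousOn_const.mul (c3.mul (c4.inner c2)))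
  have key := integral_sub_eq_integral_integral (g := fun r x => ρ r x * ‖u r x‖ ^ 2)
    (g' := g') hst
    (fun x => (((h.continuousOn_density_time x).mul ((hu.continuousOn_time x).norm.pow 2)).mono
      (fun r hr => hs.trans hr.1)))
    (fun x r hr => by
      have hr0 : 0 < r := hs.trans_lt hr.1
      have h1 := (h.hasDerivAt_density hr0 x).mul (hu.hasDerivAt hr0 x).norm_sq
      refine h1.congr_deriv ?_
      have := hmom r hr0.le x
      simp only [g', w]
      linear_combination 2 * this)
    ?_ (h.integrable_energy hs) (h.integrable_energy (hs.trans hst))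
  · unfold E₀
    rw [key]
    refine intervalIntegral.integral_congr_ae (ae_of_all _ fun r hr => ?_)
    rw [uIoc_of_le hst] at hr
    have hr0 : 0 ≤ r := hs.trans hr.1.le
    have i1 := (integrable_inner (hu.memLp hr0) (hu.lap.memLp hr0)).const_mul 2
    have i2 := (integrable_inner (hu.memLp hr0) (h.smooth_pressure.memLp hr0)).const_mul 2
    have cw : Continuous (w r) := by
      have : ContinuousOn (fun x : Plane => w r x) univ :=
        hcw.comp (f := fun x : Plane => (r, x)) (by fun_prop) (fun x _ => ⟨hr0, trivial⟩)
      exact continuousOn_univ.1 this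
    have i3 : Integrable (w r) := ((integrable_sq (hu.memLp hr0)).const_mul (6 * M ^ 2)).mono'
      cw.aestronglyMeasurable (ae_of_all _ fun x => hle r (Ioc_subset_Icc_self hr) x)
    have hw : ∫ x, w r x = 0 := by
      have hd : ∀ x, HasFDerivAt (fun x => ρ r x * ‖u r x‖ ^ 2) _ x := fun x =>
        (h.differentiable_density hr0 x).hasFDerivAt.mul
          ((hu.differentiable hr0 x).hasFDerivAt.norm_sq)
      have hwe : ∀ x, fderiv ℝ (fun x => ρ r x * ‖u r x‖ ^ 2) x (u r x) = w r x := fun x => by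
        rw [(hd x).fderiv]
        simp [w]
        ring
      have hp : ∀ i x, pderiv i (fun x => ρ r x * ‖u r x‖ ^ 2) x =
          pderiv i (ρ r) x * ‖u r x‖ ^ 2 + 2 * (ρ r x * inner ℝ (u r x) (pderiv i (u r) x)) :=
        fun i x => by
          rw [pderiv, (hd x).fderiv]
          simp [pderiv]
          ring
      obtain hMr := hM r (hI (Ioc_subset_Icc_self hr))
      have := integral_fderiv_apply_eq_zero (v := u r) (w := fun x => ρ r x * ‖u r x‖ ^ 2) (M := M)
        ((hu.contDiff_two hr0).of_le (by norm_num)) (fun x => (hMr x).2.2.1)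
        (fun i x => (hMr x).2.2.2.1 i) (h.incompressible r hr0)
        (fun x => (hd x).differentiableAt) (h.integrable_energy hr0) (fun i => by
          simp only [hp]
          have c1 := hu.continuous hr0
          have c2 := (hu.pderiv i).continuous hr0
          have c3 := (h.contDiff_density hr0).continuous
          have c4 := (h.smooth_pderiv_density i).continuous hr0
          refine ((integrable_sq (hu.memLp hr0)).const_mul (3 * M ^ 2)).mono' ?_
            (ae_of_all _ fun x => ?_)
          · exact ((((EuclideanSpace.proj (𝕜 := ℝ) i).continuous.comp c1)).mul
              ((c4.mul (c1.norm.pow 2)).add ((c3.mul (c1.inner c2)).const_mul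
                2))).aestronglyMeasurable
          · obtain ⟨-, b1, b2, b3, b4⟩ := hMr x
            have n0 := norm_nonneg (u r x)
            have d0 : |u r x i| ≤ ‖u r x‖ := by simpa using PiLp.norm_apply_le (u r x) i
            have d1 := norm_inner_le_norm (𝕜 := ℝ) (u r x) (pderiv i (u r) x)
            have d2 := b4 i
            rw [Real.norm_eq_abs] at d1 d2
            have d3 : |inner ℝ (u r x) (pderiv i (u r) x)| ≤ ‖u r x‖ * M :=
              d1.trans (mul_le_mul_of_nonneg_left (b3 i) n0)
            have d4 : |pderiv i (ρ r) x * ‖u r x‖ ^ 2 +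
                2 * (ρ r x * inner ℝ (u r x) (pderiv i (u r) x))| ≤ 3 * M ^ 2 * ‖u r x‖ := by
              refine (abs_add_le _ _).trans ?_
              rw [abs_mul, abs_mul, abs_mul, abs_two, abs_of_nonneg (sq_nonneg ‖u r x‖)]
              have e1 : |pderiv i (ρ r) x| * ‖u r x‖ ^ 2 ≤ M * (M * ‖u r x‖) := by
                refine mul_le_mul d2 ?_ (sq_nonneg _) hM0
                rw [sq]
                exact mul_le_mul_of_nonneg_right b2 n0
              have e2 := mul_le_mul b1 d3 (abs_nonneg _) hM0
              nlinarith
            rw [Real.norm_eq_abs, abs_mul]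
            calc _ ≤ ‖u r x‖ * (3 * M ^ 2 * ‖u r x‖) :=
                  mul_le_mul d0 d4 (abs_nonneg _) n0
              _ = _ := by ring)
      rw [← this]
      exact integral_congr_ae (ae_of_all _ fun x => (hwe x).symm)
    have hpr := h.integral_inner_gradient_pressure hr0 (hu.differentiable hr0) (hu.memLp hr0)
      (fun i => (hu.pderiv i).memLp hr0) (h.incompressible r hr0)
    simp only [g']
    have i12 : Integrable (fun x => 2 * inner ℝ (u r x) (lap (u r) x)
      - 2 * inner ℝ (u r x) (gradient (P r) x)) := i1.sub i2
    rw [integral_sub i12 i3, integral_sub i1 i2, integral_const_mul, integral_const_mul,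
      hw, hpr, h.integral_inner_lap_velocity hr0]
    ring
  · have hdom : Integrable (fun q : ℝ × Plane => (6 * M ^ 2 + 2) * ‖u q.1 q.2‖ ^ 2 +
        ‖lap (u q.1) q.2‖ ^ 2 + ‖gradient (P q.1) q.2‖ ^ 2)
        ((volume.restrict (Ioc s t)).prod volume) :=
      (((hu.integrable_prod hs).const_mul _).add (hu.lap.integrable_prod hs)).add
        (h.smooth_pressure.integrable_prod hs)
    refine hdom.mono' (aestronglyMeasurable_prod_of_continuousOn ?_) ?_
    · refine ContinuousOn.mono ?_ (prod_mono (fun r hr => hs.trans hr.1.le) subset_rfl)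
      exact ((continuousOn_const.mul (hu.continuousOn.inner hu.lap.continuousOn)).sub
        (continuousOn_const.mul (hu.continuousOn.inner h.smooth_pressure.continuousOn))).sub hcw
    · have : ∀ᵐ q : ℝ × Plane ∂((volume.restrict (Ioc s t)).prod volume), q.1 ∈ Ioc s t :=
        Measure.quasiMeasurePreserving_fst.ae (ae_restrict_mem measurableSet_Ioc)
      filter_upwards [this] with q hq
      have d0 := hle q.1 (Ioc_subset_Icc_self hq) q.2
      have d1 := norm_inner_le_norm (𝕜 := ℝ) (u q.1 q.2) (lap (u q.1) q.2)
      have d2 := norm_inner_le_norm (𝕜 := ℝ) (u q.1 q.2) (gradient (P q.1) q.2)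
      rw [Real.norm_eq_abs] at d1 d2
      rw [Real.norm_eq_abs]
      simp only [g']
      have hwq : |w q.1 q.2| ≤ 6 * M ^ 2 * ‖u q.1 q.2‖ ^ 2 := d0
      rw [abs_le] at d1 d2 hwq ⊢
      have e1 := two_mul_le_add_sq ‖u q.1 q.2‖ ‖lap (u q.1) q.2‖
      have e2 := two_mul_le_add_sq ‖u q.1 q.2‖ ‖gradient (P q.1) q.2‖
      constructor <;> nlinarith

end IsSmoothSolution

lemma inner_lp_eq {F G : Lp Plane 2 (volume : Measure Plane)} {f g : Plane → Plane}
    (hF : F =ᵐ[volume] f) (hG : G =ᵐ[volume] g) :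
    inner ℝ F G = ∫ x, inner ℝ (f x) (g x) := by
  rw [L2.inner_def]
  refine integral_congr_ae ?_
  filter_upwards [hF, hG] with x h1 h2
  rw [h1, h2]

namespace IsSmoothSolution

variable {ρ : ℝ → Plane → ℝ} {u : ℝ → Plane → Plane} {P : ℝ → Plane → ℝ} {s t : ℝ}

/-! ### The energy -/

lemma hasDerivAt_energy (h : IsSmoothSolution ρ u P) (ht : 0 < t) :
    HasDerivAt (fun t => E₀ (ρ t) (u t)) (-2 * gradL2Sq (u t)) t := by
  have hc : ContinuousOn (fun r => -2 * gradL2Sq (u r)) (Ici 0) :=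
    continuousOn_const.mul h.continuousOn_gradL2Sq
  have hi : IntervalIntegrable (fun r => -2 * gradL2Sq (u r)) volume 0 t := by
    refine ContinuousOn.intervalIntegrable ?_
    rw [uIcc_of_le ht.le]
    exact hc.mono Icc_subset_Ici_self
  have h1 := intervalIntegral.integral_hasDerivAt_right hi
    (hc.stronglyMeasurableAtFilter_nhdsWithin measurableSet_Ici t |>.filter_mono (by
      rw [nhdsWithin_eq_nhds.2 (Ici_mem_nhds ht)]))
    (hc.continuousAt (Ici_mem_nhds ht))
  refine (h1.const_add (E₀ (ρ 0) (u 0))).congr_of_eventuallyEq ?_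
  filter_upwards [Ioi_mem_nhds ht] with r hr
  have := h.energy_identity le_rfl (le_of_lt hr)
  linarith

lemma continuousOn_energy (h : IsSmoothSolution ρ u P) :
    ContinuousOn (fun t => E₀ (ρ t) (u t)) (Ici 0) := by
  intro t ht
  rcases eq_or_lt_of_le (show (0 : ℝ) ≤ t from ht) with h0 | h0
  · subst h0
    have hc : ContinuousOn (fun r => -2 * gradL2Sq (u r)) (Icc 0 1) :=
      continuousOn_const.mul (h.continuousOn_gradL2Sq.mono Icc_subset_Ici_self)
    have h1 := intervalIntegral.continuousOn_primitive_interval' (a := 0) (b₁ := 0) (b₂ := 1)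
      (μ := volume) (f := fun r => -2 * gradL2Sq (u r))
      (ContinuousOn.intervalIntegrable (by rwa [uIcc_of_le zero_le_one]))
      (left_mem_uIcc)
    rw [uIcc_of_le zero_le_one] at h1
    have h2 : ContinuousOn (fun t => E₀ (ρ t) (u t)) (Icc 0 1) :=
      (continuousOn_const.add h1).congr (f := fun t => E₀ (ρ 0) (u 0) + _) fun r hr => by
        have := h.energy_identity le_rfl hr.1
        linarith
    exact (h2 0 ⟨le_rfl, zero_le_one⟩).mono_of_mem_nhdsWithin
      (Icc_mem_nhdsGE (zero_lt_one))
  · exact (h.hasDerivAt_energy h0).continuousAt.continuousWithinAt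

lemma energy_antitone (h : IsSmoothSolution ρ u P) (hs : 0 ≤ s) (hst : s ≤ t) :
    E₀ (ρ t) (u t) ≤ E₀ (ρ s) (u s) := by
  have h1 := h.energy_identity hs hst
  have h2 : ∫ r in s..t, -2 * gradL2Sq (u r) ≤ 0 := by
    rw [intervalIntegral.integral_const_mul]
    have := intervalIntegral.integral_nonneg (f := fun r => gradL2Sq (u r)) hst
      (μ := volume) fun r _ => gradL2Sq_nonneg _
    linarith
  linarith

lemma energy_bounds (h : IsSmoothSolution ρ u P) (h0 : ∀ x, 3 / 4 ≤ ρ 0 x ∧ ρ 0 x ≤ 5 / 4)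
    (ht : 0 ≤ t) : 3 / 4 * l2Sq (u t) ≤ E₀ (ρ t) (u t) ∧ E₀ (ρ t) (u t) ≤ 5 / 4 * l2Sq (u t) := by
  have hi := integrable_sq (h.smooth_velocity.memLp ht)
  have hb : ∀ x, 3 / 4 ≤ ρ t x ∧ ρ t x ≤ 5 / 4 := fun x => by
    have := abs_le.1 (h.abs_density_sub_one_le h0 ht x)
    constructor <;> linarith
  unfold l2Sq E₀
  rw [← integral_const_mul, ← integral_const_mul]
  exact ⟨integral_mono (hi.const_mul _) (h.integrable_energy ht) fun x =>
      mul_le_mul_of_nonneg_right (hb x).1 (sq_nonneg _),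
    integral_mono (h.integrable_energy ht) (hi.const_mul _) fun x =>
      mul_le_mul_of_nonneg_right (hb x).2 (sq_nonneg _)⟩

/-! ### The estimate for the gradient of the velocity -/

lemma memLp_timeDeriv (h : IsSmoothSolution ρ u P) (ht : 0 < t) : MemLp (timeDeriv u t) 2 := by
  obtain ⟨U, hU, hU'⟩ := h.smooth_velocity.exists_lp
  obtain ⟨G, -, hG⟩ := h.smooth_velocity.hasDerivAt_lp hU hU' ht
  exact (memLp_congr_ae hG).1 (Lp.memLp G)

lemma integral_inner_timeDeriv_pressure (h : IsSmoothSolution ρ u P) (ht : 0 < t) :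
    ∫ x, inner ℝ (timeDeriv u t x) (gradient (P t) x) = 0 := by
  obtain ⟨U, hU, hU'⟩ := h.smooth_velocity.exists_lp
  obtain ⟨G, hG, hG'⟩ := h.smooth_velocity.hasDerivAt_lp hU hU' ht
  have hQ := h.smooth_pressure.memLp ht.le
  rw [← inner_lp_eq hG' hQ.coeFn_toLp]
  have h1 : HasDerivAt (fun r => inner ℝ (U r) (hQ.toLp _)) (inner ℝ G (hQ.toLp _)) t := by
    simpa using hG.inner ℝ (hasDerivAt_const t (hQ.toLp _))
  refine h1.unique ((hasDerivAt_const t (0 : ℝ)).congr_of_eventuallyEq ?_)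
  filter_upwards [Ioi_mem_nhds ht] with r hr
  have hr0 : 0 ≤ r := le_of_lt hr
  have hu := h.smooth_velocity
  rw [inner_lp_eq (hU' r hr0) hQ.coeFn_toLp]
  exact h.integral_inner_gradient_pressure ht.le (hu.differentiable hr0) (hu.memLp hr0)
    (fun i => (hu.pderiv i).memLp hr0) (h.incompressible r hr0)

lemma hasDerivAt_gradL2Sq (h : IsSmoothSolution ρ u P) (ht : 0 < t) :
    HasDerivAt (fun t => gradL2Sq (u t))
      (-2 * ∫ x, inner ℝ (lap (u t) x) (timeDeriv u t x)) t := by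
  have hu := h.smooth_velocity
  obtain ⟨U, hU, hU'⟩ := hu.exists_lp
  obtain ⟨G, hG, hG'⟩ := hu.hasDerivAt_lp hU hU' ht
  have hF : ∀ i, ∃ F : ℝ → Lp Plane 2 (volume : Measure Plane),
    ContDiffOn ℝ ∞ F (Ici 0) ∧ ∀ t, 0 ≤ t → F t =ᵐ[volume] pderiv i (u t) :=
    fun i => (hu.pderiv i).exists_lp
  choose F hF hF' using hF
  have hFd : ∀ i, HasDerivAt (F i) (deriv (F i) t) t := fun i =>
    (((hF i).differentiableOn (by simp) t ht.le).differentiableAt (Ici_mem_nhds ht)).hasDerivAt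
  have hL := hu.lap.memLp ht.le
  have h1 : HasDerivAt (fun r => ∑ i, ‖F i r‖ ^ 2)
      (∑ i, 2 * inner ℝ (F i t) (deriv (F i) t)) t :=
    HasDerivAt.fun_sum fun i _ => (hFd i).norm_sq
  have h2 : HasDerivAt (fun r => ∑ i, inner ℝ (F i t) (F i r))
      (∑ i, inner ℝ (F i t) (deriv (F i) t)) t :=
    HasDerivAt.fun_sum fun i _ => by
      simpa using (hasDerivAt_const t (F i t)).inner ℝ (hFd i)
  have h3 : HasDerivAt (fun r => -inner ℝ (hL.toLp _) (U r)) (-inner ℝ (hL.toLp _) G) t := by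
    have h3' : HasDerivAt (fun r => inner ℝ (hL.toLp _) (U r)) (inner ℝ (hL.toLp _) G) t := by
      simpa using (hasDerivAt_const t (hL.toLp _)).inner ℝ hG
    exact h3'.neg
  have h4 : ∑ i, inner ℝ (F i t) (deriv (F i) t) = -inner ℝ (hL.toLp _) G := by
    refine h2.unique (h3.congr_of_eventuallyEq ?_)
    filter_upwards [Ioi_mem_nhds ht] with r hr
    have hr0 : 0 ≤ r := le_of_lt hr
    rw [inner_lp_eq hL.coeFn_toLp (hU' r hr0)]
    simp only [fun i => inner_lp_eq (hF' i t ht.le) (hF' i r hr0)]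
    have := integral_inner_lap (f := u r) (g := u t) (hu.differentiable hr0)
      (fun i => (hu.pderiv i).differentiable ht.le) (hu.memLp hr0) (fun i => (hu.pderiv i).memLp hr0)
      (fun i => (hu.pderiv i).memLp ht.le) (fun i => ((hu.pderiv i).pderiv i).memLp ht.le)
    have c1 : ∀ x, inner ℝ (u r x) (lap (u t) x) = inner ℝ (lap (u t) x) (u r x) :=
      fun x => real_inner_comm _ _
    have c2 : ∀ i x, inner ℝ (pderiv i (u r) x) (pderiv i (u t) x) =
      inner ℝ (pderiv i (u t) x) (pderiv i (u r) x) := fun i x => real_inner_comm _ _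
    simp only [c1, c2] at this
    rw [this, neg_neg, integral_finsetSum]
    intro i _
    exact integrable_inner ((hu.pderiv i).memLp ht.le) ((hu.pderiv i).memLp hr0)
  have h5 : ∑ i, 2 * inner ℝ (F i t) (deriv (F i) t) =
      -2 * ∫ x, inner ℝ (lap (u t) x) (timeDeriv u t x) := by
    rw [← Finset.mul_sum, h4, inner_lp_eq hL.coeFn_toLp hG']
    ring
  rw [← h5]
  refine h1.congr_of_eventuallyEq ?_
  filter_upwards [Ioi_mem_nhds ht] with r hr
  have hr0 : 0 ≤ r := le_of_lt hr
  rw [h.gradL2Sq_eq hr0]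
  refine Finset.sum_congr rfl fun i _ => ?_
  rw [← l2Sq_congr (hF' i r hr0), l2Sq_eq_norm_sq]

lemma integral_inner_lap_pressure (h : IsSmoothSolution ρ u P) (ht : 0 ≤ t) :
    ∫ x, inner ℝ (lap (u t) x) (gradient (P t) x) = 0 := by
  have hu := h.smooth_velocity
  have e : ∀ x, inner ℝ (lap (u t) x) (gradient (P t) x) =
      ∑ i, inner ℝ (pderiv i (pderiv i (u t)) x) (gradient (P t) x) := fun x => by
    rw [lap, sum_inner]
  simp only [e]
  rw [integral_finsetSum _ fun i _ =>
    integrable_inner (((hu.pderiv i).pderiv i).memLp ht) (h.smooth_pressure.memLp ht)]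
  refine Finset.sum_eq_zero fun i _ => ?_
  refine h.integral_inner_gradient_pressure ht (((hu.pderiv i).pderiv i).differentiable ht)
    (((hu.pderiv i).pderiv i).memLp ht) (fun j => (((hu.pderiv i).pderiv i).pderiv j).memLp ht) ?_
  exact divergence_pderiv ((hu.pderiv i).contDiff_two ht)
    (divergence_pderiv (hu.contDiff_two ht) (h.incompressible t ht) i) i

lemma memLp_convection (h : IsSmoothSolution ρ u P) (ht : 0 ≤ t) :
    MemLp (fun x => fderiv ℝ (u t) x (u t x)) 2 := by
  have hu := h.smooth_velocity
  obtain ⟨M, hM0, hM⟩ := h.exists_bounds t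
  have hc : Continuous (fun x => fderiv ℝ (u t) x (u t x)) :=
    ((hu.contDiff ht).continuous_fderiv (by simp)).clm_apply (hu.continuous ht)
  refine ((hu.memLp ht).norm.const_mul (2 * M)).of_le hc.aestronglyMeasurable
    (ae_of_all _ fun x => ?_)
  have := norm_fderiv_apply_le (hM t ⟨ht, le_rfl⟩ x).2.2.2.1 (u t x)
  refine this.trans (le_abs_self _)

lemma l2Sq_convection_le {C : ℝ} (hC0 : 0 < C)
    (hC : ∀ f : Plane → Plane, ContDiff ℝ 1 f → MemLp f 2 → (∀ i, MemLp (pderiv i f) 2) →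
      Integrable (fun x => ‖f x‖ ^ 4) ∧ ∫ x, ‖f x‖ ^ 4 ≤ C * (l2Sq f * gradL2Sq f))
    (h : IsSmoothSolution ρ u P) (ht : 0 ≤ t) :
    l2Sq (fun x => fderiv ℝ (u t) x (u t x)) ≤
      2 * C * (gradL2Sq (u t) * (√(l2Sq (u t)) * √(l2Sq (lap (u t))))) := by
  have hu := h.smooth_velocity
  set X := gradL2Sq (u t) with hX
  set B := l2Sq (lap (u t)) with hB
  set l := l2Sq (u t) with hl
  have hX0 : 0 ≤ X := gradL2Sq_nonneg _
  have hB0 : 0 ≤ B := l2Sq_nonneg _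
  have hl0 : 0 ≤ l := l2Sq_nonneg _
  obtain ⟨hu4, hu4'⟩ := hC (u t) ((hu.contDiff_two ht).of_le (by norm_num)) (hu.memLp ht)
    (fun i => (hu.pderiv i).memLp ht)
  have hp4 := fun i => hC (pderiv i (u t)) (((hu.pderiv i).contDiff_two ht).of_le (by norm_num))
    ((hu.pderiv i).memLp ht) (fun j => ((hu.pderiv i).pderiv j).memLp ht)
  have hXi : ∀ i, l2Sq (pderiv i (u t)) ≤ X := fun i => by
    rw [hX, h.gradL2Sq_eq ht]
    exact Finset.single_le_sum (f := fun i => l2Sq (pderiv i (u t)))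
      (fun j _ => l2Sq_nonneg _) (Finset.mem_univ i)
  have hBi : ∀ i, gradL2Sq (pderiv i (u t)) ≤ B := fun i => by
    rw [hB, ← sum_gradL2Sq_pderiv ((hu.contDiff ht).of_le ENat.LEInfty.out)
      (fun i => (hu.pderiv i).memLp ht) (fun i j => ((hu.pderiv j).pderiv i).memLp ht)
      (fun i j k => (((hu.pderiv k).pderiv j).pderiv i).memLp ht)]
    exact Finset.single_le_sum (f := fun i => gradL2Sq (pderiv i (u t)))
      (fun j _ => gradL2Sq_nonneg _) (Finset.mem_univ i)
  have sq4 : ∀ f : Plane → Plane, l2Sq (fun x => ‖f x‖ ^ 2) = ∫ x, ‖f x‖ ^ 4 := fun f => by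
    refine integral_congr_ae (ae_of_all _ fun x => ?_)
    simp only [norm_pow, norm_norm]
    ring
  have m4 : ∀ f : Plane → Plane, Continuous f → Integrable (fun x => ‖f x‖ ^ 4) →
      MemLp (fun x => ‖f x‖ ^ 2) 2 := fun f hf hi => by
    refine (memLp_two_iff (f := fun x => ‖f x‖ ^ 2) (hf.norm.pow 2).aestronglyMeasurable).2 ?_
    refine hi.congr (ae_of_all _ fun x => ?_)
    simp only [norm_pow, norm_norm]
    ring
  have mu := m4 _ (hu.continuous ht) hu4
  have mp := fun i => m4 _ ((hu.pderiv i).continuous ht) (hp4 i).1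
  have hi : ∀ i, ∫ x, ‖u t x‖ ^ 2 * ‖pderiv i (u t) x‖ ^ 2 ≤ C * (X * (√l * √B)) := fun i => by
    have h1 := integral_norm_mul_le mu (mp i)
    simp only [norm_pow, norm_norm] at h1
    rw [sq4, sq4] at h1
    refine h1.trans ?_
    calc √(∫ x, ‖u t x‖ ^ 4) * √(∫ x, ‖pderiv i (u t) x‖ ^ 4)
        ≤ √(C * (l * X)) * √(C * (X * B)) := by
          refine mul_le_mul (Real.sqrt_le_sqrt hu4') (Real.sqrt_le_sqrt ((hp4 i).2.trans ?_))
            (Real.sqrt_nonneg _) (Real.sqrt_nonneg _)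
          refine mul_le_mul_of_nonneg_left ?_ hC0.le
          exact mul_le_mul (hXi i) (hBi i) (gradL2Sq_nonneg _) hX0
      _ = C * (X * (√l * √B)) := by
          rw [← Real.sqrt_mul (by positivity), ← Real.sqrt_mul hl0,
            show C * (l * X) * (C * (X * B)) = (C * X) ^ 2 * (l * B) by ring,
            Real.sqrt_mul (sq_nonneg _), Real.sqrt_sq (by positivity)]
          ring
  have hint : ∀ i, Integrable (fun x => ‖u t x‖ ^ 2 * ‖pderiv i (u t) x‖ ^ 2) := fun i => by
    simpa using integrable_norm_mul mu (mp i)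
  calc l2Sq (fun x => fderiv ℝ (u t) x (u t x))
      ≤ ∫ x, ∑ i, ‖u t x‖ ^ 2 * ‖pderiv i (u t) x‖ ^ 2 := by
        refine integral_mono (integrable_sq (h.memLp_convection ht))
          (integrable_finsetSum _ fun i _ => hint i) fun x => ?_
        simp only
        rw [← Finset.mul_sum]
        exact norm_fderiv_apply_sq_le _ _ _
    _ = ∑ i, ∫ x, ‖u t x‖ ^ 2 * ‖pderiv i (u t) x‖ ^ 2 := integral_finsetSum _ fun i _ => hint i
    _ ≤ _ := by
        rw [Fin.sum_univ_two]
        linarith [hi 0, hi 1]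

/-- The estimate for the Stokes system, tested against the time derivative. -/
lemma neg_integral_inner_lap_timeDeriv_le (h : IsSmoothSolution ρ u P)
    (h0 : ∀ x, 3 / 4 ≤ ρ 0 x ∧ ρ 0 x ≤ 5 / 4) (ht : 0 < t) :
    -2 * ∫ x, inner ℝ (lap (u t) x) (timeDeriv u t x) ≤
      -(2 / 5) * l2Sq (lap (u t)) + 5 / 2 * l2Sq (fun x => fderiv ℝ (u t) x (u t x)) := by
  have hu := h.smooth_velocity
  have hb : ∀ x, 3 / 4 ≤ ρ t x ∧ ρ t x ≤ 5 / 4 := fun x => by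
    have := abs_le.1 (h.abs_density_sub_one_le h0 ht.le x)
    constructor <;> linarith
  have hL := hu.lap.memLp ht.le
  have hw := h.memLp_timeDeriv ht
  have hN := h.memLp_convection ht.le
  have hP := h.smooth_pressure.memLp ht.le
  set L := lap (u t) with hLdef
  set w := timeDeriv u t with hwdef
  set N := fun x => fderiv ℝ (u t) x (u t x) with hNdef
  set Q := fun x => gradient (P t) x with hQdef
  have hmom : ∀ x, ρ t x • w x = L x - Q x - ρ t x • N x := fun x => h.momentum' ht.le x
  have i1 := integrable_inner hL hw
  have i2 := integrable_inner hw hP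
  have i3 := integrable_inner hL hP
  have i4 := integrable_sq hL
  have i5 := integrable_sq hN
  have i6 := integrable_sq hw
  have p1 : ∫ x, inner ℝ (w x) (Q x) = 0 := h.integral_inner_timeDeriv_pressure ht
  have p2 : ∫ x, inner ℝ (L x) (Q x) = 0 := h.integral_inner_lap_pressure ht.le
  -- the pointwise inequality behind the estimate
  have pw : ∀ x, 1 / 5 * ‖L x‖ ^ 2 - 5 / 4 * ‖N x‖ ^ 2 ≤
      inner ℝ (L x) (w x) - inner ℝ (w x) (Q x) + 2 / 5 * inner ℝ (L x) (Q x) := by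
    intro x
    have hm := hmom x
    have e : L x = ρ t x • w x + Q x + ρ t x • N x := by rw [hm]; abel
    have e1 : inner ℝ (L x) (w x) = ρ t x * ‖w x‖ ^ 2 + inner ℝ (w x) (Q x)
        + ρ t x * inner ℝ (w x) (N x) := by
      rw [e, inner_add_left, inner_add_left, inner_smul_left, inner_smul_left,
        real_inner_self_eq_norm_sq, real_inner_comm (w x) (Q x), real_inner_comm (w x) (N x)]
      simp
    have e2 : ‖L x‖ ^ 2 = ρ t x * inner ℝ (L x) (w x + N x) + inner ℝ (L x) (Q x) := by
      rw [← real_inner_self_eq_norm_sq]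
      nth_rewrite 2 [e]
      rw [inner_add_right, inner_add_right, inner_smul_right, inner_smul_right, inner_add_right]
      ring
    obtain ⟨b1, b2⟩ := hb x
    have f1 := norm_inner_le_norm (𝕜 := ℝ) (w x) (N x)
    have f2 := norm_inner_le_norm (𝕜 := ℝ) (L x) (w x + N x)
    have f3 := norm_add_le (w x) (N x)
    rw [Real.norm_eq_abs] at f1 f2
    have n1 := norm_nonneg (w x)
    have n2 := norm_nonneg (N x)
    have n3 := norm_nonneg (L x)
    have n4 := norm_nonneg (w x + N x)
    have g1 : -(‖w x‖ ^ 2 + ‖N x‖ ^ 2) / 2 ≤ inner ℝ (w x) (N x) := by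
      nlinarith [(abs_le.1 f1).1, sq_nonneg (‖w x‖ - ‖N x‖)]
    have g2 : ρ t x * inner ℝ (L x) (w x + N x) ≤
        1 / 2 * ‖L x‖ ^ 2 + 1 / 2 * ρ t x ^ 2 * ‖w x + N x‖ ^ 2 := by
      have : ρ t x * inner ℝ (L x) (w x + N x) ≤ ρ t x * (‖L x‖ * ‖w x + N x‖) :=
        mul_le_mul_of_nonneg_left (abs_le.1 f2).2 (by linarith)
      nlinarith [sq_nonneg (‖L x‖ - ρ t x * ‖w x + N x‖)]
    have g3 : ‖w x + N x‖ ^ 2 ≤ 2 * ‖w x‖ ^ 2 + 2 * ‖N x‖ ^ 2 := by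
      nlinarith [pow_le_pow_left₀ n4 f3 2, sq_nonneg (‖w x‖ - ‖N x‖)]
    have g4 : ρ t x ^ 2 ≤ 5 / 4 * ρ t x := by nlinarith
    have g5 : ρ t x ^ 2 * ‖w x + N x‖ ^ 2 ≤
        5 / 4 * ρ t x * (2 * ‖w x‖ ^ 2 + 2 * ‖N x‖ ^ 2) :=
      mul_le_mul g4 g3 (sq_nonneg _) (by nlinarith)
    have g6 : ρ t x * ‖N x‖ ^ 2 ≤ 5 / 4 * ‖N x‖ ^ 2 :=
      mul_le_mul_of_nonneg_right b2 (sq_nonneg _)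
    have g7 : ρ t x * (-(‖w x‖ ^ 2 + ‖N x‖ ^ 2) / 2) ≤ ρ t x * inner ℝ (w x) (N x) :=
      mul_le_mul_of_nonneg_left g1 (by linarith)
    linarith
  have hI := integral_mono ((i4.const_mul (1 / 5)).sub (i5.const_mul (5 / 4)))
    ((i1.sub i2).add (i3.const_mul (2 / 5))) pw
  have i12 : Integrable (fun x => inner ℝ (L x) (w x) - inner ℝ (w x) (Q x)) := i1.sub i2
  simp only [Pi.sub_apply, Pi.add_apply] at hI
  rw [integral_sub (i4.const_mul _) (i5.const_mul _), integral_add i12 (i3.const_mul _),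
    integral_sub i1 i2, integral_const_mul, integral_const_mul, integral_const_mul, p1, p2] at hI
  have hI' : 1 / 5 * l2Sq L - 5 / 4 * l2Sq N ≤ ∫ x, inner ℝ (L x) (w x) := by
    unfold l2Sq
    linarith
  linarith

end IsSmoothSolution

namespace IsSmoothSolution

lemma exists_deriv_gradL2Sq_le : ∃ K : ℝ, 0 < K ∧ ∀ (ρ : ℝ → Plane → ℝ) (u : ℝ → Plane → Plane)
    (P : ℝ → Plane → ℝ), IsSmoothSolution ρ u P → (∀ x, 3 / 4 ≤ ρ 0 x ∧ ρ 0 x ≤ 5 / 4) →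
    ∀ t, 0 < t → -2 * ∫ x, inner ℝ (lap (u t) x) (timeDeriv u t x) ≤
      K * (l2Sq (u t) * gradL2Sq (u t) ^ 2) := by
  obtain ⟨C, hC0, hC⟩ := exists_integral_pow_four_le
  refine ⟨125 / 8 * C ^ 2, by positivity, fun ρ u P h h0 t ht => ?_⟩
  have h1 := h.neg_integral_inner_lap_timeDeriv_le h0 ht
  have h2 := l2Sq_convection_le hC0 hC h ht.le
  set X := gradL2Sq (u t)
  have hb := Real.sq_sqrt (l2Sq_nonneg (lap (u t)))
  have hl := Real.sq_sqrt (l2Sq_nonneg (u t))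
  set b := √(l2Sq (lap (u t)))
  set l := √(l2Sq (u t))
  refine h1.trans ?_
  rw [← hb, ← hl]
  have h3 : 5 / 2 * l2Sq (fun x => fderiv ℝ (u t) x (u t x)) ≤ 5 / 2 * (2 * C * (X * (l * b))) :=
    mul_le_mul_of_nonneg_left h2 (by norm_num)
  nlinarith [sq_nonneg (2 / 5 * b - 5 / 2 * C * X * l)]

lemma energy_nonneg {ρ : ℝ → Plane → ℝ} {u : ℝ → Plane → Plane} {P : ℝ → Plane → ℝ} {t : ℝ}
    (h : IsSmoothSolution ρ u P) (ht : 0 ≤ t) : 0 ≤ E₀ (ρ t) (u t) :=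
  integral_nonneg fun x => mul_nonneg (h.density_pos t ht x).le (sq_nonneg _)

/-- Gronwall's inequality for the gradient of the velocity. -/
lemma exists_gradL2Sq_le : ∃ K : ℝ, 0 < K ∧ ∀ (ρ : ℝ → Plane → ℝ) (u : ℝ → Plane → Plane)
    (P : ℝ → Plane → ℝ), IsSmoothSolution ρ u P → (∀ x, 3 / 4 ≤ ρ 0 x ∧ ρ 0 x ≤ 5 / 4) →
    ∀ s t, 0 ≤ s → s ≤ t →
      gradL2Sq (u t) ≤ Real.exp (K * E₀ (ρ 0) (u 0) ^ 2) * gradL2Sq (u s) := by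
  obtain ⟨K, hK0, hK⟩ := exists_deriv_gradL2Sq_le
  refine ⟨2 / 3 * K, by positivity, fun ρ u P h h0 s t hs hst => ?_⟩
  set E := E₀ (ρ 0) (u 0) with hE
  have hE0 : 0 ≤ E := h.energy_nonneg le_rfl
  set c := 2 / 3 * K * E with hc
  have hc0 : 0 ≤ c := by positivity
  let Y : ℝ → ℝ := fun r => gradL2Sq (u r) * Real.exp (c * E₀ (ρ r) (u r))
  have hanti : AntitoneOn Y (Ici 0) := by
    refine antitoneOn_of_deriv_nonpos (convex_Ici 0) ?_ ?_ ?_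
    · exact h.continuousOn_gradL2Sq.mul (Real.continuous_exp.comp_continuousOn
        (continuousOn_const.mul h.continuousOn_energy))
    · intro r hr
      rw [interior_Ici] at hr
      exact ((h.hasDerivAt_gradL2Sq hr).mul
        ((h.hasDerivAt_energy hr).const_mul c).exp).differentiableAt.differentiableWithinAt
    · intro r hr
      rw [interior_Ici] at hr
      have hr0 : 0 ≤ r := le_of_lt hr
      have hd := ((h.hasDerivAt_gradL2Sq hr).mul ((h.hasDerivAt_energy hr).const_mul c).exp).deriv
      have hd' : deriv Y r = _ := hd
      rw [hd']
      have h1 := hK ρ u P h h0 r hr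
      have h2 := (h.energy_bounds h0 hr0).1
      have h3 : E₀ (ρ r) (u r) ≤ E := h.energy_antitone le_rfl hr0
      have hX0 := gradL2Sq_nonneg (u r)
      set X := gradL2Sq (u r)
      set e := Real.exp (c * E₀ (ρ r) (u r)) with he
      have he0 : 0 < e := Real.exp_pos _
      have h4 : K * (l2Sq (u r) * X ^ 2) ≤ 2 * c * X ^ 2 := by
        have : K * l2Sq (u r) ≤ 2 * c := by
          rw [hc]
          nlinarith
        nlinarith [sq_nonneg X]
      have h5 : (-2 * ∫ x, inner ℝ (lap (u r) x) (timeDeriv u r x)) * e ≤ (2 * c * X ^ 2) * e :=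
        mul_le_mul_of_nonneg_right (h1.trans h4) he0.le
      have : X * (e * (c * (-2 * X))) = -(2 * c * X ^ 2) * e := by ring
      linarith
  have h1 := hanti (show s ∈ Ici 0 from hs) (show t ∈ Ici 0 from hs.trans hst) hst
  have h2 : gradL2Sq (u t) ≤ Y t := by
    refine le_mul_of_one_le_right (gradL2Sq_nonneg _) (Real.one_le_exp ?_)
    exact mul_nonneg hc0 (h.energy_nonneg (hs.trans hst))
  refine (h2.trans h1).trans ?_
  simp only [Y]
  rw [mul_comm]
  refine mul_le_mul_of_nonneg_right (Real.exp_le_exp.2 ?_) (gradL2Sq_nonneg _)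
  have : c * E₀ (ρ s) (u s) ≤ c * E :=
    mul_le_mul_of_nonneg_left (h.energy_antitone le_rfl hs) hc0
  refine this.trans_eq ?_
  rw [hc]; ring

lemma exists_mul_gradL2Sq_le : ∃ K : ℝ, 0 < K ∧ ∀ (ρ : ℝ → Plane → ℝ) (u : ℝ → Plane → Plane)
    (P : ℝ → Plane → ℝ), IsSmoothSolution ρ u P → (∀ x, 3 / 4 ≤ ρ 0 x ∧ ρ 0 x ≤ 5 / 4) →
    ∀ t, 0 ≤ t →
      gradL2Sq (u t) ≤ Real.exp (K * E₀ (ρ 0) (u 0) ^ 2) * gradL2Sq (u 0) ∧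
      t * gradL2Sq (u t) ≤ Real.exp (K * E₀ (ρ 0) (u 0) ^ 2) * E₀ (ρ (t / 2)) (u (t / 2)) := by
  obtain ⟨K, hK0, hK⟩ := exists_gradL2Sq_le
  refine ⟨K, hK0, fun ρ u P h h0 t ht => ⟨hK ρ u P h h0 0 t le_rfl ht, ?_⟩⟩
  set e := Real.exp (K * E₀ (ρ 0) (u 0) ^ 2)
  have he0 : 0 < e := Real.exp_pos _
  have h2 : (0 : ℝ) ≤ t / 2 := by positivity
  have h3 : t / 2 ≤ t := by linarith
  have h1 := h.energy_identity h2 h3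
  rw [intervalIntegral.integral_const_mul] at h1
  have hEt := h.energy_nonneg ht
  have hI : ∫ _ in (t / 2)..t, gradL2Sq (u t) ≤ ∫ r in (t / 2)..t, e * gradL2Sq (u r) := by
    refine intervalIntegral.integral_mono_on h3 (by simp) ?_ fun r hr =>
      hK ρ u P h h0 r t (h2.trans hr.1) hr.2
    refine ContinuousOn.intervalIntegrable ?_
    rw [uIcc_of_le h3]
    exact continuousOn_const.mul (h.continuousOn_gradL2Sq.mono fun r hr => h2.trans hr.1)
  rw [intervalIntegral.integral_const, intervalIntegral.integral_const_mul, smul_eq_mul] at hI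
  have h4 : 2 * ∫ r in (t / 2)..t, gradL2Sq (u r) ≤ E₀ (ρ (t / 2)) (u (t / 2)) := by linarith
  have h5 := mul_le_mul_of_nonneg_left h4 he0.le
  linarith

end IsSmoothSolution

/-! ### The heat kernel -/

/-- The heat kernel of the plane. -/
def heat (τ : ℝ) (y : Plane) : ℝ := (4 * Real.pi * τ)⁻¹ * Real.exp (-(‖y‖ ^ 2 / (4 * τ)))

/-- The derivative of the heat kernel in time. -/
def heatDeriv (τ : ℝ) (y : Plane) : ℝ := (‖y‖ ^ 2 / (4 * τ ^ 2) - τ⁻¹) * heat τ y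

section heatKernel

variable {τ σ : ℝ}

lemma heat_pos (hτ : 0 < τ) (y : Plane) : 0 < heat τ y := by
  have := Real.pi_pos
  unfold heat
  positivity

lemma continuous_heat (τ : ℝ) : Continuous (heat τ) := by
  unfold heat; fun_prop

lemma continuous_heatDeriv (τ : ℝ) : Continuous (heatDeriv τ) := by
  have := continuous_heat τ
  unfold heatDeriv; fun_prop

lemma integral_heat (hτ : 0 < τ) : ∫ y, heat τ y = 1 := by
  have hb : 0 < (4 * τ)⁻¹ := by positivity
  have h1 := GaussianFourier.integral_rexp_neg_mul_sq_norm (V := Plane) hb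
  rw [finrank_euclideanSpace_fin] at h1
  have e : ∀ y : Plane, heat τ y =
      (4 * Real.pi * τ)⁻¹ * Real.exp (-(4 * τ)⁻¹ * ‖y‖ ^ 2) := fun y => by
    unfold heat; congr 2; ring
  simp only [e]
  rw [integral_const_mul, h1]
  have := Real.pi_pos
  norm_num
  field_simp

lemma integrable_heat (hτ : 0 < τ) : Integrable (heat τ) := by
  by_contra hc
  have h1 := integral_heat hτ
  rw [integral_undef hc] at h1
  norm_num at h1

lemma heat_le_mul_heat (hσ : 0 < σ) (h : σ ≤ τ) (y : Plane) : heat σ y ≤ τ / σ * heat τ y := by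
  have hτ : 0 < τ := hσ.trans_le h
  have := Real.pi_pos
  unfold heat
  have e : τ / σ * ((4 * Real.pi * τ)⁻¹ * Real.exp (-(‖y‖ ^ 2 / (4 * τ)))) =
      (4 * Real.pi * σ)⁻¹ * Real.exp (-(‖y‖ ^ 2 / (4 * τ))) := by field_simp
  rw [e]
  refine mul_le_mul_of_nonneg_left (Real.exp_le_exp.2 ?_) (by positivity)
  refine neg_le_neg (div_le_div_of_nonneg_left (sq_nonneg _) (by positivity) (by linarith))

lemma sq_mul_heat_le (hτ : 0 < τ) (y : Plane) : ‖y‖ ^ 2 * heat τ y ≤ 16 * τ * heat (2 * τ) y := by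
  have := Real.pi_pos
  set s := ‖y‖ ^ 2 / (8 * τ) with hs
  have hy : ‖y‖ ^ 2 = 8 * τ * s := by rw [hs]; field_simp
  have hs0 : 0 ≤ s := by positivity
  have e1 : heat τ y = (4 * Real.pi * τ)⁻¹ * (Real.exp (-s) * Real.exp (-s)) := by
    rw [heat, ← Real.exp_add, hy]; congr 2; field_simp; ring
  have e2 : heat (2 * τ) y = (8 * Real.pi * τ)⁻¹ * Real.exp (-s) := by
    rw [heat, hy]; congr 2
    · ring
    · field_simp; ring
  have h1 : s * Real.exp (-s) ≤ 1 := by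
    rw [Real.exp_neg, ← div_eq_mul_inv, div_le_one (Real.exp_pos s)]
    linarith [Real.add_one_le_exp s]
  rw [e1, e2, hy]
  have e3 : 8 * τ * s * ((4 * Real.pi * τ)⁻¹ * (Real.exp (-s) * Real.exp (-s))) =
      (2 * Real.pi⁻¹ * Real.exp (-s)) * (s * Real.exp (-s)) := by field_simp; ring
  have e4 : 16 * τ * ((8 * Real.pi * τ)⁻¹ * Real.exp (-s)) = (2 * Real.pi⁻¹ * Real.exp (-s)) * 1 := by
    field_simp; ring
  rw [e3, e4]
  exact mul_le_mul_of_nonneg_left h1 (by positivity)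

lemma heat_le_two_mul (hτ : 0 < τ) (y : Plane) : heat τ y ≤ 2 * heat (2 * τ) y := by
  have := heat_le_mul_heat hτ (by linarith : τ ≤ 2 * τ) y
  rwa [mul_div_assoc, div_self hτ.ne', mul_one] at this

lemma norm_mul_heat_le (hτ : 0 < τ) (y : Plane) : ‖y‖ * heat τ y ≤ 6 * √τ * heat (2 * τ) y := by
  have h1 := sq_mul_heat_le hτ y
  have h2 := heat_le_two_mul hτ y
  have hp := heat_pos hτ y
  have hs : 0 < √τ := Real.sqrt_pos.2 hτ
  have hs2 : √τ ^ 2 = τ := Real.sq_sqrt hτ.le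
  have h3 : ‖y‖ ≤ ‖y‖ ^ 2 / (4 * √τ) + √τ := by
    have : 0 ≤ (‖y‖ - 2 * √τ) ^ 2 / (4 * √τ) := by positivity
    have e : (‖y‖ - 2 * √τ) ^ 2 / (4 * √τ) = ‖y‖ ^ 2 / (4 * √τ) + √τ - ‖y‖ := by
      field_simp; ring
    linarith
  calc ‖y‖ * heat τ y ≤ (‖y‖ ^ 2 / (4 * √τ) + √τ) * heat τ y :=
        mul_le_mul_of_nonneg_right h3 hp.le
    _ = (‖y‖ ^ 2 * heat τ y) / (4 * √τ) + √τ * heat τ y := by ring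
    _ ≤ (16 * τ * heat (2 * τ) y) / (4 * √τ) + √τ * (2 * heat (2 * τ) y) := by gcongr
    _ = _ := by
      nth_rewrite 1 [← hs2]
      field_simp
      ring

lemma abs_heatDeriv_le (hτ : 0 < τ) (y : Plane) : |heatDeriv τ y| ≤ 6 / τ * heat (2 * τ) y := by
  have h1 := sq_mul_heat_le hτ y
  have h2 := heat_le_two_mul hτ y
  have hp := heat_pos hτ y
  rw [heatDeriv, abs_mul, abs_of_pos hp]
  have h3 : |‖y‖ ^ 2 / (4 * τ ^ 2) - τ⁻¹| ≤ ‖y‖ ^ 2 / (4 * τ ^ 2) + τ⁻¹ := by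
    rw [abs_le]
    have a1 : 0 ≤ ‖y‖ ^ 2 / (4 * τ ^ 2) := by positivity
    have a2 : 0 ≤ τ⁻¹ := by positivity
    constructor <;> linarith
  calc |‖y‖ ^ 2 / (4 * τ ^ 2) - τ⁻¹| * heat τ y ≤ (‖y‖ ^ 2 / (4 * τ ^ 2) + τ⁻¹) * heat τ y :=
        mul_le_mul_of_nonneg_right h3 hp.le
    _ = (‖y‖ ^ 2 * heat τ y) / (4 * τ ^ 2) + τ⁻¹ * heat τ y := by ring
    _ ≤ (16 * τ * heat (2 * τ) y) / (4 * τ ^ 2) + τ⁻¹ * (2 * heat (2 * τ) y) := by gcongr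
    _ = _ := by field_simp; ring

lemma l2Sq_heat (hτ : 0 < τ) : MemLp (heat τ) 2 ∧ l2Sq (heat τ) ≤ τ⁻¹ := by
  have hpi := Real.pi_gt_three
  have e : ∀ y, ‖heat τ y‖ ^ 2 = (8 * Real.pi * τ)⁻¹ * heat (τ / 2) y := fun y => by
    rw [Real.norm_of_nonneg (heat_pos hτ y).le, heat, heat, mul_pow, ← Real.exp_nat_mul]
    rw [← mul_assoc]
    congr 1
    · field_simp; ring
    · congr 1; push_cast; field_simp
  have hi : Integrable (fun y => ‖heat τ y‖ ^ 2) := by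
    simp only [e]
    exact (integrable_heat (half_pos hτ)).const_mul _
  refine ⟨(memLp_two_iff (continuous_heat τ).aestronglyMeasurable).2 hi, ?_⟩
  unfold l2Sq
  simp only [e]
  rw [integral_const_mul, integral_heat (half_pos hτ), mul_one]
  refine inv_anti₀ hτ ?_
  nlinarith

lemma hasDerivAt_heat (hτ : 0 < τ) (y : Plane) :
    HasDerivAt (fun τ => heat τ y) (heatDeriv τ y) τ := by
  have hpi := Real.pi_pos
  have h1 : HasDerivAt (fun τ : ℝ => (4 * Real.pi * τ)⁻¹)
      (-(4 * Real.pi) / (4 * Real.pi * τ) ^ 2) τ := by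
    have h0 : HasDerivAt (fun τ : ℝ => 4 * Real.pi * τ) (4 * Real.pi) τ := by
      simpa using (hasDerivAt_id τ).const_mul (4 * Real.pi)
    exact h0.inv (by positivity)
  have h2 : HasDerivAt (fun τ : ℝ => -(‖y‖ ^ 2 / (4 * τ))) (‖y‖ ^ 2 / (4 * τ ^ 2)) τ := by
    have := ((((hasDerivAt_id τ).const_mul 4).inv (by simp; exact hτ.ne')).const_mul (‖y‖ ^ 2)).neg
    refine (this.congr_deriv ?_).congr_of_eventuallyEq (Eventually.of_forall fun r => ?_)
    · simp; field_simp
    · simp [div_eq_mul_inv]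
  refine (h1.mul h2.exp).congr_deriv ?_
  rw [heatDeriv, heat]
  field_simp
  ring

lemma hasFDerivAt_heat (hτ : 0 < τ) (y : Plane) :
    HasFDerivAt (heat τ) ((-(2 * τ)⁻¹ * heat τ y) • innerSL ℝ y) y := by
  have h1 : HasFDerivAt (fun y : Plane => ‖y‖ ^ 2) (2 • innerSL ℝ y) y := by
    simpa using (hasFDerivAt_id (𝕜 := ℝ) y).norm_sq
  have h2 := ((h1.const_mul (-(4 * τ)⁻¹)).exp).const_mul ((4 * Real.pi * τ)⁻¹)
  have h3 : heat τ = fun y => (4 * Real.pi * τ)⁻¹ * Real.exp (-(4 * τ)⁻¹ * ‖y‖ ^ 2) := by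
    funext z; unfold heat; congr 2; ring
  rw [h3]
  refine h2.congr_fderiv ?_
  ext v
  simp
  field_simp
  ring

lemma pderiv_heat (hτ : 0 < τ) (i : Fin 2) (y : Plane) :
    pderiv i (heat τ) y = -(2 * τ)⁻¹ * y i * heat τ y := by
  rw [pderiv, (hasFDerivAt_heat hτ y).fderiv]
  simp [EuclideanSpace.inner_single_right]
  ring

lemma differentiable_heat (hτ : 0 < τ) : Differentiable ℝ (heat τ) := fun y =>
  (hasFDerivAt_heat hτ y).differentiableAt

lemma differentiable_pderiv_heat (hτ : 0 < τ) (i : Fin 2) :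
    Differentiable ℝ (pderiv i (heat τ)) := by
  rw [show pderiv i (heat τ) = fun y => -(2 * τ)⁻¹ * y i * heat τ y from
    funext fun y => pderiv_heat hτ i y]
  have := differentiable_heat hτ
  fun_prop

lemma pderiv_pderiv_heat (hτ : 0 < τ) (i : Fin 2) (y : Plane) :
    pderiv i (pderiv i (heat τ)) y = (-(2 * τ)⁻¹ + (2 * τ)⁻¹ ^ 2 * y i ^ 2) * heat τ y := by
  rw [show pderiv i (heat τ) = fun y => (-(2 * τ)⁻¹ * y i) * heat τ y from
    funext fun y => pderiv_heat hτ i y]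
  have hd : Differentiable ℝ (fun y : Plane => -(2 * τ)⁻¹ * y i) := by fun_prop
  rw [pderiv_mul (hd y) (differentiable_heat hτ y), pderiv_heat hτ]
  have : pderiv i (fun y : Plane => -(2 * τ)⁻¹ * y i) y = -(2 * τ)⁻¹ := by
    have h1 : HasFDerivAt (fun y : Plane => -(2 * τ)⁻¹ * y i)
        (-(2 * τ)⁻¹ • (EuclideanSpace.proj i : Plane →L[ℝ] ℝ)) y :=
      (EuclideanSpace.proj (𝕜 := ℝ) i).hasFDerivAt.const_mul _
    rw [pderiv, h1.fderiv]
    simp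
  rw [this]
  ring

lemma continuous_pderiv_pderiv_heat (hτ : 0 < τ) (i : Fin 2) :
    Continuous (pderiv i (pderiv i (heat τ))) := by
  rw [show pderiv i (pderiv i (heat τ)) = fun y => (-(2 * τ)⁻¹ + (2 * τ)⁻¹ ^ 2 * y i ^ 2) *
    heat τ y from funext fun y => pderiv_pderiv_heat hτ i y]
  have := continuous_heat τ
  fun_prop

lemma sum_pderiv_pderiv_heat (hτ : 0 < τ) (y : Plane) :
    ∑ i, pderiv i (pderiv i (heat τ)) y = heatDeriv τ y := by
  simp only [pderiv_pderiv_heat hτ]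
  rw [← Finset.sum_mul, heatDeriv, Finset.sum_add_distrib, ← Finset.mul_sum,
    EuclideanSpace.norm_sq_eq]
  simp only [Real.norm_eq_abs, sq_abs, Fin.sum_univ_two]
  field_simp
  ring

lemma abs_pderiv_heat_le (hτ : 0 < τ) (i : Fin 2) (y : Plane) :
    |pderiv i (heat τ) y| ≤ 3 / √τ * heat (2 * τ) y := by
  have h1 := norm_mul_heat_le hτ y
  have hp := heat_pos hτ y
  have h2 : |y i| ≤ ‖y‖ := by simpa using PiLp.norm_apply_le y i
  have hs : 0 < √τ := Real.sqrt_pos.2 hτ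
  have hs2 : √τ ^ 2 = τ := Real.sq_sqrt hτ.le
  rw [pderiv_heat hτ, abs_mul, abs_mul, abs_neg, abs_of_pos hp, abs_of_pos (by positivity)]
  calc (2 * τ)⁻¹ * |y i| * heat τ y ≤ (2 * τ)⁻¹ * (‖y‖ * heat τ y) := by
        rw [mul_assoc]; gcongr
    _ ≤ (2 * τ)⁻¹ * (6 * √τ * heat (2 * τ) y) := by gcongr
    _ = _ := by
      nth_rewrite 1 [← hs2]
      field_simp
      ring

lemma abs_pderiv_pderiv_heat_le (hτ : 0 < τ) (i : Fin 2) (y : Plane) :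
    |pderiv i (pderiv i (heat τ)) y| ≤ 6 / τ * heat (2 * τ) y := by
  have h1 := sq_mul_heat_le hτ y
  have h2 := heat_le_two_mul hτ y
  have hp := heat_pos hτ y
  have hp2 := heat_pos (by positivity : 0 < 2 * τ) y
  have h3 : y i ^ 2 ≤ ‖y‖ ^ 2 := by
    rw [← sq_abs (y i)]
    exact pow_le_pow_left₀ (abs_nonneg _) (by simpa using PiLp.norm_apply_le y i) 2
  rw [pderiv_pderiv_heat hτ, abs_mul, abs_of_pos hp]
  have h4 : |-(2 * τ)⁻¹ + (2 * τ)⁻¹ ^ 2 * y i ^ 2| ≤ (2 * τ)⁻¹ + (2 * τ)⁻¹ ^ 2 * ‖y‖ ^ 2 := by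
    refine (abs_add_le _ _).trans ?_
    rw [abs_neg, abs_of_nonneg (by positivity), abs_of_nonneg (by positivity)]
    gcongr
  calc |-(2 * τ)⁻¹ + (2 * τ)⁻¹ ^ 2 * y i ^ 2| * heat τ y
      ≤ ((2 * τ)⁻¹ + (2 * τ)⁻¹ ^ 2 * ‖y‖ ^ 2) * heat τ y := mul_le_mul_of_nonneg_right h4 hp.le
    _ = (2 * τ)⁻¹ * heat τ y + (2 * τ)⁻¹ ^ 2 * (‖y‖ ^ 2 * heat τ y) := by ring
    _ ≤ (2 * τ)⁻¹ * (2 * heat (2 * τ) y) + (2 * τ)⁻¹ ^ 2 * (16 * τ * heat (2 * τ) y) := by gcongr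
    _ = 5 / τ * heat (2 * τ) y := by field_simp; ring
    _ ≤ _ := by gcongr; norm_num

end heatKernel

/-! ### Convolution with Gaussian kernels -/

/-- The convolution `K * h` of a scalar kernel and a vector field. -/
def conv (K : Plane → ℝ) (h : Plane → Plane) (x : Plane) : Plane := ∫ y, K y • h (x - y)

section kernel

variable {K : Plane → ℝ} {h : Plane → Plane} {c σ M : ℝ}

lemma integrable_kernel (hσ : 0 < σ) (hK : Continuous K) (hKb : ∀ y, |K y| ≤ c * heat σ y) :
    Integrable K :=
  ((integrable_heat hσ).const_mul c).mono' hK.aestronglyMeasurable (ae_of_all _ hKb)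

lemma integrable_conv (hσ : 0 < σ) (hK : Continuous K) (hKb : ∀ y, |K y| ≤ c * heat σ y)
    (hh : Continuous h) (hM : ∀ x, ‖h x‖ ≤ M) (x : Plane) :
    Integrable (fun y => K y • h (x - y)) := by
  refine ((integrable_kernel hσ hK hKb).norm.mul_const M).mono'
    (by fun_prop : Continuous fun y => K y • h (x - y)).aestronglyMeasurable
    (ae_of_all _ fun y => ?_)
  rw [norm_smul]
  exact mul_le_mul_of_nonneg_left (hM _) (norm_nonneg _)

lemma continuous_conv (hσ : 0 < σ) (hK : Continuous K) (hKb : ∀ y, |K y| ≤ c * heat σ y)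
    (hh : Continuous h) (hM : ∀ x, ‖h x‖ ≤ M) : Continuous (conv K h) := by
  refine continuous_of_dominated (bound := fun y => ‖K y‖ * M)
    (fun x => (integrable_conv hσ hK hKb hh hM x).1) (fun x => ae_of_all _ fun y => ?_)
    ((integrable_kernel hσ hK hKb).norm.mul_const M) (ae_of_all _ fun y => by fun_prop)
  rw [norm_smul]
  exact mul_le_mul_of_nonneg_left (hM _) (norm_nonneg _)

lemma norm_fderiv_le_of_pderiv {f : Plane → Plane} {x : Plane}
    (hM : ∀ i, ‖pderiv i f x‖ ≤ M) : ‖fderiv ℝ f x‖ ≤ 2 * M := by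
  have h0 : 0 ≤ M := (norm_nonneg _).trans (hM 0)
  exact ContinuousLinearMap.opNorm_le_bound _ (by positivity) fun v => norm_fderiv_apply_le hM v

lemma hasFDerivAt_conv (hσ : 0 < σ) (hK : Continuous K) (hKb : ∀ y, |K y| ≤ c * heat σ y)
    (hh : ContDiff ℝ 1 h) (hM : ∀ x, ‖h x‖ ≤ M) (hM' : ∀ i x, ‖pderiv i h x‖ ≤ M) (x : Plane) :
    HasFDerivAt (conv K h) (∫ y, K y • fderiv ℝ h (x - y)) x := by
  have hc : Continuous (fderiv ℝ h) := hh.continuous_fderiv (by norm_num)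
  refine hasFDerivAt_integral_of_dominated_of_fderiv_le (bound := fun y => ‖K y‖ * (2 * M))
    (F' := fun x y => K y • fderiv ℝ h (x - y))
    (s := univ) univ_mem (Eventually.of_forall fun x =>
      (integrable_conv hσ hK hKb hh.continuous hM x).1)
    (integrable_conv hσ hK hKb hh.continuous hM x)
    (by fun_prop : Continuous fun y => K y • fderiv ℝ h (x - y)).aestronglyMeasurable
    (ae_of_all _ fun y z _ => ?_) ((integrable_kernel hσ hK hKb).norm.mul_const _)
    (ae_of_all _ fun y z _ => ?_)
  · rw [norm_smul]
    exact mul_le_mul_of_nonneg_left (norm_fderiv_le_of_pderiv fun i => hM' i _) (norm_nonneg _)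
  · have h1 : HasFDerivAt h (fderiv ℝ h (z - y)) (z - y) :=
      (hh.differentiable (by norm_num) (z - y)).hasFDerivAt
    have h2 := h1.comp z ((hasFDerivAt_id z).sub_const y)
    exact (h2.const_smul (K y))

lemma pderiv_conv (hσ : 0 < σ) (hK : Continuous K) (hKb : ∀ y, |K y| ≤ c * heat σ y)
    (hh : ContDiff ℝ 1 h) (hM : ∀ x, ‖h x‖ ≤ M) (hM' : ∀ i x, ‖pderiv i h x‖ ≤ M)
    (i : Fin 2) : pderiv i (conv K h) = conv K (pderiv i h) := by
  funext x
  have hc : Continuous (fderiv ℝ h) := hh.continuous_fderiv (by norm_num)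
  have hi : Integrable (fun y => K y • fderiv ℝ h (x - y)) := by
    refine ((integrable_kernel hσ hK hKb).norm.mul_const (2 * M)).mono'
      (by fun_prop : Continuous fun y => K y • fderiv ℝ h (x - y)).aestronglyMeasurable
      (ae_of_all _ fun y => ?_)
    rw [norm_smul]
    exact mul_le_mul_of_nonneg_left (norm_fderiv_le_of_pderiv fun i => hM' i _) (norm_nonneg _)
  rw [pderiv, (hasFDerivAt_conv hσ hK hKb hh hM hM' x).fderiv, ContinuousLinearMap.integral_apply hi]
  rfl

lemma differentiable_conv (hσ : 0 < σ) (hK : Continuous K) (hKb : ∀ y, |K y| ≤ c * heat σ y)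
    (hh : ContDiff ℝ 1 h) (hM : ∀ x, ‖h x‖ ≤ M) (hM' : ∀ i x, ‖pderiv i h x‖ ≤ M) :
    Differentiable ℝ (conv K h) := fun x =>
  (hasFDerivAt_conv hσ hK hKb hh hM hM' x).differentiableAt

lemma divergence_conv (hσ : 0 < σ) (hK : Continuous K) (hKb : ∀ y, |K y| ≤ c * heat σ y)
    (hh : ContDiff ℝ 1 h) (hM : ∀ x, ‖h x‖ ≤ M) (hM' : ∀ i x, ‖pderiv i h x‖ ≤ M)
    (hdiv : ∀ x, divergence h x = 0) (x : Plane) : divergence (conv K h) x = 0 := by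
  have hp : ∀ i, Continuous (pderiv i h) := fun i =>
    (contDiff_pderiv (n := 0) hh (by norm_num) i).continuous
  have hi := fun i => integrable_conv hσ hK hKb (hp i) (hM' i) x
  have e : ∀ i, conv K (pderiv i h) x i = ∫ y, K y * pderiv i h (x - y) i := fun i => by
    have := (EuclideanSpace.proj (𝕜 := ℝ) i : Plane →L[ℝ] ℝ).integral_comp_comm (hi i)
    rw [conv]
    simpa using this.symm
  have hi' : ∀ i, Integrable (fun y => K y * pderiv i h (x - y) i) := fun i => by
    simpa using (EuclideanSpace.proj (𝕜 := ℝ) i : Plane →L[ℝ] ℝ).integrable_comp (hi i)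
  rw [divergence]
  simp only [pderiv_conv hσ hK hKb hh hM hM', e]
  rw [← integral_finsetSum _ fun i _ => hi' i]
  have : ∀ y, ∑ i, K y * pderiv i h (x - y) i = 0 := fun y => by
    rw [← Finset.mul_sum]
    have := hdiv (x - y)
    rw [divergence] at this
    rw [this, mul_zero]
  simp only [this, integral_zero]

lemma conv_pderiv {c' σ' : ℝ} (hσ : 0 < σ) (hσ' : 0 < σ') (hK : Differentiable ℝ K)
    (i : Fin 2) (hK' : Continuous (pderiv i K))
    (hKb : ∀ y, |K y| ≤ c * heat σ y) (hKb' : ∀ y, |pderiv i K y| ≤ c' * heat σ' y)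
    (hh : ContDiff ℝ 1 h) (hM : ∀ x, ‖h x‖ ≤ M) (hM' : ∀ x, ‖pderiv i h x‖ ≤ M) :
    conv K (pderiv i h) = conv (pderiv i K) h := by
  funext x
  have hp : Continuous (pderiv i h) := (contDiff_pderiv (n := 0) hh (by norm_num) i).continuous
  have hd : Differentiable ℝ h := hh.differentiable (by norm_num)
  have hf : ∀ y, fderiv ℝ (fun y => h (x - y)) y (EuclideanSpace.single i 1) =
      -pderiv i h (x - y) := fun y => by
    have h1 := (hd (x - y)).hasFDerivAt.comp y ((hasFDerivAt_id y).const_sub x)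
    have h2 : fderiv ℝ (fun y => h (x - y)) y = _ := h1.fderiv
    rw [h2, pderiv]
    simp
  have h1 := integrable_conv hσ hK.continuous hKb hp hM' x
  have h2 := integrable_conv hσ' hK' hKb' hh.continuous hM x
  have h3 := integrable_conv hσ hK.continuous hKb hh.continuous hM x
  have := integral_smul_fderiv_eq_neg_fderiv_smul_of_integrable (μ := (volume : Measure Plane))
    (f := K) (g := fun y => h (x - y)) (v := EuclideanSpace.single i 1) h2
    (by simp only [hf, smul_neg]; exact h1.neg) h3 (fun y _ => hK y)
    (fun y _ => by fun_prop)
  simp only [hf, smul_neg, integral_neg, neg_inj] at this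
  exact this

lemma norm_conv_le_sup (hσ : 0 < σ) (hc : 0 ≤ c) (hKb : ∀ y, |K y| ≤ c * heat σ y)
    (hh2 : MemLp h 2) (x : Plane) :
    ‖conv K h x‖ ≤ c * √(σ⁻¹) * √(l2Sq h) := by
  obtain ⟨hm, hl⟩ := l2Sq_heat hσ
  have hmp := (Measure.measurePreserving_sub_left (volume : Measure Plane) x)
  have h2 : MemLp (fun y => h (x - y)) 2 := hh2.comp_measurePreserving hmp
  have e2 : l2Sq (fun y => h (x - y)) = l2Sq h := by
    unfold l2Sq
    exact integral_sub_left_eq_self (fun y => ‖h y‖ ^ 2) volume x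
  calc ‖conv K h x‖ ≤ ∫ y, c * (‖heat σ y‖ * ‖h (x - y)‖) := by
        refine norm_integral_le_of_norm_le ((integrable_norm_mul hm h2).const_mul c)
          (ae_of_all _ fun y => ?_)
        rw [norm_smul, ← mul_assoc, Real.norm_of_nonneg (heat_pos hσ y).le]
        exact mul_le_mul_of_nonneg_right (hKb y) (norm_nonneg _)
    _ = c * ∫ y, ‖heat σ y‖ * ‖h (x - y)‖ := integral_const_mul _ _
    _ ≤ c * (√(σ⁻¹) * √(l2Sq h)) := by
        refine mul_le_mul_of_nonneg_left ((integral_norm_mul_le hm h2).trans ?_) hc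
        rw [e2]
        gcongr
    _ = _ := by ring

end kernel

/-- An `L²` bound for functions dominated by Gaussian averages. -/
lemma memLp_of_norm_le_integral_heat {F : Plane → Plane} {g : Plane → Plane → ℝ} {B : Plane → ℝ}
    {c σ : ℝ} (hσ : 0 < σ) (hF : Continuous F) (hg : Continuous (Function.uncurry g))
    (hg0 : ∀ x y, 0 ≤ g x y)
    (hM : ∀ x, ∃ M, ∀ y, g x y ≤ M) (hg2 : ∀ y, Integrable (fun x => g x y ^ 2))
    (hB : ∀ y, ∫ x, g x y ^ 2 ≤ B y) (hBi : Integrable (fun y => heat σ y * B y))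
    (hle : ∀ x, ‖F x‖ ≤ c * ∫ y, heat σ y * g x y) :
    MemLp F 2 ∧ l2Sq F ≤ c ^ 2 * ∫ y, heat σ y * B y := by
  have hgx : ∀ x, Continuous (g x) := fun x => hg.comp (by fun_prop : Continuous fun y => (x, y))
  have hH := continuous_heat σ
  have hpos := fun y => heat_pos hσ y
  have i1 : ∀ x, Integrable (fun y => heat σ y * g x y) := fun x => by
    obtain ⟨M, hM⟩ := hM x
    refine ((integrable_heat hσ).mul_const M).mono'
      (hH.mul (hgx x)).aestronglyMeasurable (ae_of_all _ fun y => ?_)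
    rw [Real.norm_of_nonneg (mul_nonneg (hpos y).le (hg0 x y))]
    exact mul_le_mul_of_nonneg_left (hM y) (hpos y).le
  have i2 : ∀ x, Integrable (fun y => heat σ y * g x y ^ 2) := fun x => by
    obtain ⟨M, hM⟩ := hM x
    refine ((integrable_heat hσ).mul_const (M ^ 2)).mono'
      (hH.mul ((hgx x).pow 2)).aestronglyMeasurable (ae_of_all _ fun y => ?_)
    rw [Real.norm_of_nonneg (mul_nonneg (hpos y).le (sq_nonneg _))]
    exact mul_le_mul_of_nonneg_left (pow_le_pow_left₀ (hg0 x y) (hM y) 2) (hpos y).le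
  have jensen : ∀ x, (∫ y, heat σ y * g x y) ^ 2 ≤ ∫ y, heat σ y * g x y ^ 2 := fun x => by
    set m := ∫ y, heat σ y * g x y with hm
    have h0 : 0 ≤ ∫ y, heat σ y * (g x y - m) ^ 2 :=
      integral_nonneg fun y => mul_nonneg (hpos y).le (sq_nonneg _)
    have i3 : Integrable (fun y => heat σ y * g x y ^ 2 - 2 * m * (heat σ y * g x y)) :=
      (i2 x).sub ((i1 x).const_mul _)
    have e : ∀ y, heat σ y * (g x y - m) ^ 2 =
        heat σ y * g x y ^ 2 - 2 * m * (heat σ y * g x y) + m ^ 2 * heat σ y := fun y => by ring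
    simp only [e] at h0
    rw [integral_add i3 ((integrable_heat hσ).const_mul _),
      integral_sub (i2 x) ((i1 x).const_mul _), integral_const_mul, integral_const_mul,
      integral_heat hσ, ← hm] at h0
    nlinarith
  have hcont : Continuous (fun q : Plane × Plane => heat σ q.2 * g q.1 q.2 ^ 2) :=
    (hH.comp continuous_snd).mul (hg.pow 2)
  have hprod : Integrable (fun q : Plane × Plane => heat σ q.2 * g q.1 q.2 ^ 2)
      (volume.prod volume) := by
    rw [integrable_prod_iff' hcont.aestronglyMeasurable]
    refine ⟨ae_of_all _ fun y => (hg2 y).const_mul (heat σ y), ?_⟩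
    refine hBi.mono' ?_ (ae_of_all _ fun y => ?_)
    · exact (hcont.norm.comp continuous_swap).aestronglyMeasurable.integral_prod_right'
        (μ := (volume : Measure Plane)) (ν := (volume : Measure Plane))
    · have e : ∀ x, ‖heat σ y * g x y ^ 2‖ = heat σ y * g x y ^ 2 := fun x =>
        Real.norm_of_nonneg (mul_nonneg (hpos y).le (sq_nonneg _))
      simp only [e]
      rw [integral_const_mul, Real.norm_of_nonneg
        (mul_nonneg (hpos y).le (integral_nonneg fun x => sq_nonneg _))]
      exact mul_le_mul_of_nonneg_left (hB y) (hpos y).le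
  have hint : Integrable (fun x => ∫ y, heat σ y * g x y ^ 2) := hprod.integral_prod_left
  have hpt : ∀ x, ‖F x‖ ^ 2 ≤ c ^ 2 * ∫ y, heat σ y * g x y ^ 2 := fun x => by
    calc ‖F x‖ ^ 2 ≤ (c * ∫ y, heat σ y * g x y) ^ 2 :=
          pow_le_pow_left₀ (norm_nonneg _) (hle x) 2
      _ = c ^ 2 * (∫ y, heat σ y * g x y) ^ 2 := mul_pow _ _ _
      _ ≤ _ := mul_le_mul_of_nonneg_left (jensen x) (sq_nonneg _)
  have hFi : Integrable (fun x => ‖F x‖ ^ 2) :=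
    (hint.const_mul (c ^ 2)).mono' (hF.norm.pow 2).aestronglyMeasurable (ae_of_all _ fun x => by
      rw [Real.norm_of_nonneg (sq_nonneg _)]; exact hpt x)
  refine ⟨(memLp_two_iff hF.aestronglyMeasurable).2 hFi, ?_⟩
  calc l2Sq F ≤ ∫ x, c ^ 2 * ∫ y, heat σ y * g x y ^ 2 :=
        integral_mono hFi (hint.const_mul _) hpt
    _ = c ^ 2 * ∫ x, ∫ y, heat σ y * g x y ^ 2 := integral_const_mul _ _
    _ = c ^ 2 * ∫ y, ∫ x, heat σ y * g x y ^ 2 := by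
        rw [integral_integral_swap hprod]
    _ ≤ _ := by
        refine mul_le_mul_of_nonneg_left (integral_mono hprod.integral_prod_right hBi fun y => ?_)
          (sq_nonneg _)
        simp only [integral_const_mul]
        exact mul_le_mul_of_nonneg_left (hB y) (hpos y).le

lemma memLp_conv {K : Plane → ℝ} {h : Plane → Plane} {c σ M : ℝ} (hσ : 0 < σ)
    (hK : Continuous K) (hKb : ∀ y, |K y| ≤ c * heat σ y)
    (hh : Continuous h) (hM : ∀ x, ‖h x‖ ≤ M) (hh2 : MemLp h 2) :
    MemLp (conv K h) 2 ∧ l2Sq (conv K h) ≤ c ^ 2 * l2Sq h := by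
  have e : ∀ y, ∫ x, ‖h (x - y)‖ ^ 2 = l2Sq h := fun y =>
    integral_sub_right_eq_self (fun x => ‖h x‖ ^ 2) y
  have key := memLp_of_norm_le_integral_heat (c := c) (F := conv K h) (g := fun x y => ‖h (x - y)‖)
    (B := fun _ => l2Sq h) hσ (continuous_conv hσ hK hKb hh hM)
    (by simp only [Function.uncurry_def]; fun_prop) (fun _ _ => norm_nonneg _)
    (fun x => ⟨M, fun y => hM _⟩)
    (fun y => (integrable_sq hh2).comp_sub_right y)
    (fun y => (e y).le) ((integrable_heat hσ).mul_const _) (fun x => ?_)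
  · rwa [integral_mul_const, integral_heat hσ, one_mul] at key
  · have hi : Integrable (fun y => heat σ y * ‖h (x - y)‖) := by
      refine ((integrable_heat hσ).mul_const M).mono'
        ((continuous_heat σ).mul (by fun_prop)).aestronglyMeasurable (ae_of_all _ fun y => ?_)
      rw [Real.norm_of_nonneg (mul_nonneg (heat_pos hσ y).le (norm_nonneg _))]
      exact mul_le_mul_of_nonneg_left (hM _) (heat_pos hσ y).le
    rw [← integral_const_mul]
    refine norm_integral_le_of_norm_le (hi.const_mul c) (ae_of_all _ fun y => ?_)
    rw [norm_smul, ← mul_assoc]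
    exact mul_le_mul_of_nonneg_right (hKb y) (norm_nonneg _)

lemma abs_heat_le {σ : ℝ} (hσ : 0 < σ) (y : Plane) : |heat σ y| ≤ 1 * heat σ y := by
  rw [one_mul, abs_of_pos (heat_pos hσ y)]

lemma memLp_sub_conv_heat {h : Plane → Plane} {a M : ℝ} (ha : 0 < a) (hh : ContDiff ℝ 1 h)
    (hM : ∀ x, ‖h x‖ ≤ M) (hh' : ∀ i, MemLp (pderiv i h) 2) :
    MemLp (fun x => h x - conv (heat a) h x) 2 ∧
      l2Sq (fun x => h x - conv (heat a) h x) ≤ 16 * a * gradL2Sq h := by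
  have hc := hh.continuous
  have h2a : 0 < 2 * a := by positivity
  have ht : ∀ y, MemLp (fun x => h (x - y) - h x) 2 ∧
      l2Sq (fun x => h (x - y) - h x) ≤ ‖y‖ ^ 2 * gradL2Sq h := fun y => by
    have := translate_sub_memLp hh hh' (-y)
    simpa only [← sub_eq_add_neg, norm_neg, gradL2Sq] using this
  have hsi : Integrable (fun y => ‖y‖ ^ 2 * heat a y) := by
    refine ((integrable_heat h2a).const_mul (16 * a)).mono'
      ((continuous_norm.pow 2).mul (continuous_heat a)).aestronglyMeasurable
      (ae_of_all _ fun y => ?_)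
    rw [Real.norm_of_nonneg (mul_nonneg (sq_nonneg _) (heat_pos ha y).le)]
    exact sq_mul_heat_le ha y
  have hsl : ∫ y, ‖y‖ ^ 2 * heat a y ≤ 16 * a := by
    have := integral_mono hsi ((integrable_heat h2a).const_mul (16 * a)) (sq_mul_heat_le ha)
    rwa [integral_const_mul, integral_heat h2a, mul_one] at this
  have eB : ∀ y, heat a y * (‖y‖ ^ 2 * gradL2Sq h) = (‖y‖ ^ 2 * heat a y) * gradL2Sq h :=
    fun y => by ring
  have hconv := continuous_conv ha (continuous_heat a) (abs_heat_le ha) hc hM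
  have hMg : ∀ x y, ‖h (x - y) - h x‖ ≤ 2 * M := fun x y =>
    (norm_sub_le _ _).trans (by linarith [hM x, hM (x - y)])
  have key := memLp_of_norm_le_integral_heat (c := 1) (F := fun x => h x - conv (heat a) h x)
    (g := fun x y => ‖h (x - y) - h x‖)
    (B := fun y => ‖y‖ ^ 2 * gradL2Sq h) ha (hc.sub hconv)
    (by simp only [Function.uncurry_def]; fun_prop) (fun _ _ => norm_nonneg _)
    (fun x => ⟨2 * M, hMg x⟩)
    (fun y => integrable_sq (ht y).1)
    (fun y => (ht y).2) (by simp only [eB]; exact hsi.mul_const _) (fun x => ?_)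
  · refine ⟨key.1, key.2.trans ?_⟩
    simp only [eB]
    rw [integral_mul_const, one_pow, one_mul]
    exact mul_le_mul_of_nonneg_right hsl (gradL2Sq_nonneg h)
  · have hi : Integrable (fun y => heat a y * ‖h (x - y) - h x‖) := by
      refine ((integrable_heat ha).mul_const (2 * M)).mono'
        ((continuous_heat a).mul (by fun_prop)).aestronglyMeasurable (ae_of_all _ fun y => ?_)
      rw [Real.norm_of_nonneg (mul_nonneg (heat_pos ha y).le (norm_nonneg _))]
      exact mul_le_mul_of_nonneg_left (hMg x y) (heat_pos ha y).le
    have e1 : h x = ∫ y, heat a y • h x := by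
      rw [integral_smul_const, integral_heat ha, one_smul]
    have e2 : h x - conv (heat a) h x = ∫ y, (heat a y • h x - heat a y • h (x - y)) := by
      rw [integral_sub ((integrable_heat ha).smul_const _)
        (integrable_conv ha (continuous_heat a) (abs_heat_le ha) hc hM x), ← e1, conv]
    rw [one_mul, e2]
    refine norm_integral_le_of_norm_le hi (ae_of_all _ fun y => ?_)
    rw [← smul_sub, norm_smul, norm_sub_rev, Real.norm_of_nonneg (heat_pos ha y).le]

lemma hasDerivAt_conv_heat {h : Plane → Plane} {τ M : ℝ} (hτ : 0 < τ) (hh : Continuous h)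
    (hM : ∀ x, ‖h x‖ ≤ M) (x : Plane) :
    HasDerivAt (fun τ => conv (heat τ) h x) (conv (heatDeriv τ) h x) τ := by
  have hs : Ioo (τ / 2) (2 * τ) ∈ 𝓝 τ := Ioo_mem_nhds (by linarith) (by linarith)
  have hM0 : 0 ≤ M := (norm_nonneg _).trans (hM 0)
  have hm : ∀ σ, AEStronglyMeasurable (fun y => heat σ y • h (x - y)) volume := fun σ =>
    ((continuous_heat σ).smul (by fun_prop)).aestronglyMeasurable
  refine (hasDerivAt_integral_of_dominated_loc_of_deriv_le
    (bound := fun y => 6 / (τ / 2) * (4 * τ / τ * heat (4 * τ) y) * M)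
    (F := fun σ y => heat σ y • h (x - y)) (F' := fun σ y => heatDeriv σ y • h (x - y)) hs
    (Eventually.of_forall hm)
    (integrable_conv hτ (continuous_heat τ) (abs_heat_le hτ) hh hM x)
    ((continuous_heatDeriv τ).smul (by fun_prop)).aestronglyMeasurable
    (ae_of_all _ fun y σ hσ => ?_)
    ((((integrable_heat (by positivity)).const_mul _).const_mul _).mul_const _)
    (ae_of_all _ fun y σ hσ => ?_)).2
  · have hσ0 : 0 < σ := by linarith [hσ.1]
    rw [norm_smul]
    refine mul_le_mul ((abs_heatDeriv_le hσ0 y).trans ?_) (hM _) (norm_nonneg _) (by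
      have := heat_pos (by positivity : 0 < 4 * τ) y
      positivity)
    refine mul_le_mul ?_ ?_ (heat_pos (by positivity) y).le (by positivity)
    · exact div_le_div_of_nonneg_left (by norm_num) (by positivity) hσ.1.le
    · refine (heat_le_mul_heat (τ := 4 * τ) (by positivity : 0 < 2 * σ) (by linarith [hσ.2]) y).trans ?_
      refine mul_le_mul_of_nonneg_right ?_ (heat_pos (by positivity) y).le
      exact div_le_div_of_nonneg_left (by positivity) hτ (by linarith [hσ.1])
  · have hσ0 : 0 < σ := by linarith [hσ.1]
    exact (hasDerivAt_heat hσ0 y).smul_const _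

lemma continuousOn_conv_heat {h : Plane → Plane} {a t M : ℝ} (ha : 0 < a) (ht : 0 ≤ t) (hh : Continuous h)
    (hM : ∀ x, ‖h x‖ ≤ M) :
    ContinuousOn (fun q : ℝ × Plane => conv (heat (t - q.1 + a)) h q.2) (Icc 0 t ×ˢ univ) := by
  unfold conv
  refine continuousOn_of_dominated (bound := fun y => ((t + a) / a * heat (t + a) y) * M)
    (fun q _ => ((continuous_heat _).smul (by fun_prop)).aestronglyMeasurable)
    (fun q hq => ae_of_all _ fun y => ?_) ?_ (ae_of_all _ fun y => ?_)
  · have h0 : 0 < t - q.1 + a := by linarith [hq.1.2]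
    have h1 : 0 < t + a := by linarith [hq.1.2, hq.1.1]
    rw [norm_smul, Real.norm_of_nonneg (heat_pos h0 y).le]
    refine mul_le_mul ?_ (hM _) (norm_nonneg _)
      (mul_nonneg (by positivity) (heat_pos h1 y).le)
    refine (heat_le_mul_heat (τ := t + a) h0 (by linarith [hq.1.1]) y).trans ?_
    refine mul_le_mul_of_nonneg_right ?_ (heat_pos h1 y).le
    exact div_le_div_of_nonneg_left h1.le ha (by linarith [hq.1.2])
  · exact ((integrable_heat (by linarith : 0 < t + a)).const_mul _).mul_const _
  · intro q hq
    have h0 : 0 < t - q.1 + a := by linarith [hq.1.2]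
    have h1 : ContinuousAt (fun τ => heat τ y) (t - q.1 + a) := (hasDerivAt_heat h0 y).continuousAt
    have h2 : ContinuousAt (fun q : ℝ × Plane => heat (t - q.1 + a) y) q :=
      ContinuousAt.comp (f := fun q : ℝ × Plane => t - q.1 + a) h1 (by fun_prop)
    exact (h2.smul (by fun_prop)).continuousWithinAt

/-! ### Testing the momentum equation against backward heat flows -/

/-- A solenoidal solution of the backward heat equation on `[0, t]`, square-integrable with its
derivatives. -/
structure IsBackwardHeatFlow (Φ : ℝ → Plane → Plane) (t N : ℝ) : Prop where
  differentiable : ∀ s ∈ Icc 0 t, Differentiable ℝ (Φ s)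
  differentiable_pderiv : ∀ s ∈ Icc 0 t, ∀ i, Differentiable ℝ (pderiv i (Φ s))
  memLp : ∀ s ∈ Icc 0 t, MemLp (Φ s) 2
  memLp_pderiv : ∀ s ∈ Icc 0 t, ∀ i, MemLp (pderiv i (Φ s)) 2
  memLp_pderiv_pderiv : ∀ s ∈ Icc 0 t, ∀ i, MemLp (pderiv i (pderiv i (Φ s))) 2
  divergence_eq_zero : ∀ s ∈ Icc 0 t, ∀ x, divergence (Φ s) x = 0
  continuousOn : ContinuousOn (fun q : ℝ × Plane => Φ q.1 q.2) (Icc 0 t ×ˢ univ)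
  continuousOn_lap : ContinuousOn (fun q : ℝ × Plane => lap (Φ q.1) q.2) (Icc 0 t ×ˢ univ)
  hasDerivAt : ∀ s ∈ Ioo 0 t, ∀ x, HasDerivAt (fun s => Φ s x) (-lap (Φ s) x) s
  l2Sq_le : ∀ s ∈ Icc 0 t, l2Sq (Φ s) ≤ N
  l2Sq_lap_le : ∀ s ∈ Icc 0 t, l2Sq (lap (Φ s)) ≤ N

namespace IsBackwardHeatFlow

variable {Φ : ℝ → Plane → Plane} {s t N : ℝ}

lemma memLp_lap (h : IsBackwardHeatFlow Φ t N) (hs : s ∈ Icc 0 t) : MemLp (lap (Φ s)) 2 := by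
  have : lap (Φ s) = ∑ i, pderiv i (pderiv i (Φ s)) := by
    funext x
    simp [lap]
  rw [this]
  exact memLp_finsetSum' _ fun i _ => h.memLp_pderiv_pderiv s hs i

lemma integral_inner_lap_comm (h : IsBackwardHeatFlow Φ t N) (hs : s ∈ Icc 0 t)
    {v : Plane → Plane} (hv : Differentiable ℝ v) (hv1 : ∀ i, Differentiable ℝ (pderiv i v))
    (hv2 : MemLp v 2) (hv' : ∀ i, MemLp (pderiv i v) 2)
    (hv'' : ∀ i, MemLp (pderiv i (pderiv i v)) 2) :
    ∫ x, inner ℝ (lap v x) (Φ s x) = ∫ x, inner ℝ (v x) (lap (Φ s) x) := by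
  rw [integral_inner_lap hv (h.differentiable_pderiv s hs) hv2 hv' (h.memLp_pderiv s hs)
    (h.memLp_pderiv_pderiv s hs)]
  have e : ∀ x, inner ℝ (lap v x) (Φ s x) = inner ℝ (Φ s x) (lap v x) := fun x =>
    real_inner_comm _ _
  simp only [e]
  rw [integral_inner_lap (h.differentiable s hs) hv1 (h.memLp s hs) (h.memLp_pderiv s hs) hv' hv'']
  congr 1
  refine integral_congr_ae (ae_of_all _ fun x => Finset.sum_congr rfl fun i _ =>
    real_inner_comm _ _)

end IsBackwardHeatFlow

lemma norm_fderiv_apply_le_sum {V : Type*} [NormedAddCommGroup V] [NormedSpace ℝ V]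
    (f : Plane → V) (x v : Plane) :
    ‖fderiv ℝ f x v‖ ≤ ‖v‖ * ∑ i, ‖pderiv i f x‖ := by
  rw [fderiv_apply_eq_sum, Finset.mul_sum]
  refine (norm_sum_le _ _).trans (Finset.sum_le_sum fun i _ => ?_)
  rw [norm_smul]
  exact mul_le_mul_of_nonneg_right (PiLp.norm_apply_le v i) (norm_nonneg _)

namespace IsSmoothSolution

variable {ρ : ℝ → Plane → ℝ} {u : ℝ → Plane → Plane} {P : ℝ → Plane → ℝ}
  {Φ : ℝ → Plane → Plane} {r t N : ℝ}

lemma integrable_density_inner (h : IsSmoothSolution ρ u P) (ht : 0 ≤ t) {v : Plane → Plane}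
    (hv : MemLp v 2) : Integrable (fun x => ρ t x * inner ℝ (u t x) (v x)) := by
  obtain ⟨M, hM0, hM⟩ := h.exists_bounds t
  exact (integrable_inner (h.smooth_velocity.memLp ht) hv).bdd_mul
    (h.contDiff_density ht).continuous.aestronglyMeasurable
    (ae_of_all _ fun x => (hM t ⟨ht, le_rfl⟩ x).2.1)

lemma integrable_convection_test (h : IsSmoothSolution ρ u P) (hΦ : IsBackwardHeatFlow Φ t N)
    (hr : r ∈ Icc 0 t) :
    Integrable (fun x => ρ r x * inner ℝ (u r x) (fderiv ℝ (Φ r) x (u r x))) := by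
  obtain ⟨M, hM0, hM⟩ := h.exists_bounds t
  have hu := h.smooth_velocity
  have e : ∀ x, ρ r x * inner ℝ (u r x) (fderiv ℝ (Φ r) x (u r x)) =
      ∑ i, (ρ r x * u r x i) * inner ℝ (u r x) (pderiv i (Φ r) x) := fun x => by
    rw [fderiv_apply_eq_sum, inner_sum, Finset.mul_sum]
    refine Finset.sum_congr rfl fun i _ => ?_
    rw [inner_smul_right]
    ring
  simp only [e]
  refine integrable_finsetSum _ fun i _ => ?_
  refine (integrable_inner (hu.memLp hr.1) (hΦ.memLp_pderiv r hr i)).bdd_mul (c := M * M)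
    ((h.contDiff_density hr.1).continuous.mul
      ((EuclideanSpace.proj (𝕜 := ℝ) i).continuous.comp
        (hu.continuous hr.1))).aestronglyMeasurable (ae_of_all _ fun x => ?_)
  obtain ⟨-, b1, b2, -, -⟩ := hM r hr x
  rw [norm_mul]
  exact mul_le_mul b1 ((PiLp.norm_apply_le (u r x) i).trans b2) (norm_nonneg _) hM0

lemma integral_transport_test (h : IsSmoothSolution ρ u P) (hΦ : IsBackwardHeatFlow Φ t N)
    (hr : r ∈ Icc 0 t) :
    Integrable (fun x => fderiv ℝ (ρ r) x (u r x) * inner ℝ (u r x) (Φ r x) +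
        ρ r x * inner ℝ (fderiv ℝ (u r) x (u r x)) (Φ r x)) ∧
    ∫ x, (fderiv ℝ (ρ r) x (u r x) * inner ℝ (u r x) (Φ r x) +
        ρ r x * inner ℝ (fderiv ℝ (u r) x (u r x)) (Φ r x)) =
      -∫ x, ρ r x * inner ℝ (u r x) (fderiv ℝ (Φ r) x (u r x)) := by
  obtain ⟨M, hM0, hM⟩ := h.exists_bounds t
  have hu := h.smooth_velocity
  have hr0 := hr.1
  have hMr := hM r hr
  have cu := hu.continuous hr0
  have cρ := (h.contDiff_density hr0).continuous
  have cΦ := (hΦ.differentiable r hr).continuous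
  have hd : ∀ x, HasFDerivAt (fun x => ρ r x * inner ℝ (u r x) (Φ r x)) _ x := fun x =>
    (h.differentiable_density hr0 x).hasFDerivAt.mul
      ((hu.differentiable hr0 x).hasFDerivAt.inner ℝ (hΦ.differentiable r hr x).hasFDerivAt)
  have hfd : ∀ x v, fderiv ℝ (fun x => ρ r x * inner ℝ (u r x) (Φ r x)) x v =
      (fderiv ℝ (ρ r) x v * inner ℝ (u r x) (Φ r x) +
        ρ r x * inner ℝ (fderiv ℝ (u r) x v) (Φ r x)) +
        ρ r x * inner ℝ (u r x) (fderiv ℝ (Φ r) x v) := fun x v => by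
    rw [(hd x).fderiv]
    simp
    ring
  have i0 : Integrable (fun x => fderiv ℝ (ρ r) x (u r x) * inner ℝ (u r x) (Φ r x) +
        ρ r x * inner ℝ (fderiv ℝ (u r) x (u r x)) (Φ r x)) := by
    have c1 : Continuous (fun x => fderiv ℝ (ρ r) x (u r x)) :=
      ((h.contDiff_density hr0).continuous_fderiv (by norm_num)).clm_apply cu
    have c2 : Continuous (fun x => fderiv ℝ (u r) x (u r x)) :=
      ((hu.contDiff_two hr0).continuous_fderiv (by norm_num)).clm_apply cu
    refine ((integrable_norm_mul (hu.memLp hr0) (hΦ.memLp r hr)).const_mul (4 * M ^ 2)).mono'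
      ((c1.mul (cu.inner cΦ)).add (cρ.mul (c2.inner cΦ))).aestronglyMeasurable
      (ae_of_all _ fun x => ?_)
    obtain ⟨-, b1, b2, b3, b4⟩ := hMr x
    have d1 := norm_fderiv_apply_le b4 (u r x)
    have d2 := norm_fderiv_apply_le b3 (u r x)
    have d3 := norm_inner_le_norm (𝕜 := ℝ) (u r x) (Φ r x)
    have d4 := norm_inner_le_norm (𝕜 := ℝ) (fderiv ℝ (u r) x (u r x)) (Φ r x)
    have n0 := norm_nonneg (u r x)
    have n1 := norm_nonneg (Φ r x)
    refine (norm_add_le _ _).trans ?_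
    rw [norm_mul, norm_mul]
    have e1 : ‖fderiv ℝ (ρ r) x (u r x)‖ * ‖inner ℝ (u r x) (Φ r x)‖ ≤
        (2 * M * M) * (‖u r x‖ * ‖Φ r x‖) :=
      mul_le_mul (d1.trans (mul_le_mul_of_nonneg_left b2 (by positivity))) d3 (norm_nonneg _)
        (by positivity)
    have e2 : ‖ρ r x‖ * ‖inner ℝ (fderiv ℝ (u r) x (u r x)) (Φ r x)‖ ≤
        M * ((2 * M * ‖u r x‖) * ‖Φ r x‖) :=
      mul_le_mul b1 (d4.trans (mul_le_mul_of_nonneg_right d2 n1)) (norm_nonneg _) hM0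
    nlinarith
  refine ⟨i0, ?_⟩
  have key := integral_fderiv_apply_eq_zero (v := u r)
    (w := fun x => ρ r x * inner ℝ (u r x) (Φ r x)) (M := M)
    ((hu.contDiff_two hr0).of_le (by norm_num)) (fun x => (hMr x).2.2.1)
    (fun i x => (hMr x).2.2.2.1 i) (h.incompressible r hr0)
    (fun x => (hd x).differentiableAt) (h.integrable_density_inner hr0 (hΦ.memLp r hr))
    (fun i => ?_)
  · simp only [hfd] at key
    rw [integral_add i0 (h.integrable_convection_test hΦ hr)] at key
    linarith
  · have e : ∀ x, pderiv i (fun x => ρ r x * inner ℝ (u r x) (Φ r x)) x = _ := fun x => hfd x _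
    simp only [e]
    have c2 := (hu.pderiv i).continuous hr0
    have c4 := (h.smooth_pderiv_density i).continuous hr0
    have ci := (EuclideanSpace.proj (𝕜 := ℝ) i).continuous.comp cu
    refine (((integrable_norm_mul (hu.memLp hr0) (hΦ.memLp r hr)).const_mul (2 * M ^ 2)).add
      ((integrable_norm_mul (hu.memLp hr0) (hΦ.memLp_pderiv r hr i)).const_mul (M ^ 2))).mono'
      (ci.aestronglyMeasurable.mul
        (((c4.mul (cu.inner cΦ)).add (cρ.mul (c2.inner cΦ))).aestronglyMeasurable.add
          (cρ.aestronglyMeasurable.mul (cu.aestronglyMeasurable.inner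
            (hΦ.memLp_pderiv r hr i).1)))) (ae_of_all _ fun x => ?_)
    obtain ⟨-, b1, b2, b3, b4⟩ := hMr x
    have n0 := norm_nonneg (u r x)
    have n1 := norm_nonneg (Φ r x)
    have n2 := norm_nonneg (pderiv i (Φ r) x)
    have d0 : ‖u r x i‖ ≤ ‖u r x‖ := PiLp.norm_apply_le (u r x) i
    have d1 := norm_inner_le_norm (𝕜 := ℝ) (u r x) (Φ r x)
    have d2 := norm_inner_le_norm (𝕜 := ℝ) (pderiv i (u r) x) (Φ r x)
    have d3 := norm_inner_le_norm (𝕜 := ℝ) (u r x) (pderiv i (Φ r) x)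
    have e1 : ‖pderiv i (ρ r) x * inner ℝ (u r x) (Φ r x)‖ ≤ M * (M * ‖Φ r x‖) := by
      rw [norm_mul]
      exact mul_le_mul (b4 i) (d1.trans (mul_le_mul_of_nonneg_right b2 n1)) (norm_nonneg _) hM0
    have e2 : ‖ρ r x * inner ℝ (pderiv i (u r) x) (Φ r x)‖ ≤ M * (M * ‖Φ r x‖) := by
      rw [norm_mul]
      exact mul_le_mul b1 (d2.trans (mul_le_mul_of_nonneg_right (b3 i) n1)) (norm_nonneg _) hM0
    have e3 : ‖ρ r x * inner ℝ (u r x) (pderiv i (Φ r) x)‖ ≤ M * (M * ‖pderiv i (Φ r) x‖) := by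
      rw [norm_mul]
      exact mul_le_mul b1 (d3.trans (mul_le_mul_of_nonneg_right b2 n2)) (norm_nonneg _) hM0
    rw [norm_mul]
    calc _ ≤ ‖u r x‖ * (M * (M * ‖Φ r x‖) + M * (M * ‖Φ r x‖) + M * (M * ‖pderiv i (Φ r) x‖)) := by
          refine mul_le_mul d0 ?_ (norm_nonneg _) n0
          exact (norm_add_le _ _).trans (add_le_add ((norm_add_le _ _).trans (add_le_add e1 e2)) e3)
      _ = _ := by simp only [Pi.add_apply]; ring

/-- The weak form of the momentum equation against a backward heat flow. -/
lemma integral_momentum_test (h : IsSmoothSolution ρ u P) (ht : 0 ≤ t)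
    (hΦ : IsBackwardHeatFlow Φ t N) :
    (∫ x, ρ t x * inner ℝ (u t x) (Φ t x)) - ∫ x, ρ 0 x * inner ℝ (u 0 x) (Φ 0 x) =
      ∫ r in 0..t, ((∫ x, ρ r x * inner ℝ (u r x) (fderiv ℝ (Φ r) x (u r x))) -
        ∫ x, (ρ r x - 1) * inner ℝ (u r x) (lap (Φ r) x)) := by
  obtain ⟨M, hM0, hM⟩ := h.exists_bounds t
  have hu := h.smooth_velocity
  have hmom : ∀ r, 0 ≤ r → ∀ x, ρ r x * inner ℝ (timeDeriv u r x) (Φ r x) =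
      inner ℝ (lap (u r) x) (Φ r x) - inner ℝ (Φ r x) (gradient (P r) x) -
        ρ r x * inner ℝ (fderiv ℝ (u r) x (u r x)) (Φ r x) := fun r hr x => by
    have := congrArg (fun z => inner ℝ z (Φ r x)) (h.momentum' hr x)
    simp only [inner_sub_left, real_inner_smul_left] at this
    rw [this, real_inner_comm (Φ r x) (gradient (P r) x)]
  let A : ℝ → Plane → ℝ := fun r x => fderiv ℝ (ρ r) x (u r x) * inner ℝ (u r x) (Φ r x) +
        ρ r x * inner ℝ (fderiv ℝ (u r) x (u r x)) (Φ r x)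
  let g' : ℝ → Plane → ℝ := fun r x => inner ℝ (lap (u r) x) (Φ r x) -
    inner ℝ (Φ r x) (gradient (P r) x) - A r x - ρ r x * inner ℝ (u r x) (lap (Φ r) x)
  have hsub : Icc (0 : ℝ) t ×ˢ (univ : Set Plane) ⊆ Ici 0 ×ˢ univ :=
    prod_mono (fun r hr => hr.1) subset_rfl
  have cu := hu.continuousOn.mono hsub
  have cl := hu.lap.continuousOn.mono hsub
  have cP := h.smooth_pressure.continuousOn.mono hsub
  have cρ := h.continuousOn_density.mono hsub
  have c1 := h.continuousOn_fderiv_density.mono hsub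
  have c2 := h.continuousOn_fderiv_velocity.mono hsub
  have cΦ := hΦ.continuousOn
  have cg : ContinuousOn (fun q : ℝ × Plane => g' q.1 q.2) (Icc 0 t ×ˢ univ) :=
    (((cl.inner cΦ).sub (cΦ.inner cP)).sub ((c1.mul (cu.inner cΦ)).add
      (cρ.mul (c2.inner cΦ)))).sub (cρ.mul (cu.inner hΦ.continuousOn_lap))
  have h0m : (0 : ℝ) ∈ Icc 0 t := ⟨le_rfl, ht⟩
  have htm : t ∈ Icc 0 t := ⟨ht, le_rfl⟩
  have key := integral_sub_eq_integral_integral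
    (g := fun r x => ρ r x * inner ℝ (u r x) (Φ r x)) (g' := g') ht
    (fun x => by
      have : ContinuousOn (fun q : ℝ × Plane => ρ q.1 q.2 * inner ℝ (u q.1 q.2) (Φ q.1 q.2))
        (Icc 0 t ×ˢ univ) := cρ.mul (cu.inner cΦ)
      exact this.comp (f := fun r : ℝ => (r, x)) (by fun_prop) (fun r hr => ⟨hr, trivial⟩))
    (fun x r hr => by
      have hr0 : 0 < r := hr.1
      have h1 := (h.hasDerivAt_density hr0 x).mul
        ((hu.hasDerivAt hr0 x).inner ℝ (hΦ.hasDerivAt r hr x))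
      refine h1.congr_deriv ?_
      have := hmom r hr0.le x
      simp only [g', A, inner_neg_right]
      linear_combination this)
    ?_ (h.integrable_density_inner le_rfl (hΦ.memLp 0 h0m))
    (h.integrable_density_inner ht (hΦ.memLp t htm))
  · rw [key]
    refine intervalIntegral.integral_congr_ae (ae_of_all _ fun r hr => ?_)
    rw [uIoc_of_le ht] at hr
    have hr' : r ∈ Icc 0 t := Ioc_subset_Icc_self hr
    have hr0 := hr'.1
    have i1 := integrable_inner (hu.lap.memLp hr0) (hΦ.memLp r hr')
    have i2 := integrable_inner (hΦ.memLp r hr') (h.smooth_pressure.memLp hr0)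
    obtain ⟨i3, e3⟩ := h.integral_transport_test hΦ hr'
    have i4 := h.integrable_density_inner hr0 (hΦ.memLp_lap hr')
    have i12 : Integrable (fun x => inner ℝ (lap (u r) x) (Φ r x) -
      inner ℝ (Φ r x) (gradient (P r) x)) := i1.sub i2
    have i123 : Integrable (fun x => inner ℝ (lap (u r) x) (Φ r x) -
      inner ℝ (Φ r x) (gradient (P r) x) - A r x) := i12.sub i3
    have hpr := h.integral_inner_gradient_pressure hr0 (hΦ.differentiable r hr') (hΦ.memLp r hr')
      (hΦ.memLp_pderiv r hr') (hΦ.divergence_eq_zero r hr')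
    have hl := hΦ.integral_inner_lap_comm hr' (hu.differentiable hr0)
      (fun i => (hu.pderiv i).differentiable hr0) (hu.memLp hr0)
      (fun i => (hu.pderiv i).memLp hr0) (fun i => ((hu.pderiv i).pderiv i).memLp hr0)
    have e4 : ∫ x, (ρ r x - 1) * inner ℝ (u r x) (lap (Φ r) x) =
        (∫ x, ρ r x * inner ℝ (u r x) (lap (Φ r) x)) - ∫ x, inner ℝ (u r x) (lap (Φ r) x) := by
      rw [← integral_sub i4 (integrable_inner (hu.memLp hr0) (hΦ.memLp_lap hr'))]
      exact integral_congr_ae (ae_of_all _ fun x => by ring)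
    simp only [g']
    rw [integral_sub i123 i4, integral_sub i12 i3, integral_sub i1 i2, hpr, hl, e3, e4]
    ring
  · have iΦ : Integrable (fun q : ℝ × Plane => ‖Φ q.1 q.2‖ ^ 2)
        ((volume.restrict (Ioc 0 t)).prod volume) :=
      integrable_prod_sq (cΦ.mono (prod_mono Ioc_subset_Icc_self subset_rfl))
        (fun r hr => hΦ.memLp r (Ioc_subset_Icc_self hr))
        (fun r hr => hΦ.l2Sq_le r (Ioc_subset_Icc_self hr))
    have ilΦ : Integrable (fun q : ℝ × Plane => ‖lap (Φ q.1) q.2‖ ^ 2)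
        ((volume.restrict (Ioc 0 t)).prod volume) :=
      integrable_prod_sq (hΦ.continuousOn_lap.mono (prod_mono Ioc_subset_Icc_self subset_rfl))
        (fun r hr => hΦ.memLp_lap (Ioc_subset_Icc_self hr))
        (fun r hr => hΦ.l2Sq_lap_le r (Ioc_subset_Icc_self hr))
    have hdom := (((((hu.integrable_prod (t := t) le_rfl).const_mul (2 * M ^ 2 + M)).add
      (iΦ.const_mul (2 + 2 * M ^ 2))).add (ilΦ.const_mul M)).add
        (hu.lap.integrable_prod (t := t) le_rfl)).add
          (h.smooth_pressure.integrable_prod (t := t) le_rfl)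
    refine hdom.mono' (aestronglyMeasurable_prod_of_continuousOn
      (cg.mono (prod_mono Ioc_subset_Icc_self subset_rfl))) ?_
    have : ∀ᵐ q : ℝ × Plane ∂((volume.restrict (Ioc 0 t)).prod volume), q.1 ∈ Ioc 0 t :=
      Measure.quasiMeasurePreserving_fst.ae (ae_restrict_mem measurableSet_Ioc)
    filter_upwards [this] with q hq
    obtain ⟨r, x⟩ := q
    obtain ⟨-, b1, b2, b3, b4⟩ := hM r (Ioc_subset_Icc_self hq) x
    simp only [Pi.add_apply]
    have d1 := norm_inner_le_norm (𝕜 := ℝ) (lap (u r) x) (Φ r x)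
    have d2 := norm_inner_le_norm (𝕜 := ℝ) (Φ r x) (gradient (P r) x)
    have d3 := norm_inner_le_norm (𝕜 := ℝ) (u r x) (lap (Φ r) x)
    have d4 := norm_inner_le_norm (𝕜 := ℝ) (u r x) (Φ r x)
    have d5 := norm_inner_le_norm (𝕜 := ℝ) (fderiv ℝ (u r) x (u r x)) (Φ r x)
    have d6 := norm_fderiv_apply_le b4 (u r x)
    have d7 := norm_fderiv_apply_le b3 (u r x)
    have n1 := norm_nonneg (Φ r x)
    have f1 : ‖fderiv ℝ (ρ r) x (u r x) * inner ℝ (u r x) (Φ r x)‖ ≤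
        (2 * M * M) * (‖u r x‖ * ‖Φ r x‖) := by
      rw [norm_mul]
      exact mul_le_mul (d6.trans (mul_le_mul_of_nonneg_left b2 (by positivity))) d4 (norm_nonneg _)
        (by positivity)
    have f2 : ‖ρ r x * inner ℝ (fderiv ℝ (u r) x (u r x)) (Φ r x)‖ ≤
        M * ((2 * M * ‖u r x‖) * ‖Φ r x‖) := by
      rw [norm_mul]
      exact mul_le_mul b1 (d5.trans (mul_le_mul_of_nonneg_right d7 n1)) (norm_nonneg _) hM0
    have f3 : ‖ρ r x * inner ℝ (u r x) (lap (Φ r) x)‖ ≤ M * (‖u r x‖ * ‖lap (Φ r) x‖) := by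
      rw [norm_mul]
      exact mul_le_mul b1 d3 (norm_nonneg _) hM0
    have f0 : ‖g' r x‖ ≤ ‖lap (u r) x‖ * ‖Φ r x‖ + ‖Φ r x‖ * ‖gradient (P r) x‖ +
        ((2 * M * M) * (‖u r x‖ * ‖Φ r x‖) + M * ((2 * M * ‖u r x‖) * ‖Φ r x‖)) +
        M * (‖u r x‖ * ‖lap (Φ r) x‖) := by
      simp only [g', A]
      refine (norm_sub_le _ _).trans (add_le_add ((norm_sub_le _ _).trans (add_le_add
        ((norm_sub_le _ _).trans (add_le_add d1 d2)) ((norm_add_le _ _).trans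
          (add_le_add f1 f2)))) f3)
    refine f0.trans ?_
    have g1 := two_mul_le_add_sq ‖lap (u r) x‖ ‖Φ r x‖
    have g2 := two_mul_le_add_sq ‖Φ r x‖ ‖gradient (P r) x‖
    have g3 := mul_le_mul_of_nonneg_left (two_mul_le_add_sq ‖u r x‖ ‖Φ r x‖)
      (by positivity : 0 ≤ 2 * M ^ 2)
    have g4 := mul_le_mul_of_nonneg_left (two_mul_le_add_sq ‖u r x‖ ‖lap (Φ r) x‖) hM0
    have g5 := mul_nonneg hM0 (sq_nonneg ‖u r x‖)
    have g6 := mul_nonneg hM0 (sq_nonneg ‖lap (Φ r) x‖)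
    have g7 := sq_nonneg ‖lap (u r) x‖
    have g8 := sq_nonneg ‖gradient (P r) x‖
    have g9 := sq_nonneg ‖Φ r x‖
    linarith

end IsSmoothSolution

/-! ### The heat flow of a smooth solenoidal field -/

/-- A solenoidal field that is bounded and square-integrable together with its derivatives of order
at most two. -/
structure IsTestField (h : Plane → Plane) (M : ℝ) : Prop where
  contDiff : ContDiff ℝ 2 h
  norm_le : ∀ x, ‖h x‖ ≤ M
  norm_pderiv_le : ∀ i x, ‖pderiv i h x‖ ≤ M
  norm_pderiv_pderiv_le : ∀ i j x, ‖pderiv i (pderiv j h) x‖ ≤ M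
  memLp : MemLp h 2
  memLp_pderiv : ∀ i, MemLp (pderiv i h) 2
  memLp_pderiv_pderiv : ∀ i j, MemLp (pderiv i (pderiv j h)) 2
  divergence_eq_zero : ∀ x, divergence h x = 0

namespace IsTestField

variable {h : Plane → Plane} {M τ a t : ℝ}

lemma contDiff_one (hh : IsTestField h M) : ContDiff ℝ 1 h := hh.contDiff.of_le (by norm_num)

lemma contDiff_pderiv (hh : IsTestField h M) (i : Fin 2) : ContDiff ℝ 1 (pderiv i h) :=
  INS2D.contDiff_pderiv (n := 1) hh.contDiff (by norm_num) i

lemma continuous_pderiv_pderiv (hh : IsTestField h M) (i j : Fin 2) :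
    Continuous (pderiv i (pderiv j h)) :=
  (INS2D.contDiff_pderiv (n := 0) (hh.contDiff_pderiv j) (by norm_num) i).continuous

lemma continuous_lap (hh : IsTestField h M) : Continuous (lap h) :=
  continuous_finsetSum _ fun i _ => hh.continuous_pderiv_pderiv i i

lemma norm_lap_le (hh : IsTestField h M) (x : Plane) : ‖lap h x‖ ≤ 2 * M := by
  have := norm_sum_le_of_le Finset.univ (fun i (_ : i ∈ Finset.univ) =>
    hh.norm_pderiv_pderiv_le i i x)
  simpa [lap] using this

lemma memLp_lap (hh : IsTestField h M) : MemLp (lap h) 2 := by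
  have : lap h = ∑ i, INS2D.pderiv i (INS2D.pderiv i h) := by
    funext x
    simp [lap]
  rw [this]
  exact memLp_finsetSum' _ fun i _ => hh.memLp_pderiv_pderiv i i

lemma pderiv_conv_heat (hh : IsTestField h M) (hτ : 0 < τ) (i : Fin 2) :
    pderiv i (conv (heat τ) h) = conv (heat τ) (pderiv i h) :=
  pderiv_conv hτ (continuous_heat τ) (abs_heat_le hτ) hh.contDiff_one hh.norm_le hh.norm_pderiv_le i

lemma pderiv_conv_heat' (hh : IsTestField h M) (hτ : 0 < τ) (i : Fin 2) :
    pderiv i (conv (heat τ) h) = conv (pderiv i (heat τ)) h := by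
  rw [hh.pderiv_conv_heat hτ]
  exact conv_pderiv hτ (by positivity : 0 < 2 * τ) (differentiable_heat hτ) i
    (differentiable_pderiv_heat hτ i).continuous (abs_heat_le hτ) (abs_pderiv_heat_le hτ i)
    hh.contDiff_one hh.norm_le (hh.norm_pderiv_le i)

lemma pderiv_pderiv_conv_heat (hh : IsTestField h M) (hτ : 0 < τ) (i : Fin 2) :
    pderiv i (pderiv i (conv (heat τ) h)) = conv (heat τ) (pderiv i (pderiv i h)) := by
  rw [hh.pderiv_conv_heat hτ]
  exact pderiv_conv hτ (continuous_heat τ) (abs_heat_le hτ) (hh.contDiff_pderiv i)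
    (hh.norm_pderiv_le i) (fun j => hh.norm_pderiv_pderiv_le j i) i

lemma pderiv_pderiv_conv_heat' (hh : IsTestField h M) (hτ : 0 < τ) (i : Fin 2) :
    pderiv i (pderiv i (conv (heat τ) h)) = conv (pderiv i (pderiv i (heat τ))) h := by
  have h2 : 0 < 2 * τ := by positivity
  rw [hh.pderiv_pderiv_conv_heat hτ,
    conv_pderiv hτ h2 (differentiable_heat hτ) i
      (differentiable_pderiv_heat hτ i).continuous (abs_heat_le hτ) (abs_pderiv_heat_le hτ i)
      (hh.contDiff_pderiv i) (hh.norm_pderiv_le i) (hh.norm_pderiv_pderiv_le i i),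
    conv_pderiv h2 h2 (differentiable_pderiv_heat hτ i) i
      (continuous_pderiv_pderiv_heat hτ i) (abs_pderiv_heat_le hτ i)
      (abs_pderiv_pderiv_heat_le hτ i)
      hh.contDiff_one hh.norm_le (hh.norm_pderiv_le i)]

lemma lap_conv_heat (hh : IsTestField h M) (hτ : 0 < τ) :
    lap (conv (heat τ) h) = conv (heat τ) (lap h) := by
  funext x
  simp only [lap, hh.pderiv_pderiv_conv_heat hτ]
  simp only [conv]
  rw [← integral_finsetSum _ fun i _ => integrable_conv hτ (continuous_heat τ) (abs_heat_le hτ)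
    (hh.continuous_pderiv_pderiv i i) (hh.norm_pderiv_pderiv_le i i) x]
  simp only [lap, Finset.smul_sum]

lemma lap_conv_heat' (hh : IsTestField h M) (hτ : 0 < τ) :
    lap (conv (heat τ) h) = conv (heatDeriv τ) h := by
  funext x
  have h2 : 0 < 2 * τ := by positivity
  simp only [lap, hh.pderiv_pderiv_conv_heat' hτ]
  simp only [conv]
  rw [← integral_finsetSum _ fun i _ => integrable_conv h2 (continuous_pderiv_pderiv_heat hτ i)
    (abs_pderiv_pderiv_heat_le hτ i) hh.contDiff.continuous hh.norm_le x]
  simp only [← Finset.sum_smul, sum_pderiv_pderiv_heat hτ]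

lemma sqrt_inv_two_mul_le (hτ : 0 < τ) : √((2 * τ)⁻¹) ≤ √(τ⁻¹) :=
  Real.sqrt_le_sqrt (inv_anti₀ hτ (by linarith))

lemma norm_conv_heat_le (hh : IsTestField h M) (hτ : 0 < τ) (x : Plane) :
    ‖conv (heat τ) h x‖ ≤ √(τ⁻¹) * √(l2Sq h) := by
  simpa using norm_conv_le_sup hτ zero_le_one (abs_heat_le hτ) hh.memLp x

lemma norm_pderiv_conv_heat_le (hh : IsTestField h M) (hτ : 0 < τ) (i : Fin 2) (x : Plane) :
    ‖pderiv i (conv (heat τ) h) x‖ ≤ 3 / τ * √(l2Sq h) := by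
  rw [hh.pderiv_conv_heat' hτ]
  refine (norm_conv_le_sup (by positivity : 0 < 2 * τ) (by positivity) (abs_pderiv_heat_le hτ i)
    hh.memLp x).trans ?_
  refine mul_le_mul_of_nonneg_right ?_ (Real.sqrt_nonneg _)
  calc 3 / √τ * √((2 * τ)⁻¹) ≤ 3 / √τ * √(τ⁻¹) :=
        mul_le_mul_of_nonneg_left (sqrt_inv_two_mul_le hτ) (by positivity)
    _ = 3 / (√τ * √τ) := by rw [Real.sqrt_inv, div_mul_eq_div_div]; rfl
    _ = 3 / τ := by rw [Real.mul_self_sqrt hτ.le]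

lemma norm_lap_conv_heat_le (hh : IsTestField h M) (hτ : 0 < τ) (x : Plane) :
    ‖lap (conv (heat τ) h) x‖ ≤ 6 / τ * √(τ⁻¹) * √(l2Sq h) := by
  rw [hh.lap_conv_heat' hτ]
  refine (norm_conv_le_sup (by positivity : 0 < 2 * τ) (by positivity) (abs_heatDeriv_le hτ)
    hh.memLp x).trans ?_
  refine mul_le_mul_of_nonneg_right ?_ (Real.sqrt_nonneg _)
  exact mul_le_mul_of_nonneg_left (sqrt_inv_two_mul_le hτ) (by positivity)

lemma l2Sq_pderiv_conv_heat_le (hh : IsTestField h M) (hτ : 0 < τ) (i : Fin 2) :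
    l2Sq (pderiv i (conv (heat τ) h)) ≤ 9 / τ * l2Sq h := by
  rw [hh.pderiv_conv_heat' hτ]
  refine (memLp_conv (by positivity : 0 < 2 * τ)
    (differentiable_pderiv_heat hτ i).continuous (abs_pderiv_heat_le hτ i) hh.contDiff.continuous
    hh.norm_le hh.memLp).2.trans_eq ?_
  rw [div_pow, Real.sq_sqrt hτ.le]
  norm_num

lemma isBackwardHeatFlow (hh : IsTestField h M) (ha : 0 < a) (ht : 0 ≤ t) :
    IsBackwardHeatFlow (fun s => conv (heat (t - s + a)) h) t (max (l2Sq h) (l2Sq (lap h))) := by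
  have hpos : ∀ s ∈ Icc 0 t, 0 < t - s + a := fun s hs => by linarith [hs.2]
  have hc := hh.contDiff.continuous
  refine ⟨fun s hs => ?_, fun s hs i => ?_, fun s hs => ?_, fun s hs i => ?_, fun s hs i => ?_,
    fun s hs => ?_, continuousOn_conv_heat ha ht hc hh.norm_le, ?_, fun s hs x => ?_,
    fun s hs => ?_, fun s hs => ?_⟩
  · exact differentiable_conv (hpos s hs) (continuous_heat _) (abs_heat_le (hpos s hs))
      hh.contDiff_one hh.norm_le hh.norm_pderiv_le
  · rw [hh.pderiv_conv_heat (hpos s hs)]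
    exact differentiable_conv (hpos s hs) (continuous_heat _) (abs_heat_le (hpos s hs))
      (hh.contDiff_pderiv i) (hh.norm_pderiv_le i) (fun j => hh.norm_pderiv_pderiv_le j i)
  · exact (memLp_conv (hpos s hs) (continuous_heat _) (abs_heat_le (hpos s hs)) hc hh.norm_le
      hh.memLp).1
  · rw [hh.pderiv_conv_heat (hpos s hs)]
    exact (memLp_conv (hpos s hs) (continuous_heat _) (abs_heat_le (hpos s hs))
      (hh.contDiff_pderiv i).continuous (hh.norm_pderiv_le i) (hh.memLp_pderiv i)).1
  · rw [hh.pderiv_pderiv_conv_heat (hpos s hs)]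
    exact (memLp_conv (hpos s hs) (continuous_heat _) (abs_heat_le (hpos s hs))
      (hh.continuous_pderiv_pderiv i i) (hh.norm_pderiv_pderiv_le i i)
      (hh.memLp_pderiv_pderiv i i)).1
  · exact divergence_conv (hpos s hs) (continuous_heat _) (abs_heat_le (hpos s hs))
      hh.contDiff_one hh.norm_le hh.norm_pderiv_le hh.divergence_eq_zero
  · refine (continuousOn_conv_heat ha ht hh.continuous_lap hh.norm_lap_le).congr fun q hq => ?_
    simp only [hh.lap_conv_heat (hpos q.1 hq.1)]
  · have hs' := hpos s (Ioo_subset_Icc_self hs)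
    rw [hh.lap_conv_heat' hs']
    have h1 := hasDerivAt_conv_heat hs' hc hh.norm_le x
    have h2 : HasDerivAt (fun s => t - s + a) (-1) s := by
      simpa using ((hasDerivAt_id s).const_sub t).add_const a
    have h3 := h1.scomp s h2
    rw [neg_one_smul] at h3
    exact h3
  · refine le_max_of_le_left ?_
    simpa using (memLp_conv (hpos s hs) (continuous_heat _) (abs_heat_le (hpos s hs)) hc hh.norm_le
      hh.memLp).2
  · refine le_max_of_le_right ?_
    rw [hh.lap_conv_heat (hpos s hs)]
    simpa using (memLp_conv (hpos s hs) (continuous_heat _) (abs_heat_le (hpos s hs))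
      hh.continuous_lap hh.norm_lap_le hh.memLp_lap).2

end IsTestField

/-! ### The duality estimate -/

lemma integrable_of_norm_mul {f : Plane → Plane} (hf : Continuous f)
    (hi : Integrable (fun x => ‖x‖ * ‖f x‖)) : Integrable f := by
  have h1 : IntegrableOn (fun x => ‖f x‖) (Metric.closedBall 0 1) :=
    hf.norm.continuousOn.integrableOn_compact (isCompact_closedBall _ _)
  have h2 := (integrable_indicator_iff Metric.isClosed_closedBall.measurableSet).2 h1
  refine (hi.add h2).mono' hf.aestronglyMeasurable (ae_of_all _ fun x => ?_)
  simp only [Pi.add_apply]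
  by_cases hx : x ∈ Metric.closedBall (0 : Plane) 1
  · rw [indicator_of_mem hx]
    have : 0 ≤ ‖x‖ * ‖f x‖ := by positivity
    linarith
  · rw [indicator_of_notMem hx, add_zero]
    have : 1 < ‖x‖ := by simpa using hx
    nlinarith [norm_nonneg (f x)]

namespace IsSmoothSolution

variable {ρ : ℝ → Plane → ℝ} {u : ℝ → Plane → Plane} {P : ℝ → Plane → ℝ} {r t a : ℝ}

lemma isTestField (h : IsSmoothSolution ρ u P) (ht : 0 ≤ t) : ∃ M, IsTestField (u t) M := by
  have hu := h.smooth_velocity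
  obtain ⟨M0, hM0, h0⟩ := hu.exists_norm_le t
  have h1 := fun i => (hu.pderiv i).exists_norm_le t
  choose M1 hM1 h1 using h1
  have h2 := fun i j => ((hu.pderiv j).pderiv i).exists_norm_le t
  choose M2 hM2 h2 using h2
  have htm : t ∈ Icc 0 t := ⟨ht, le_rfl⟩
  have s1 : 0 ≤ ∑ i, M1 i := Finset.sum_nonneg fun i _ => hM1 i
  have s2 : 0 ≤ ∑ i, ∑ j, M2 i j := Finset.sum_nonneg fun i _ => Finset.sum_nonneg fun j _ => hM2 i j
  refine ⟨M0 + ∑ i, M1 i + ∑ i, ∑ j, M2 i j, hu.contDiff_two ht, fun x => ?_, fun i x => ?_,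
    fun i j x => ?_, hu.memLp ht, fun i => (hu.pderiv i).memLp ht,
    fun i j => ((hu.pderiv j).pderiv i).memLp ht, h.incompressible t ht⟩
  · linarith [h0 t htm x]
  · have := Finset.single_le_sum (f := M1) (fun i _ => hM1 i) (Finset.mem_univ i)
    linarith [h1 i t htm x]
  · have e1 := Finset.single_le_sum (f := M2 i) (fun j _ => hM2 i j) (Finset.mem_univ j)
    have e2 := Finset.single_le_sum (f := fun i => ∑ j, M2 i j)
      (fun i _ => Finset.sum_nonneg fun j _ => hM2 i j) (Finset.mem_univ i)
    have e3 := h2 i j t htm x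
    linarith

lemma abs_density_le (h : IsSmoothSolution ρ u P) (h0 : ∀ x, 3 / 4 ≤ ρ 0 x ∧ ρ 0 x ≤ 5 / 4)
    (ht : 0 ≤ t) (x : Plane) : |ρ t x| ≤ 5 / 4 := by
  have := h.abs_density_sub_one_le h0 ht x
  rw [abs_le] at this ⊢
  constructor <;> linarith

/-- The density fluctuation paired with a bounded field. -/
lemma abs_integral_density_sub_one_inner_le (h : IsSmoothSolution ρ u P) (ht : 0 ≤ t)
    {v : Plane → Plane} {L : ℝ} (hL : ∀ x, ‖v x‖ ≤ L) :
    |∫ x, (ρ t x - 1) * inner ℝ (u t x) (v x)| ≤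
      L * (√(l2Sq (fun x => ρ 0 x - 1)) * √(l2Sq (u t))) := by
  have hL0 : 0 ≤ L := (norm_nonneg _).trans (hL 0)
  have h1 := h.smooth_density.memLp ht
  have h2 := h.smooth_velocity.memLp ht
  have key := integral_norm_mul_le h1 h2
  rw [h.l2Sq_density ht] at key
  rw [← Real.norm_eq_abs]
  calc ‖∫ x, (ρ t x - 1) * inner ℝ (u t x) (v x)‖
      ≤ ∫ x, L * (‖ρ t x - 1‖ * ‖u t x‖) := by
        refine norm_integral_le_of_norm_le ((integrable_norm_mul h1 h2).const_mul L)
          (ae_of_all _ fun x => ?_)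
        rw [norm_mul]
        calc _ ≤ ‖ρ t x - 1‖ * (‖u t x‖ * L) := by
              refine mul_le_mul_of_nonneg_left ?_ (norm_nonneg _)
              exact (norm_inner_le_norm _ _).trans
                (mul_le_mul_of_nonneg_left (hL x) (norm_nonneg _))
          _ = _ := by ring
    _ = L * ∫ x, ‖ρ t x - 1‖ * ‖u t x‖ := integral_const_mul _ _
    _ ≤ _ := mul_le_mul_of_nonneg_left key hL0

/-- The initial momentum, which has mean zero, paired with a Lipschitz field. -/
lemma abs_integral_initial_le (h : IsSmoothSolution ρ u P)
    (hU : Integrable (fun x => ‖x‖ * ‖u 0 x‖)) (hmean : ∫ x, ρ 0 x • u 0 x = 0)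
    (h0 : ∀ x, 3 / 4 ≤ ρ 0 x ∧ ρ 0 x ≤ 5 / 4) {v : Plane → Plane} (hv : Differentiable ℝ v)
    (hv2 : MemLp v 2) {L : ℝ} (hL : ∀ i x, ‖pderiv i v x‖ ≤ L) :
    |∫ x, ρ 0 x * inner ℝ (u 0 x) (v x)| ≤ 5 / 2 * L * U₀ (u 0) := by
  have hL0 : 0 ≤ L := (norm_nonneg _).trans (hL 0 0)
  have hu0 := integrable_of_norm_mul (h.smooth_velocity.continuous le_rfl) hU
  have hρu : Integrable (fun x => ρ 0 x • u 0 x) :=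
    hu0.bdd_smul (5 / 4) (h.contDiff_density le_rfl).continuous.aestronglyMeasurable
      (ae_of_all _ fun x => h.abs_density_le h0 le_rfl x)
  have hc : ∫ x, ρ 0 x * inner ℝ (u 0 x) (v 0) = 0 := by
    have := integral_inner (𝕜 := ℝ) hρu (v 0)
    rw [hmean, inner_zero_right] at this
    refine Eq.trans (integral_congr_ae (ae_of_all _ fun x => ?_)) this
    simp only [inner_smul_right]
    rw [real_inner_comm]
  have i1 := h.integrable_density_inner le_rfl hv2
  have i2 : Integrable (fun x => ρ 0 x * inner ℝ (u 0 x) (v 0)) := by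
    refine (hρu.inner_const (𝕜 := ℝ) (v 0)).congr (ae_of_all _ fun x => ?_)
    simp only [real_inner_smul_left]
  have e : ∫ x, ρ 0 x * inner ℝ (u 0 x) (v x) = ∫ x, ρ 0 x * inner ℝ (u 0 x) (v x - v 0) := by
    simp only [inner_sub_right, mul_sub]
    rw [integral_sub i1 i2, hc, sub_zero]
  have hlip : ∀ x, ‖v x - v 0‖ ≤ 2 * L * ‖x‖ := fun x => by
    have := convex_univ.norm_image_sub_le_of_norm_fderiv_le (𝕜 := ℝ) (f := v) (C := 2 * L)
      (fun x _ => hv x) (fun x _ => norm_fderiv_le_of_pderiv fun i => hL i x)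
      (mem_univ 0) (mem_univ x)
    simpa using this
  rw [e, ← Real.norm_eq_abs]
  calc ‖∫ x, ρ 0 x * inner ℝ (u 0 x) (v x - v 0)‖ ≤ ∫ x, 5 / 2 * L * (‖x‖ * ‖u 0 x‖) := by
        refine norm_integral_le_of_norm_le (hU.const_mul _) (ae_of_all _ fun x => ?_)
        rw [norm_mul]
        calc _ ≤ 5 / 4 * (‖u 0 x‖ * (2 * L * ‖x‖)) := by
              refine mul_le_mul (h.abs_density_le h0 le_rfl x) ?_ (norm_nonneg _) (by norm_num)
              exact (norm_inner_le_norm _ _).trans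
                (mul_le_mul_of_nonneg_left (hlip x) (norm_nonneg _))
          _ = _ := by ring
    _ = _ := integral_const_mul _ _

lemma abs_integral_convection_le_sup (h : IsSmoothSolution ρ u P)
    (h0 : ∀ x, 3 / 4 ≤ ρ 0 x ∧ ρ 0 x ≤ 5 / 4) (ht : 0 ≤ t) {v : Plane → Plane} {L : ℝ}
    (hL : ∀ i x, ‖pderiv i v x‖ ≤ L) :
    |∫ x, ρ t x * inner ℝ (u t x) (fderiv ℝ v x (u t x))| ≤ 5 / 2 * L * l2Sq (u t) := by
  have hL0 : 0 ≤ L := (norm_nonneg _).trans (hL 0 0)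
  rw [← Real.norm_eq_abs]
  calc _ ≤ ∫ x, 5 / 2 * L * ‖u t x‖ ^ 2 := by
        refine norm_integral_le_of_norm_le
          ((integrable_sq (h.smooth_velocity.memLp ht)).const_mul _) (ae_of_all _ fun x => ?_)
        rw [norm_mul]
        calc _ ≤ 5 / 4 * (‖u t x‖ * (2 * L * ‖u t x‖)) := by
              refine mul_le_mul (h.abs_density_le h0 ht x) ?_ (norm_nonneg _) (by norm_num)
              exact (norm_inner_le_norm _ _).trans
                (mul_le_mul_of_nonneg_left (norm_fderiv_apply_le (fun i => hL i x) _)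
                  (norm_nonneg _))
          _ = _ := by ring
    _ = _ := integral_const_mul _ _

lemma exists_abs_integral_convection_le : ∃ K : ℝ, 0 < K ∧
    ∀ (ρ : ℝ → Plane → ℝ) (u : ℝ → Plane → Plane) (P : ℝ → Plane → ℝ),
      IsSmoothSolution ρ u P → (∀ x, 3 / 4 ≤ ρ 0 x ∧ ρ 0 x ≤ 5 / 4) → ∀ t, 0 ≤ t →
      ∀ (v : Plane → Plane) (L : ℝ), (∀ i, MemLp (pderiv i v) 2) →
      (∀ i, l2Sq (pderiv i v) ≤ L) →
      |∫ x, ρ t x * inner ℝ (u t x) (fderiv ℝ v x (u t x))| ≤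
        K * √L * √(l2Sq (u t) * gradL2Sq (u t)) := by
  obtain ⟨C, hC, hlad⟩ := exists_integral_pow_four_le
  refine ⟨5 / 2 * √C, by positivity, fun ρ u P h h0 t ht v L hv hL => ?_⟩
  have hu := h.smooth_velocity
  obtain ⟨j1, j2⟩ := hlad (u t) ((hu.contDiff_two ht).of_le (by norm_num)) (hu.memLp ht)
    (fun i => (hu.pderiv i).memLp ht)
  have hcq : Continuous (fun x => ‖u t x‖ ^ 2) := (hu.continuous ht).norm.pow 2
  have hq : MemLp (fun x => ‖u t x‖ ^ 2) 2 := by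
    refine (memLp_two_iff (hcq.aestronglyMeasurable)).2 ?_
    refine j1.congr (ae_of_all _ fun x => ?_)
    simp only [norm_pow, norm_norm]
    ring
  have hql : l2Sq (fun x => ‖u t x‖ ^ 2) ≤ C * (l2Sq (u t) * gradL2Sq (u t)) := by
    refine le_trans (le_of_eq ?_) j2
    refine integral_congr_ae (ae_of_all _ fun x => ?_)
    simp only [norm_pow, norm_norm]
    ring
  have hs : ∀ i, ∫ x, ‖‖u t x‖ ^ 2‖ * ‖pderiv i v x‖ ≤
      √C * √(l2Sq (u t) * gradL2Sq (u t)) * √L := fun i => by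
    refine (integral_norm_mul_le hq (hv i)).trans ?_
    rw [← Real.sqrt_mul hC.le]
    exact mul_le_mul (Real.sqrt_le_sqrt hql) (Real.sqrt_le_sqrt (hL i)) (Real.sqrt_nonneg _)
      (Real.sqrt_nonneg _)
  have hi := fun i => integrable_norm_mul hq (hv i)
  rw [← Real.norm_eq_abs]
  calc _ ≤ ∫ x, 5 / 4 * ∑ i, ‖‖u t x‖ ^ 2‖ * ‖pderiv i v x‖ := by
        refine norm_integral_le_of_norm_le
          ((integrable_finsetSum _ fun i _ => hi i).const_mul _) (ae_of_all _ fun x => ?_)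
        rw [norm_mul]
        calc _ ≤ 5 / 4 * (‖u t x‖ * (‖u t x‖ * ∑ i, ‖pderiv i v x‖)) := by
              refine mul_le_mul (h.abs_density_le h0 ht x) ?_ (norm_nonneg _) (by norm_num)
              exact (norm_inner_le_norm _ _).trans
                (mul_le_mul_of_nonneg_left (norm_fderiv_apply_le_sum v x _)
                  (norm_nonneg _))
          _ = _ := by
            simp only [norm_pow, norm_norm]
            rw [← Finset.mul_sum]
            ring
    _ = 5 / 4 * ∑ i, ∫ x, ‖‖u t x‖ ^ 2‖ * ‖pderiv i v x‖ := by
        rw [integral_const_mul, integral_finsetSum _ fun i _ => hi i]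
    _ ≤ 5 / 4 * ∑ i : Fin 2, √C * √(l2Sq (u t) * gradL2Sq (u t)) * √L :=
        mul_le_mul_of_nonneg_left (Finset.sum_le_sum fun i _ => hs i) (by norm_num)
    _ = _ := by
        rw [Finset.sum_const, Finset.card_univ, Fintype.card_fin, nsmul_eq_mul]
        push_cast
        ring

/-- The duality estimate for the momentum equation, with an unspecified bound `J` of the
convection term. -/
lemma sqrt_l2Sq_le_of_convection (h : IsSmoothSolution ρ u P)
    (hU : Integrable (fun x => ‖x‖ * ‖u 0 x‖)) (hmean : ∫ x, ρ 0 x • u 0 x = 0)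
    (h0 : ∀ x, 3 / 4 ≤ ρ 0 x ∧ ρ 0 x ≤ 5 / 4) (ht : 0 ≤ t) (ha : 0 < a) {J : ℝ → ℝ}
    (hJ : ContinuousOn J (Icc 0 t)) (hJ0 : ∀ r ∈ Icc 0 t, 0 ≤ J r)
    (hconv : ∀ r ∈ Icc 0 t, |∫ x, ρ r x * inner ℝ (u r x)
      (fderiv ℝ (conv (heat (t - r + a)) (u t)) x (u r x))| ≤ J r * √(l2Sq (u t))) :
    √(l2Sq (u t)) ≤ 4 * √(a * gradL2Sq (u t)) +
      √(a⁻¹) * √(l2Sq (fun x => ρ 0 x - 1)) * √(l2Sq (u t)) + 8 / a * U₀ (u 0) +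
      6 / a * √(a⁻¹) * √(l2Sq (fun x => ρ 0 x - 1)) * (∫ r in 0..t, √(l2Sq (u r))) +
      ∫ r in 0..t, J r := by
  have hu := h.smooth_velocity
  obtain ⟨M, hh⟩ := h.isTestField ht
  have hΦ := hh.isBackwardHeatFlow ha ht
  set Φ : ℝ → Plane → Plane := fun s => conv (heat (t - s + a)) (u t) with hΦd
  set v := √(l2Sq (u t)) with hv
  set D := √(l2Sq (fun x => ρ 0 x - 1)) with hD
  have hv0 : 0 ≤ v := Real.sqrt_nonneg _
  have hD0 : 0 ≤ D := Real.sqrt_nonneg _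
  have hvsq : v * v = l2Sq (u t) := Real.mul_self_sqrt (l2Sq_nonneg _)
  have htm : t ∈ Icc 0 t := ⟨ht, le_rfl⟩
  have h0m : (0 : ℝ) ∈ Icc 0 t := ⟨le_rfl, ht⟩
  have cY : ContinuousOn (fun r => √(l2Sq (u r))) (Icc 0 t) :=
    (hu.continuousOn_l2Sq.mono fun r hr => hr.1).sqrt
  have hYi : IntervalIntegrable (fun r => √(l2Sq (u r))) volume 0 t :=
    ContinuousOn.intervalIntegrable (by rwa [uIcc_of_le ht])
  have hJi : IntervalIntegrable J volume 0 t :=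
    ContinuousOn.intervalIntegrable (by rwa [uIcc_of_le ht])
  have hU0 : 0 ≤ U₀ (u 0) := integral_nonneg fun x => by positivity
  have hYnn : 0 ≤ ∫ r in 0..t, √(l2Sq (u r)) :=
    intervalIntegral.integral_nonneg ht fun r _ => Real.sqrt_nonneg _
  have hJnn : 0 ≤ ∫ r in 0..t, J r := intervalIntegral.integral_nonneg ht hJ0
  have Φt : Φ t = conv (heat a) (u t) := by simp [hΦd]
  have hsub := memLp_sub_conv_heat ha hh.contDiff_one hh.norm_le hh.memLp_pderiv
  rw [← Φt] at hsub
  have p1 : ∫ x, inner ℝ (u t x) (u t x - Φ t x) ≤ v * (4 * √(a * gradL2Sq (u t))) := by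
    refine (le_abs_self _).trans ((abs_integral_inner_le (hu.memLp ht) hsub.1).trans ?_)
    refine mul_le_mul_of_nonneg_left ?_ hv0
    calc √(l2Sq fun x => u t x - Φ t x) ≤ √(16 * a * gradL2Sq (u t)) := Real.sqrt_le_sqrt hsub.2
      _ = _ := by
        rw [mul_assoc, Real.sqrt_mul (by norm_num), show (16 : ℝ) = 4 ^ 2 by norm_num,
          Real.sqrt_sq (by norm_num)]
  have p2 : |∫ x, (ρ t x - 1) * inner ℝ (u t x) (Φ t x)| ≤ √(a⁻¹) * v * (D * v) :=
    h.abs_integral_density_sub_one_inner_le ht fun x => by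
      rw [Φt]; exact hh.norm_conv_heat_le ha x
  have p3 : |∫ x, ρ 0 x * inner ℝ (u 0 x) (Φ 0 x)| ≤ 5 / 2 * (3 / a * v) * U₀ (u 0) := by
    refine h.abs_integral_initial_le hU hmean h0 (hΦ.differentiable 0 h0m) (hΦ.memLp 0 h0m)
      fun i x => ?_
    refine (hh.norm_pderiv_conv_heat_le (by linarith : 0 < t - 0 + a) i x).trans ?_
    refine mul_le_mul_of_nonneg_right ?_ hv0
    exact div_le_div_of_nonneg_left (by norm_num) ha (by linarith)
  have p4 : |∫ r in 0..t, ((∫ x, ρ r x * inner ℝ (u r x) (fderiv ℝ (Φ r) x (u r x))) -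
        ∫ x, (ρ r x - 1) * inner ℝ (u r x) (lap (Φ r) x))| ≤
      ∫ r in 0..t, (J r * v + 6 / a * √(a⁻¹) * v * D * √(l2Sq (u r))) := by
    rw [← Real.norm_eq_abs]
    refine intervalIntegral.norm_integral_le_of_norm_le ht (ae_of_all _ fun r hr => ?_)
      ((hJi.mul_const v).add (hYi.const_mul _))
    have hr' : r ∈ Icc 0 t := Ioc_subset_Icc_self hr
    have hτ : a ≤ t - r + a := by linarith [hr.2]
    have hτ0 : 0 < t - r + a := ha.trans_le hτ
    refine (norm_sub_le _ _).trans (add_le_add (hconv r hr') ?_)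
    have := h.abs_integral_density_sub_one_inner_le hr'.1 (v := lap (Φ r))
      (L := 6 / a * √(a⁻¹) * v) fun x => by
        refine (hh.norm_lap_conv_heat_le hτ0 x).trans ?_
        refine mul_le_mul_of_nonneg_right ?_ hv0
        refine mul_le_mul ?_ ?_ (Real.sqrt_nonneg _) (by positivity)
        · exact div_le_div_of_nonneg_left (by norm_num) ha hτ
        · exact Real.sqrt_le_sqrt (inv_anti₀ ha hτ)
    refine this.trans_eq ?_
    ring
  rw [intervalIntegral.integral_add (hJi.mul_const v) (hYi.const_mul _),
    intervalIntegral.integral_mul_const, intervalIntegral.integral_const_mul] at p4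
  have key := h.integral_momentum_test ht hΦ
  have e1 : l2Sq (u t) = (∫ x, inner ℝ (u t x) (u t x - Φ t x)) +
      ∫ x, inner ℝ (u t x) (Φ t x) := by
    rw [← integral_add (integrable_inner (hu.memLp ht) hsub.1)
      (integrable_inner (hu.memLp ht) (hΦ.memLp t htm))]
    refine integral_congr_ae (ae_of_all _ fun x => ?_)
    simp only
    rw [← inner_add_right, sub_add_cancel, real_inner_self_eq_norm_sq]
  have e2 : ∫ x, (ρ t x - 1) * inner ℝ (u t x) (Φ t x) =
      (∫ x, ρ t x * inner ℝ (u t x) (Φ t x)) - ∫ x, inner ℝ (u t x) (Φ t x) := by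
    rw [← integral_sub (h.integrable_density_inner ht (hΦ.memLp t htm))
      (integrable_inner (hu.memLp ht) (hΦ.memLp t htm))]
    exact integral_congr_ae (ae_of_all _ fun x => by ring)
  have q2 := (abs_le.1 p2).1
  have q3 := (abs_le.1 p3).2
  have q4 := (abs_le.1 p4).2
  rcases hv0.eq_or_lt with hz | hz
  · rw [← hz]
    have := Real.sqrt_nonneg (a * gradL2Sq (u t))
    positivity
  · refine le_of_mul_le_mul_left ?_ hz
    have hgap : 5 / 2 * (3 / a * v) * U₀ (u 0) ≤ v * (8 / a * U₀ (u 0)) := by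
      have : 0 ≤ v * (U₀ (u 0) / a) := by positivity
      have e : v * (8 / a * U₀ (u 0)) - 5 / 2 * (3 / a * v) * U₀ (u 0) =
        1 / 2 * (v * (U₀ (u 0) / a)) := by ring
      linarith
    rw [hvsq, e1]
    have : ∫ x, inner ℝ (u t x) (Φ t x) ≤ √(a⁻¹) * v * (D * v) + v * (8 / a * U₀ (u 0)) +
      ((∫ r in 0..t, J r) * v + 6 / a * √(a⁻¹) * v * D * ∫ r in 0..t, √(l2Sq (u r))) := by
        linarith
    calc _ ≤ v * (4 * √(a * gradL2Sq (u t))) + (√(a⁻¹) * v * (D * v) + v * (8 / a * U₀ (u 0)) +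
      ((∫ r in 0..t, J r) * v + 6 / a * √(a⁻¹) * v * D * ∫ r in 0..t, √(l2Sq (u r)))) :=
          add_le_add p1 this
      _ = _ := by ring

/-- The duality estimate for the momentum equation. -/
lemma exists_sqrt_l2Sq_le : ∃ K : ℝ, 0 < K ∧
    ∀ (ρ : ℝ → Plane → ℝ) (u : ℝ → Plane → Plane) (P : ℝ → Plane → ℝ),
      IsSmoothSolution ρ u P → Integrable (fun x => ‖x‖ * ‖u 0 x‖) →
      (∫ x, ρ 0 x • u 0 x = 0) → (∀ x, 3 / 4 ≤ ρ 0 x ∧ ρ 0 x ≤ 5 / 4) →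
      ∀ t, 0 ≤ t → ∀ a, 0 < a →
      ∀ B, B = 4 * √(a * gradL2Sq (u t)) +
        √(a⁻¹) * √(l2Sq (fun x => ρ 0 x - 1)) * √(l2Sq (u t)) + 8 / a * U₀ (u 0) +
        6 / a * √(a⁻¹) * √(l2Sq (fun x => ρ 0 x - 1)) * (∫ r in 0..t, √(l2Sq (u r))) →
      √(l2Sq (u t)) ≤ B + 8 / a * (∫ r in 0..t, l2Sq (u r)) ∧
      √(l2Sq (u t)) ≤ B + K * √(a⁻¹) * (∫ r in 0..t, √(l2Sq (u r) * gradL2Sq (u r))) := by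
  obtain ⟨K, hK, hconv⟩ := exists_abs_integral_convection_le
  refine ⟨3 * K, by positivity, fun ρ u P h hU hmean h0 t ht a ha B hB => ?_⟩
  have hu := h.smooth_velocity
  obtain ⟨M, hh⟩ := h.isTestField ht
  have hΦ := hh.isBackwardHeatFlow ha ht
  have cY : ContinuousOn (fun r => l2Sq (u r)) (Icc 0 t) :=
    hu.continuousOn_l2Sq.mono fun r hr => hr.1
  have cX : ContinuousOn (fun r => gradL2Sq (u r)) (Icc 0 t) :=
    h.continuousOn_gradL2Sq.mono fun r hr => hr.1
  subst hB
  constructor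
  · rw [← intervalIntegral.integral_const_mul (8 / a)]
    refine h.sqrt_l2Sq_le_of_convection (J := fun r => 8 / a * l2Sq (u r)) hU hmean h0 ht ha
      (continuousOn_const.mul cY)
      (fun r _ => mul_nonneg (by positivity) (l2Sq_nonneg _)) fun r hr => ?_
    have hτ : a ≤ t - r + a := by linarith [hr.2]
    have hτ0 : 0 < t - r + a := ha.trans_le hτ
    refine (h.abs_integral_convection_le_sup h0 hr.1 (L := 3 / a * √(l2Sq (u t)))
      fun i x => ?_).trans ?_
    · refine (hh.norm_pderiv_conv_heat_le hτ0 i x).trans ?_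
      refine mul_le_mul_of_nonneg_right ?_ (Real.sqrt_nonneg _)
      exact div_le_div_of_nonneg_left (by norm_num) ha hτ
    · have n1 : 0 ≤ √(l2Sq (u t)) * (l2Sq (u r) / a) :=
        mul_nonneg (Real.sqrt_nonneg _) (div_nonneg (l2Sq_nonneg _) ha.le)
      have e : 8 / a * l2Sq (u r) * √(l2Sq (u t)) - 5 / 2 * (3 / a * √(l2Sq (u t))) * l2Sq (u r) =
        1 / 2 * (√(l2Sq (u t)) * (l2Sq (u r) / a)) := by ring
      linarith
  · rw [← intervalIntegral.integral_const_mul (3 * K * √(a⁻¹))]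
    refine h.sqrt_l2Sq_le_of_convection
      (J := fun r => 3 * K * √(a⁻¹) * √(l2Sq (u r) * gradL2Sq (u r))) hU hmean h0 ht ha
      (continuousOn_const.mul (cY.mul cX).sqrt)
      (fun r _ => by positivity) fun r hr => ?_
    have hτ : a ≤ t - r + a := by linarith [hr.2]
    have hτ0 : 0 < t - r + a := ha.trans_le hτ
    refine (hconv ρ u P h h0 r hr.1 _ (9 * a⁻¹ * l2Sq (u t)) (hΦ.memLp_pderiv r hr)
      fun i => ?_).trans_eq ?_
    · refine (hh.l2Sq_pderiv_conv_heat_le hτ0 i).trans ?_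
      refine mul_le_mul_of_nonneg_right ?_ (l2Sq_nonneg _)
      rw [← div_eq_mul_inv]
      exact div_le_div_of_nonneg_left (by norm_num) ha hτ
    · rw [Real.sqrt_mul (by positivity), Real.sqrt_mul (by norm_num),
        show (9 : ℝ) = 3 ^ 2 by norm_num, Real.sqrt_sq (by norm_num)]
      ring

end IsSmoothSolution

/-! ### A nonlocal differential inequality -/

lemma sq_integral_mul_le {f g : ℝ → ℝ} {t : ℝ} (ht : 0 ≤ t) (hf : ContinuousOn f (Icc 0 t))
    (hg : ContinuousOn g (Icc 0 t)) :
    (∫ s in 0..t, f s * g s) ^ 2 ≤ (∫ s in 0..t, f s ^ 2) * ∫ s in 0..t, g s ^ 2 := by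
  have i1 : IntervalIntegrable (fun s => f s ^ 2) volume 0 t :=
    ContinuousOn.intervalIntegrable (by rw [uIcc_of_le ht]; exact hf.pow 2)
  have i2 : IntervalIntegrable (fun s => g s ^ 2) volume 0 t :=
    ContinuousOn.intervalIntegrable (by rw [uIcc_of_le ht]; exact hg.pow 2)
  have i3 : IntervalIntegrable (fun s => f s * g s) volume 0 t :=
    ContinuousOn.intervalIntegrable (by rw [uIcc_of_le ht]; exact hf.mul hg)
  have key : ∀ l : ℝ, 0 ≤ (∫ s in 0..t, g s ^ 2) * (l * l) + (2 * ∫ s in 0..t, f s * g s) * l +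
      ∫ s in 0..t, f s ^ 2 := fun l => by
    have h0 : 0 ≤ ∫ s in 0..t, (g s ^ 2 * (l * l) + 2 * l * (f s * g s) + f s ^ 2) :=
      intervalIntegral.integral_nonneg ht fun s _ => by
        have : g s ^ 2 * (l * l) + 2 * l * (f s * g s) + f s ^ 2 = (g s * l + f s) ^ 2 := by ring
        rw [this]; positivity
    rw [intervalIntegral.integral_add ((i2.mul_const _).add (i3.const_mul _)) i1,
      intervalIntegral.integral_add (i2.mul_const _) (i3.const_mul _),
      intervalIntegral.integral_mul_const, intervalIntegral.integral_const_mul] at h0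
    linarith
  have := discrim_le_zero key
  rw [discrim] at this
  nlinarith

lemma integral_le_sub_of_le_deriv {f G G' : ℝ → ℝ} {t : ℝ} (ht : 0 ≤ t)
    (hf : ContinuousOn f (Icc 0 t)) (hG' : ContinuousOn G' (Icc 0 t))
    (hG : ∀ s ∈ Icc 0 t, HasDerivAt G (G' s) s) (hle : ∀ s ∈ Icc 0 t, f s ≤ G' s) :
    ∫ s in 0..t, f s ≤ G t - G 0 := by
  have iG : IntervalIntegrable G' volume 0 t :=
    ContinuousOn.intervalIntegrable (by rwa [uIcc_of_le ht])
  rw [← intervalIntegral.integral_eq_sub_of_hasDerivAt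
    (fun s hs => hG s (by rwa [uIcc_of_le ht] at hs)) iG]
  exact intervalIntegral.integral_mono_on ht
    (ContinuousOn.intervalIntegrable (by rwa [uIcc_of_le ht])) iG hle

/-- The function `s ↦ (1 + s) ^ (1 / 4)`. -/
def fourthRoot (s : ℝ) : ℝ := (1 + s) ^ (1 / 4 : ℝ)

section fourthRoot

variable {s t : ℝ}

lemma fourthRoot_pow (hs : 0 ≤ s) : fourthRoot s ^ 4 = 1 + s := by
  rw [fourthRoot, ← Real.rpow_natCast, ← Real.rpow_mul (by positivity)]
  norm_num

lemma one_le_fourthRoot (hs : 0 ≤ s) : 1 ≤ fourthRoot s :=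
  Real.one_le_rpow (by linarith) (by norm_num)

lemma fourthRoot_zero : fourthRoot 0 = 1 := by simp [fourthRoot]

lemma fourthRoot_mono (hs : 0 ≤ s) (hst : s ≤ t) : fourthRoot s ≤ fourthRoot t :=
  Real.rpow_le_rpow (by positivity) (by linarith) (by norm_num)

lemma hasDerivAt_fourthRoot (hs : 0 ≤ s) :
    HasDerivAt fourthRoot (1 / (4 * fourthRoot s ^ 3)) s := by
  have h1 : HasDerivAt (fun s : ℝ => 1 + s) 1 s := (hasDerivAt_id s).const_add 1
  have h2 := h1.rpow_const (p := 1 / 4) (Or.inl (by positivity))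
  refine h2.congr_deriv ?_
  have e : (1 + s) ^ ((1 : ℝ) / 4 - 1) = (fourthRoot s ^ 3)⁻¹ := by
    rw [fourthRoot, ← Real.rpow_natCast, ← Real.rpow_mul (by positivity),
      ← Real.rpow_neg (by positivity)]
    norm_num
  rw [e]
  field_simp

lemma continuousOn_fourthRoot : ContinuousOn fourthRoot (Ici 0) := fun _ hs =>
  (hasDerivAt_fourthRoot hs).continuousAt.continuousWithinAt

end fourthRoot

/-- The constant in the preliminary decay estimate. -/
def preDecayConst (K z : ℝ) : ℝ := (1 + 2 * K + K * z) * Real.exp (2 * K * z)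

/-- The constant obtained when a decay estimate with constant `c` is improved. -/
def improvedDecayConst (K c z : ℝ) : ℝ := 1 + K * (1 + z + 4 * c + 16 * z * c ^ 2)

/-- The constant in the decay estimate. -/
def decayConst (K z : ℝ) : ℝ :=
  improvedDecayConst K (improvedDecayConst K (preDecayConst K z) z) z

/-- An energy `E` with dissipation `2X` that satisfies the nonlocal differential inequalities
coming from the duality estimate. -/
structure IsDecayPair (K : ℝ) (E X : ℝ → ℝ) : Prop where
  continuousOn : ContinuousOn E (Ici 0)
  continuousOn_dissipation : ContinuousOn X (Ici 0)
  nonneg : ∀ t, 0 ≤ t → 0 ≤ E t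
  dissipation_nonneg : ∀ t, 0 ≤ t → 0 ≤ X t
  hasDerivAt : ∀ t, 0 < t → HasDerivAt E (-2 * X t) t
  le_sup : ∀ t, 0 < t → 3 * (1 + t) ^ 2 * E t ≤ 2 * (1 + t) ^ 3 * X t +
    K * (E 0 + E 0 ^ 2 + (∫ s in 0..t, E s) + (∫ s in 0..t, E s) ^ 2)
  le_dissipation : ∀ t, 0 < t → 3 * (1 + t) ^ 2 * E t ≤ 2 * (1 + t) ^ 3 * X t +
    K * (E 0 + E 0 ^ 2 + (∫ s in 0..t, E s) + (1 + t) * (∫ s in 0..t, √(E s * X s)) ^ 2)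

namespace IsDecayPair

variable {K : ℝ} {E X : ℝ → ℝ} {t B : ℝ}

lemma le_of_deriv_le (h : IsDecayPair K E X) (ht : 0 ≤ t)
    (hB : ∀ s ∈ Ioo 0 t, 3 * (1 + s) ^ 2 * E s ≤ 2 * (1 + s) ^ 3 * X s + B) :
    (1 + t) ^ 3 * E t ≤ E 0 + B * t := by
  have hd : ∀ s ∈ Ioo 0 t, HasDerivAt (fun s => (1 + s) ^ 3 * E s)
      (3 * (1 + s) ^ 2 * E s - 2 * (1 + s) ^ 3 * X s) s := fun s hs => by
    have h1 : HasDerivAt (fun s : ℝ => (1 + s) ^ 3) (3 * (1 + s) ^ 2) s := by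
      refine (((hasDerivAt_id s).const_add 1).pow 3).congr_deriv ?_
      simp
    refine (h1.mul (h.hasDerivAt s hs.1)).congr_deriv ?_
    ring
  have hc : ContinuousOn (fun s => (1 + s) ^ 3 * E s) (Icc 0 t) :=
    ContinuousOn.mul (by fun_prop) (h.continuousOn.mono fun s hs => hs.1)
  have := (convex_Icc 0 t).image_sub_le_mul_sub_of_deriv_le hc
    (fun s hs => by
      rw [interior_Icc] at hs
      exact (hd s hs).differentiableAt.differentiableWithinAt)
    (C := B) (fun s hs => by
      rw [interior_Icc] at hs
      rw [(hd s hs).deriv]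
      linarith [hB s hs]) 0 ⟨le_rfl, ht⟩ t ⟨ht, le_rfl⟩ ht
  simp only [sub_zero, add_zero, one_pow, one_mul] at this
  linarith

lemma antitoneOn (h : IsDecayPair K E X) : AntitoneOn E (Ici 0) := by
  refine antitoneOn_of_deriv_nonpos (convex_Ici 0) h.continuousOn ?_ ?_
  · intro s hs
    rw [interior_Ici] at hs
    exact (h.hasDerivAt s hs).differentiableAt.differentiableWithinAt
  · intro s hs
    rw [interior_Ici] at hs
    rw [(h.hasDerivAt s hs).deriv]
    linarith [h.dissipation_nonneg s (le_of_lt hs)]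

lemma integral_nonneg (h : IsDecayPair K E X) (ht : 0 ≤ t) : 0 ≤ ∫ s in 0..t, E s :=
  intervalIntegral.integral_nonneg ht fun s hs => h.nonneg s hs.1

lemma integral_le (h : IsDecayPair K E X) (ht : 0 ≤ t) : ∫ s in 0..t, E s ≤ E 0 * t := by
  have := integral_le_sub_of_le_deriv (f := E) (G := fun s => E 0 * s) (G' := fun _ => E 0) ht
    (h.continuousOn.mono fun s hs => hs.1) continuousOn_const
    (fun s _ => by simpa using (hasDerivAt_id s).const_mul (E 0))
    (fun s hs => h.antitoneOn (mem_Ici.2 le_rfl) hs.1 hs.1)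
  simpa using this

lemma improve (h : IsDecayPair K E X) (hK : 0 ≤ K) (ht : 0 ≤ t) {c y : ℝ} (hc : 0 ≤ c)
    (hy : 1 ≤ y) (hI : ∀ s ∈ Icc 0 t, ∫ r in 0..s, E r ≤ 4 * E 0 * c * y) :
    (1 + t) ^ 2 * E t ≤ improvedDecayConst K c (E 0) * E 0 * y ^ 2 := by
  have e0 := h.nonneg 0 le_rfl
  set B := K * (E 0 + E 0 ^ 2 + 4 * E 0 * c * y + (4 * E 0 * c * y) ^ 2) with hB
  have hB0 : 0 ≤ B := by positivity
  have key := h.le_of_deriv_le (B := B) ht fun s hs => by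
    refine (h.le_sup s hs.1).trans ?_
    have h1 := hI s (Ioo_subset_Icc_self hs)
    have h2 := h.integral_nonneg hs.1.le
    have h3 := pow_le_pow_left₀ h2 h1 2
    rw [hB]
    gcongr
  have hy2 : 1 ≤ y ^ 2 := one_le_pow₀ hy
  have hyy : y ≤ y ^ 2 := by nlinarith
  have hBle : E 0 + B ≤ improvedDecayConst K c (E 0) * E 0 * y ^ 2 := by
    have a1 : E 0 ≤ E 0 * y ^ 2 := le_mul_of_one_le_right e0 hy2
    have a2 : E 0 ^ 2 ≤ E 0 ^ 2 * y ^ 2 := le_mul_of_one_le_right (sq_nonneg _) hy2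
    have a3 : 4 * E 0 * c * y ≤ 4 * E 0 * c * y ^ 2 :=
      mul_le_mul_of_nonneg_left hyy (by positivity)
    calc E 0 + B ≤ E 0 * y ^ 2 + K * (E 0 * y ^ 2 + E 0 ^ 2 * y ^ 2 + 4 * E 0 * c * y ^ 2 +
          (4 * E 0 * c * y) ^ 2) := by rw [hB]; gcongr
      _ = _ := by rw [improvedDecayConst]; ring
  have h1t : (0 : ℝ) < 1 + t := by positivity
  refine le_of_mul_le_mul_left ?_ h1t
  calc (1 + t) * ((1 + t) ^ 2 * E t) = (1 + t) ^ 3 * E t := by ring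
    _ ≤ E 0 + B * t := key
    _ ≤ (1 + t) * (E 0 + B) := by nlinarith [mul_nonneg ht e0]
    _ ≤ _ := mul_le_mul_of_nonneg_left hBle h1t.le

lemma continuousOn_weighted (h : IsDecayPair K E X) :
    ContinuousOn (fun s => fourthRoot s ^ 3 * (E s * X s)) (Ici 0) :=
  (continuousOn_fourthRoot.pow 3).mul (h.continuousOn.mul h.continuousOn_dissipation)

lemma weighted_nonneg (h : IsDecayPair K E X) (ht : 0 ≤ t) :
    0 ≤ fourthRoot t ^ 3 * (E t * X t) :=
  mul_nonneg (pow_nonneg (zero_le_one.trans (one_le_fourthRoot ht)) 3)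
    (mul_nonneg (h.nonneg t ht) (h.dissipation_nonneg t ht))

lemma sq_integral_sqrt_le (h : IsDecayPair K E X) (ht : 0 ≤ t) :
    (∫ s in 0..t, √(E s * X s)) ^ 2 ≤
      4 * fourthRoot t * ∫ s in 0..t, fourthRoot s ^ 3 * (E s * X s) := by
  have hsub : Icc 0 t ⊆ Ici 0 := fun s hs => hs.1
  have hq : ∀ s ∈ Icc 0 t, 0 < fourthRoot s := fun s hs =>
    zero_lt_one.trans_le (one_le_fourthRoot hs.1)
  have cq := continuousOn_fourthRoot.mono hsub
  have cw := h.continuousOn_weighted.mono hsub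
  have c1 : ContinuousOn (fun s => √((fourthRoot s ^ 3)⁻¹)) (Icc 0 t) :=
    ((cq.pow 3).inv₀ fun s hs => (pow_pos (hq s hs) 3).ne').sqrt
  have key := sq_integral_mul_le ht c1 cw.sqrt
  have e1 : ∫ s in 0..t, √((fourthRoot s ^ 3)⁻¹) * √(fourthRoot s ^ 3 * (E s * X s)) =
      ∫ s in 0..t, √(E s * X s) := by
    refine intervalIntegral.integral_congr fun s hs => ?_
    rw [uIcc_of_le ht] at hs
    have := hq s hs
    rw [← Real.sqrt_mul (by positivity), inv_mul_cancel_left₀ (by positivity)]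
  have e2 : ∫ s in 0..t, √(fourthRoot s ^ 3 * (E s * X s)) ^ 2 =
      ∫ s in 0..t, fourthRoot s ^ 3 * (E s * X s) := by
    refine intervalIntegral.integral_congr fun s hs => ?_
    rw [uIcc_of_le ht] at hs
    exact Real.sq_sqrt (h.weighted_nonneg hs.1)
  have e3 : ∫ s in 0..t, √((fourthRoot s ^ 3)⁻¹) ^ 2 ≤ 4 * fourthRoot t := by
    have := integral_le_sub_of_le_deriv (G := fun s => 4 * fourthRoot s)
      (G' := fun s => 4 * (1 / (4 * fourthRoot s ^ 3))) ht (c1.pow 2)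
      (continuousOn_const.mul (continuousOn_const.div (continuousOn_const.mul (cq.pow 3))
        fun s hs => (mul_pos (by norm_num) (pow_pos (hq s hs) 3)).ne'))
      (fun s hs => (hasDerivAt_fourthRoot hs.1).const_mul 4)
      (fun s hs => by
        have := hq s hs
        simp only [Pi.pow_apply]
        rw [Real.sq_sqrt (by positivity)]
        apply le_of_eq
        field_simp)
    simp only [Pi.pow_apply, fourthRoot_zero] at this
    linarith
  rw [e1, e2] at key
  refine key.trans (mul_le_mul_of_nonneg_right e3 ?_)
  exact intervalIntegral.integral_nonneg ht fun s hs => h.weighted_nonneg hs.1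

lemma fourthRoot_mul_le_integral (h : IsDecayPair K E X) (hK : 0 ≤ K) (ht : 0 ≤ t) :
    fourthRoot t ^ 3 * E t ≤ (1 + 2 * K + K * E 0) * E 0 +
      4 * K * ∫ s in 0..t, fourthRoot s ^ 3 * (E s * X s) := by
  have e0 := h.nonneg 0 le_rfl
  set W := ∫ s in 0..t, fourthRoot s ^ 3 * (E s * X s) with hW
  have hW0 : 0 ≤ W := intervalIntegral.integral_nonneg ht fun s hs => h.weighted_nonneg hs.1
  set q := fourthRoot t with hq
  have hq1 : 1 ≤ q := one_le_fourthRoot ht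
  have hq4 : q ^ 4 = 1 + t := fourthRoot_pow ht
  set B := K * (E 0 + E 0 ^ 2 + E 0 * t + (1 + t) * (4 * q * W)) with hB
  have hB0 : 0 ≤ B := by positivity
  have key := h.le_of_deriv_le (B := B) ht fun s hs => by
    refine (h.le_dissipation s hs.1).trans ?_
    have h1 := h.integral_le hs.1.le
    have h2 := h.sq_integral_sqrt_le hs.1.le
    have h3 : ∫ r in 0..s, fourthRoot r ^ 3 * (E r * X r) ≤ W := by
      refine intervalIntegral.integral_mono_interval le_rfl hs.1.le hs.2.le ?_ ?_
      · filter_upwards [ae_restrict_mem measurableSet_Ioc] with r hr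
        exact h.weighted_nonneg hr.1.le
      · refine ContinuousOn.intervalIntegrable ?_
        rw [uIcc_of_le ht]
        exact h.continuousOn_weighted.mono fun r hr => hr.1
    have h4 : fourthRoot s ≤ q := fourthRoot_mono hs.1.le hs.2.le
    have h5 : (0 : ℝ) ≤ fourthRoot s := zero_le_one.trans (one_le_fourthRoot hs.1.le)
    have h6 : E 0 * s ≤ E 0 * t := mul_le_mul_of_nonneg_left hs.2.le e0
    have h7 : (∫ r in 0..s, √(E r * X r)) ^ 2 ≤ 4 * q * W := by
      refine h2.trans (mul_le_mul (by linarith) h3 ?_ (by positivity))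
      exact intervalIntegral.integral_nonneg hs.1.le fun r hr => h.weighted_nonneg hr.1
    have h8 : (1 + s) * (∫ r in 0..s, √(E r * X r)) ^ 2 ≤ (1 + t) * (4 * q * W) :=
      mul_le_mul (by linarith [hs.2]) h7 (sq_nonneg _) (by positivity)
    have h9 : E 0 + E 0 ^ 2 + (∫ r in 0..s, E r) + (1 + s) * (∫ r in 0..s, √(E r * X r)) ^ 2 ≤
        E 0 + E 0 ^ 2 + E 0 * t + (1 + t) * (4 * q * W) := by linarith
    have h10 := mul_le_mul_of_nonneg_left h9 hK
    linarith
  have hq0 : 0 < q := zero_lt_one.trans_le hq1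
  have p4 : q ^ 4 ≤ q ^ 9 := pow_le_pow_right₀ hq1 (by norm_num)
  have p8 : q ^ 8 ≤ q ^ 9 := pow_le_pow_right₀ hq1 (by norm_num)
  have p0 : 1 ≤ q ^ 9 := one_le_pow₀ hq1
  have hle : E 0 + B * t ≤ E 0 + B * q ^ 4 := by
    have : B * t ≤ B * q ^ 4 := mul_le_mul_of_nonneg_left (by linarith) hB0
    linarith
  refine le_of_mul_le_mul_left ?_ (by positivity : 0 < q ^ 9)
  calc q ^ 9 * (q ^ 3 * E t) = (q ^ 4) ^ 3 * E t := by ring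
    _ = (1 + t) ^ 3 * E t := by rw [hq4]
    _ ≤ E 0 + B * q ^ 4 := key.trans hle
    _ ≤ E 0 + K * (E 0 + E 0 ^ 2 + E 0 * q ^ 4 + q ^ 4 * (4 * q * W)) * q ^ 4 := by
        have : E 0 * t ≤ E 0 * q ^ 4 := mul_le_mul_of_nonneg_left (by linarith) e0
        rw [hB, ← hq4]
        gcongr
    _ = E 0 * 1 + K * ((E 0 + E 0 ^ 2) * q ^ 4 + E 0 * q ^ 8 + q ^ 9 * (4 * W)) := by ring
    _ ≤ E 0 * q ^ 9 + K * ((E 0 + E 0 ^ 2) * q ^ 9 + E 0 * q ^ 9 + q ^ 9 * (4 * W)) := by gcongr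
    _ = _ := by ring

/-- A preliminary decay rate, by Gronwall's inequality. -/
lemma fourthRoot_mul_le (h : IsDecayPair K E X) (hK : 0 ≤ K) (ht : 0 ≤ t) :
    fourthRoot t ^ 3 * E t ≤ preDecayConst K (E 0) * E 0 := by
  have e0 := h.nonneg 0 le_rfl
  set A := (1 + 2 * K + K * E 0) * E 0 with hA
  let W : ℝ → ℝ := fun t => ∫ s in 0..t, fourthRoot s ^ 3 * (E s * X s)
  have hint : ∀ s, 0 ≤ s → IntervalIntegrable (fun s => fourthRoot s ^ 3 * (E s * X s)) volume 0 s :=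
    fun s hs => ContinuousOn.intervalIntegrable (by
      rw [uIcc_of_le hs]
      exact h.continuousOn_weighted.mono fun r hr => hr.1)
  have cW : ContinuousOn W (Icc 0 t) := by
    have := intervalIntegral.continuousOn_primitive_interval' (hint t ht) left_mem_uIcc
    rwa [uIcc_of_le ht] at this
  have dW : ∀ s ∈ Ioo 0 t, HasDerivAt W (fourthRoot s ^ 3 * (E s * X s)) s := fun s hs => by
    refine intervalIntegral.integral_hasDerivAt_right (hint s hs.1.le) ?_ ?_
    · exact (h.continuousOn_weighted.mono Ioi_subset_Ici_self).stronglyMeasurableAtFilter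
        isOpen_Ioi s hs.1
    · exact h.continuousOn_weighted.continuousAt (Ici_mem_nhds hs.1)
  let F : ℝ → ℝ := fun s => (A + 4 * K * W s) * Real.exp (2 * K * E s)
  have hF : AntitoneOn F (Icc 0 t) := by
    have hd : ∀ s ∈ Ioo 0 t, HasDerivAt F
        (4 * K * (fourthRoot s ^ 3 * (E s * X s)) * Real.exp (2 * K * E s) +
          (A + 4 * K * W s) * (Real.exp (2 * K * E s) * (2 * K * (-2 * X s)))) s := fun s hs =>
      (((dW s hs).const_mul (4 * K)).const_add A).mul
        (((h.hasDerivAt s hs.1).const_mul (2 * K)).exp)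
    refine antitoneOn_of_deriv_nonpos (convex_Icc 0 t) ?_ ?_ ?_
    · exact (continuousOn_const.add (continuousOn_const.mul cW)).mul
        ((continuousOn_const.mul (h.continuousOn.mono fun s hs => hs.1)).rexp)
    · intro s hs
      rw [interior_Icc] at hs
      exact (hd s hs).differentiableAt.differentiableWithinAt
    · intro s hs
      rw [interior_Icc] at hs
      rw [(hd s hs).deriv]
      have h1 : fourthRoot s ^ 3 * E s ≤ A + 4 * K * W s :=
        h.fourthRoot_mul_le_integral hK hs.1.le
      have h2 : 0 ≤ 4 * K * X s * Real.exp (2 * K * E s) := by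
        have := h.dissipation_nonneg s hs.1.le
        positivity
      have h3 := mul_le_mul_of_nonneg_left h1 h2
      linarith
  have h1 := h.fourthRoot_mul_le_integral hK ht
  have h2 := hF ⟨le_rfl, ht⟩ ⟨ht, le_rfl⟩ ht
  have hW0 : W 0 = 0 := by simp [W]
  have hWt : 0 ≤ W t := intervalIntegral.integral_nonneg ht fun s hs => h.weighted_nonneg hs.1
  have hA0 : 0 ≤ A := by positivity
  simp only [F, hW0, mul_zero, add_zero] at h2
  have h3 : 1 ≤ Real.exp (2 * K * E t) := by
    have := h.nonneg t ht
    exact Real.one_le_exp (by positivity)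
  have h4 : A + 4 * K * W t ≤ (A + 4 * K * W t) * Real.exp (2 * K * E t) :=
    le_mul_of_one_le_right (by positivity) h3
  calc _ ≤ A + 4 * K * W t := h1
    _ ≤ A * Real.exp (2 * K * E 0) := h4.trans h2
    _ = _ := by rw [hA, preDecayConst]; ring

/-- The decay of the energy. -/
theorem sq_mul_le (h : IsDecayPair K E X) (hK : 0 ≤ K) (ht : 0 ≤ t) :
    (1 + t) ^ 2 * E t ≤ decayConst K (E 0) * E 0 := by
  have e0 := h.nonneg 0 le_rfl
  have hq : ∀ s, 0 ≤ s → 0 < fourthRoot s := fun s hs =>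
    zero_lt_one.trans_le (one_le_fourthRoot hs)
  have hsub : ∀ s, Icc 0 s ⊆ Ici (0 : ℝ) := fun _ => Icc_subset_Ici_self
  have cq : ∀ s, ContinuousOn fourthRoot (Icc 0 s) := fun s =>
    continuousOn_fourthRoot.mono (hsub s)
  set c := preDecayConst K (E 0) with hc
  have hc0 : 0 ≤ c := by
    rw [hc, preDecayConst]
    positivity
  set c' := improvedDecayConst K c (E 0) with hc'
  have hc'0 : 0 ≤ c' := by
    rw [hc', improvedDecayConst]
    positivity
  have first : ∀ s, 0 ≤ s → ∫ r in 0..s, E r ≤ 4 * E 0 * c * fourthRoot s := fun s hs => by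
    have := integral_le_sub_of_le_deriv (f := E) (G := fun s => 4 * E 0 * c * fourthRoot s)
      (G' := fun s => 4 * E 0 * c * (1 / (4 * fourthRoot s ^ 3))) hs
      (h.continuousOn.mono (hsub _))
      (continuousOn_const.mul (continuousOn_const.div (continuousOn_const.mul ((cq _).pow 3))
        fun r hr => (mul_pos (by norm_num) (pow_pos (hq r hr.1) 3)).ne'))
      (fun r hr => (hasDerivAt_fourthRoot hr.1).const_mul _)
      (fun r hr => by
        have h1 := h.fourthRoot_mul_le hK hr.1
        have := hq r hr.1
        rw [mul_one_div, le_div_iff₀ (by positivity)]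
        linarith)
    have h2 : 0 ≤ 4 * E 0 * c * fourthRoot 0 := by
      rw [fourthRoot_zero]; positivity
    linarith
  have second : ∀ s, 0 ≤ s → fourthRoot s ^ 6 * E s ≤ c' * E 0 := fun s hs => by
    have h1 := h.improve hK hs hc0 (one_le_fourthRoot hs) fun r hr =>
      (first r hr.1).trans (mul_le_mul_of_nonneg_left (fourthRoot_mono hr.1 hr.2) (by positivity))
    have hqs := hq s hs
    rw [← fourthRoot_pow hs] at h1
    refine le_of_mul_le_mul_left ?_ (by positivity : 0 < fourthRoot s ^ 2)
    linarith
  refine (h.improve hK ht hc'0 le_rfl fun s hs => ?_).trans_eq ?_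
  · have := integral_le_sub_of_le_deriv (f := E)
      (G := fun s => -(2 * E 0 * c') * (fourthRoot s ^ 2)⁻¹)
      (G' := fun s => E 0 * c' * (fourthRoot s ^ 6)⁻¹) hs.1
      (h.continuousOn.mono (hsub _))
      (continuousOn_const.mul (((cq _).pow 6).inv₀
        fun r hr => (pow_pos (hq r hr.1) 6).ne'))
      (fun r hr => by
        have hr0 := hq r hr.1
        refine ((((hasDerivAt_fourthRoot hr.1).pow 2).inv (by simp; positivity)).const_mul
          _).congr_deriv ?_
        simp only [Pi.pow_apply]
        field_simp
        norm_num
        left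
        ring)
      (fun r hr => by
        have h1 := second r hr.1
        have := hq r hr.1
        rw [← div_eq_mul_inv, le_div_iff₀ (by positivity)]
        linarith)
    have h2 : 0 ≤ 2 * E 0 * c' * (fourthRoot s ^ 2)⁻¹ := by
      have := hq s hs.1; positivity
    have h3 : 0 ≤ E 0 * c' := by positivity
    simp only [fourthRoot_zero] at this
    linarith
  · rw [decayConst, ← hc, ← hc']
    ring

end IsDecayPair

/-! ### Decay of the energy -/

lemma four_add_sq_le (x y z w : ℝ) :
    (x + y + z + w) ^ 2 ≤ 4 * (x ^ 2 + y ^ 2 + z ^ 2 + w ^ 2) := by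
  nlinarith [sq_nonneg (x - y), sq_nonneg (x - z), sq_nonneg (x - w), sq_nonneg (y - z),
    sq_nonneg (y - w), sq_nonneg (z - w)]

/-- The algebra that turns the duality estimate into a differential inequality for the energy. -/
lemma three_mul_sq_mul_le {E Y X D U I S J T σ e : ℝ} (hσ : 1920 * T ≤ σ) (hT : 0 < T)
    (hY : 0 ≤ Y) (hX : 0 ≤ X) (hEY : E ≤ 5 / 4 * Y) (hD : 0 ≤ D) (hDT : D ≤ T)
    (hU : 0 ≤ U) (hUT : U ≤ e * T) (hI : 0 ≤ I)
    (hSI : S ^ 2 ≤ 4 / 3 * σ * I)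
    (h : √Y ≤ 4 * √(σ / 480 * X) + √((σ / 480)⁻¹) * √D * √Y + 8 / (σ / 480) * U +
      6 / (σ / 480) * √((σ / 480)⁻¹) * √D * S + J) :
    3 * σ ^ 2 * E ≤ 2 * σ ^ 3 * X + 10 ^ 12 * (e ^ 2 * T ^ 2 + T * I) + 60 * (σ ^ 2 * J ^ 2) := by
  have hσ0 : 0 < σ := by linarith
  set a := σ / 480 with ha
  have ha0 : 0 < a := by positivity
  have hσa : σ = 480 * a := by rw [ha]; ring
  set m := √(a⁻¹) * √D with hm
  have hm0 : 0 ≤ m := by positivity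
  have hm2 : m ^ 2 = D / a := by
    rw [hm, mul_pow, Real.sq_sqrt (by positivity), Real.sq_sqrt hD]
    field_simp
  have hmhalf : m ≤ 1 / 2 := by
    refine abs_le_of_sq_le_sq' ?_ (by norm_num) |>.2
    rw [hm2, div_le_iff₀ ha0]
    linarith
  have h1 : √Y ≤ 2 * (4 * √(a * X) + 8 / a * U + 6 / a * m * S + J) := by
    have e1 : 6 / a * √(a⁻¹) * √D * S = 6 / a * m * S := by rw [hm]; ring
    have e2 : m * √Y ≤ 1 / 2 * √Y := mul_le_mul_of_nonneg_right hmhalf (Real.sqrt_nonneg _)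
    rw [e1] at h
    linarith
  have h2 : Y ≤ 16 * (16 * (a * X) + 64 * U ^ 2 / a ^ 2 + 36 / a ^ 2 * (D / a) * S ^ 2 + J ^ 2) := by
    calc Y = √Y ^ 2 := (Real.sq_sqrt hY).symm
      _ ≤ (2 * (4 * √(a * X) + 8 / a * U + 6 / a * m * S + J)) ^ 2 :=
          pow_le_pow_left₀ (Real.sqrt_nonneg _) h1 2
      _ = 4 * (4 * √(a * X) + 8 / a * U + 6 / a * m * S + J) ^ 2 := by ring
      _ ≤ 4 * (4 * ((4 * √(a * X)) ^ 2 + (8 / a * U) ^ 2 + (6 / a * m * S) ^ 2 + J ^ 2)) :=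
          mul_le_mul_of_nonneg_left (four_add_sq_le _ _ _ _) (by norm_num)
      _ = 16 * (16 * √(a * X) ^ 2 + 64 * U ^ 2 / a ^ 2 + 36 / a ^ 2 * m ^ 2 * S ^ 2 + J ^ 2) := by
          ring
      _ = _ := by rw [hm2, Real.sq_sqrt (by positivity)]
  have h3 : D / a * S ^ 2 ≤ 640 * (T * I) := by
    calc D / a * S ^ 2 ≤ T / a * (4 / 3 * σ * I) := by gcongr
      _ = 640 * (T * I) := by rw [hσa]; field_simp; ring
  have h4 : U ^ 2 ≤ e ^ 2 * T ^ 2 := by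
    rw [← mul_pow]
    exact pow_le_pow_left₀ hU hUT 2
  have h5 : σ ^ 2 * Y ≤ 16 * (16 / 480 * σ ^ 3 * X + 64 * 480 ^ 2 * U ^ 2 +
      36 * 480 ^ 2 * (D / a * S ^ 2) + σ ^ 2 * J ^ 2) := by
    refine (mul_le_mul_of_nonneg_left h2 (sq_nonneg σ)).trans_eq ?_
    rw [hσa]
    field_simp
  have hTI : 0 ≤ T * I := by positivity
  have h6 := mul_le_mul_of_nonneg_left hEY (by positivity : 0 ≤ 3 * σ ^ 2)
  have h7 : 0 ≤ e ^ 2 * T ^ 2 := by positivity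
  linarith

namespace IsSmoothSolution

lemma exists_three_mul_sq_mul_energy_le : ∃ K : ℝ, 0 < K ∧
    ∀ (ρ : ℝ → Plane → ℝ) (u : ℝ → Plane → Plane) (P : ℝ → Plane → ℝ),
      IsSmoothSolution ρ u P → Integrable (fun x => ‖x‖ * ‖u 0 x‖) →
      (∫ x, ρ 0 x • u 0 x = 0) → (∀ x, 3 / 4 ≤ ρ 0 x ∧ ρ 0 x ≤ 5 / 4) →
      ∀ T, 0 < T → l2Sq (fun x => ρ 0 x - 1) ≤ T → U₀ (u 0) ≤ E₀ (ρ 0) (u 0) * T →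
      ∀ t, 0 ≤ t → ∀ e I B, e = E₀ (ρ 0) (u 0) → I = ∫ r in 0..t, E₀ (ρ r) (u r) →
      B = 2 * (t + T) ^ 3 * gradL2Sq (u t) + K * ((e + e ^ 2) * T ^ 2 + T * I) →
      3 * (t + T) ^ 2 * E₀ (ρ t) (u t) ≤ B + K * I ^ 2 ∧
      3 * (t + T) ^ 2 * E₀ (ρ t) (u t) ≤
        B + K * ((t + T) * (∫ r in 0..t, √(E₀ (ρ r) (u r) * gradL2Sq (u r))) ^ 2) := by
  obtain ⟨K, hK, key⟩ := exists_sqrt_l2Sq_le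
  refine ⟨10 ^ 12 + 10 ^ 5 * K ^ 2, by positivity,
    fun ρ u P h hU hmean h0 T hT hDT hUT t ht e I B he hIe hB => ?_⟩
  have hu := h.smooth_velocity
  have he0 : 0 ≤ e := he ▸ h.energy_nonneg le_rfl
  have hE0 : 0 ≤ E₀ (ρ t) (u t) := h.energy_nonneg ht
  have hEe : E₀ (ρ t) (u t) ≤ e := he ▸ h.energy_antitone le_rfl ht
  have hX := gradL2Sq_nonneg (u t)
  have hsub : Icc 0 t ⊆ Ici 0 := Icc_subset_Ici_self
  have cY := hu.continuousOn_l2Sq.mono hsub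
  have cE := h.continuousOn_energy.mono hsub
  have cX := h.continuousOn_gradL2Sq.mono hsub
  have hI0 : 0 ≤ I := hIe ▸ intervalIntegral.integral_nonneg ht fun r hr => h.energy_nonneg hr.1
  have hσ0 : 0 < t + T := by positivity
  set Q := (t + T) * (∫ r in 0..t, √(E₀ (ρ r) (u r) * gradL2Sq (u r))) ^ 2 with hQ
  have hQ0 : 0 ≤ Q := by positivity
  rcases le_or_gt (1920 * T) (t + T) with hσ | hσ
  · have hYE : ∀ r ∈ Icc 0 t, l2Sq (u r) ≤ 4 / 3 * E₀ (ρ r) (u r) := fun r hr => by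
      linarith [(h.energy_bounds h0 hr.1).1]
    have iY : IntervalIntegrable (fun r => l2Sq (u r)) volume 0 t :=
      ContinuousOn.intervalIntegrable (by rwa [uIcc_of_le ht])
    have iE : IntervalIntegrable (fun r => E₀ (ρ r) (u r)) volume 0 t :=
      ContinuousOn.intervalIntegrable (by rwa [uIcc_of_le ht])
    have hIY : ∫ r in 0..t, l2Sq (u r) ≤ 4 / 3 * I := by
      rw [hIe, ← intervalIntegral.integral_const_mul]
      exact intervalIntegral.integral_mono_on ht iY (iE.const_mul _) hYE
    have hIY0 : 0 ≤ ∫ r in 0..t, l2Sq (u r) :=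
      intervalIntegral.integral_nonneg ht fun r _ => l2Sq_nonneg _
    set S := ∫ r in 0..t, √(l2Sq (u r)) with hS
    have hSI : S ^ 2 ≤ 4 / 3 * (t + T) * I := by
      have := sq_integral_mul_le ht (f := fun _ => 1) continuousOn_const cY.sqrt
      simp only [one_mul, one_pow, intervalIntegral.integral_const, sub_zero, smul_eq_mul,
        mul_one, Real.sq_sqrt (l2Sq_nonneg _)] at this
      have h1 : t * ∫ r in 0..t, l2Sq (u r) ≤ (t + T) * (4 / 3 * I) :=
        mul_le_mul (by linarith) hIY hIY0 hσ0.le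
      linarith
    have hEY := (h.energy_bounds h0 ht).2
    have hU0 : 0 ≤ U₀ (u 0) := integral_nonneg fun x => by positivity
    obtain ⟨k1, k2⟩ := key ρ u P h hU hmean h0 t ht ((t + T) / 480) (by positivity) _ rfl
    have hZ0 : 0 ≤ ∫ r in 0..t, √(l2Sq (u r) * gradL2Sq (u r)) :=
      intervalIntegral.integral_nonneg ht fun r _ => Real.sqrt_nonneg _
    have f1 := three_mul_sq_mul_le hσ hT (l2Sq_nonneg _) hX hEY (l2Sq_nonneg _) hDT hU0
      (he ▸ hUT) hI0 hSI k1
    have f2 := three_mul_sq_mul_le hσ hT (l2Sq_nonneg _) hX hEY (l2Sq_nonneg _) hDT hU0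
      (he ▸ hUT) hI0 hSI k2
    have hK2 : 0 ≤ K ^ 2 := sq_nonneg K
    have g0 : 0 ≤ e * T ^ 2 := by positivity
    have g1 : 0 ≤ e ^ 2 * T ^ 2 := by positivity
    have g2 : 0 ≤ T * I := by positivity
    have g3 := mul_nonneg hK2 g0
    have g4 := mul_nonneg hK2 g1
    have g5 := mul_nonneg hK2 g2
    constructor
    · have e1 : (t + T) ^ 2 * (8 / ((t + T) / 480) * ∫ r in 0..t, l2Sq (u r)) ^ 2 =
          14745600 * (∫ r in 0..t, l2Sq (u r)) ^ 2 := by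
        field_simp
        ring
      have e2 : (∫ r in 0..t, l2Sq (u r)) ^ 2 ≤ 2 * I ^ 2 := by
        have := pow_le_pow_left₀ hIY0 hIY 2
        linarith [sq_nonneg I]
      rw [e1] at f1
      rw [hB]
      linarith [sq_nonneg I, mul_nonneg hK2 (sq_nonneg I)]
    · have e1 : (t + T) ^ 2 * (K * √(((t + T) / 480)⁻¹) *
          ∫ r in 0..t, √(l2Sq (u r) * gradL2Sq (u r))) ^ 2 =
          480 * K ^ 2 * ((t + T) * (∫ r in 0..t, √(l2Sq (u r) * gradL2Sq (u r))) ^ 2) := by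
        rw [mul_pow, mul_pow, Real.sq_sqrt (by positivity)]
        field_simp
      have hZ : ∫ r in 0..t, √(l2Sq (u r) * gradL2Sq (u r)) ≤
          √(4 / 3) * ∫ r in 0..t, √(E₀ (ρ r) (u r) * gradL2Sq (u r)) := by
        rw [← intervalIntegral.integral_const_mul]
        refine intervalIntegral.integral_mono_on ht
          (ContinuousOn.intervalIntegrable (by rw [uIcc_of_le ht]; exact (cY.mul cX).sqrt))
          (ContinuousOn.intervalIntegrable (by
            rw [uIcc_of_le ht]; exact continuousOn_const.mul (cE.mul cX).sqrt)) fun r hr => ?_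
        rw [← Real.sqrt_mul (by norm_num)]
        refine Real.sqrt_le_sqrt ?_
        rw [← mul_assoc]
        exact mul_le_mul_of_nonneg_right (hYE r hr) (gradL2Sq_nonneg _)
      have e2 : (t + T) * (∫ r in 0..t, √(l2Sq (u r) * gradL2Sq (u r))) ^ 2 ≤ 4 / 3 * Q := by
        have := pow_le_pow_left₀ hZ0 hZ 2
        rw [mul_pow, Real.sq_sqrt (by norm_num)] at this
        have := mul_le_mul_of_nonneg_left this hσ0.le
        rw [hQ]
        linarith
      rw [e1] at f2
      rw [hB]
      linarith [mul_nonneg hK2 hQ0, mul_le_mul_of_nonneg_left e2 hK2]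
  · have hb : 3 * (t + T) ^ 2 * E₀ (ρ t) (u t) ≤ B := by
      have h1 : (t + T) ^ 2 ≤ (1920 * T) ^ 2 := pow_le_pow_left₀ hσ0.le hσ.le 2
      have h2 : (t + T) ^ 2 * E₀ (ρ t) (u t) ≤ (1920 * T) ^ 2 * e :=
        mul_le_mul h1 hEe hE0 (sq_nonneg _)
      have h3 : 0 ≤ 2 * (t + T) ^ 3 * gradL2Sq (u t) := by positivity
      have h4 : 0 ≤ e ^ 2 * T ^ 2 + T * I := by positivity
      have h5 : 0 ≤ e * T ^ 2 := by positivity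
      have h6 : 0 ≤ K ^ 2 * ((e + e ^ 2) * T ^ 2 + T * I) := by positivity
      rw [hB]
      linarith
    constructor
    · have : 0 ≤ (10 ^ 12 + 10 ^ 5 * K ^ 2) * I ^ 2 := by positivity
      linarith
    · have : 0 ≤ (10 ^ 12 + 10 ^ 5 * K ^ 2) * Q := by positivity
      linarith

/-- Decay of the energy at every admissible time scale. -/
theorem exists_energy_le : ∃ K : ℝ, 0 < K ∧
    ∀ (ρ : ℝ → Plane → ℝ) (u : ℝ → Plane → Plane) (P : ℝ → Plane → ℝ),
      IsSmoothSolution ρ u P → Integrable (fun x => ‖x‖ * ‖u 0 x‖) →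
      (∫ x, ρ 0 x • u 0 x = 0) → (∀ x, 3 / 4 ≤ ρ 0 x ∧ ρ 0 x ≤ 5 / 4) →
      ∀ T, 0 < T → l2Sq (fun x => ρ 0 x - 1) ≤ T → U₀ (u 0) ≤ E₀ (ρ 0) (u 0) * T →
      ∀ t, 0 ≤ t → (1 + t / T) ^ 2 * E₀ (ρ t) (u t) ≤
        decayConst K (E₀ (ρ 0) (u 0)) * E₀ (ρ 0) (u 0) := by
  obtain ⟨K, hK, key⟩ := exists_three_mul_sq_mul_energy_le
  refine ⟨K, hK, fun ρ u P h hU hmean h0 T hT hDT hUT t ht => ?_⟩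
  have hmaps : MapsTo (fun s => T * s) (Ici 0) (Ici 0) := fun s hs =>
    mul_nonneg hT.le hs
  have e1 : ∀ s, ∫ r in 0..T * s, E₀ (ρ r) (u r) = T * ∫ r in 0..s, E₀ (ρ (T * r)) (u (T * r)) :=
    fun s => by
      have := intervalIntegral.smul_integral_comp_mul_left (a := 0) (b := s)
        (fun r => E₀ (ρ r) (u r)) T
      rw [mul_zero, smul_eq_mul] at this
      exact this.symm
  have e2 : ∀ s, T * (∫ r in 0..T * s, √(E₀ (ρ r) (u r) * gradL2Sq (u r))) ^ 2 =
      T ^ 2 * (∫ r in 0..s, √(E₀ (ρ (T * r)) (u (T * r)) * (T * gradL2Sq (u (T * r))))) ^ 2 :=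
    fun s => by
      have := intervalIntegral.smul_integral_comp_mul_left (a := 0) (b := s)
        (fun r => √(E₀ (ρ r) (u r) * gradL2Sq (u r))) T
      rw [mul_zero, smul_eq_mul] at this
      have e : ∀ r, √(E₀ (ρ (T * r)) (u (T * r)) * (T * gradL2Sq (u (T * r)))) =
          √T * √(E₀ (ρ (T * r)) (u (T * r)) * gradL2Sq (u (T * r))) := fun r => by
        rw [← Real.sqrt_mul hT.le]
        congr 1
        ring
      simp only [e]
      rw [← this, intervalIntegral.integral_const_mul, mul_pow, mul_pow, Real.sq_sqrt hT.le]
      ring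
  have pair : IsDecayPair K (fun s => E₀ (ρ (T * s)) (u (T * s)))
      (fun s => T * gradL2Sq (u (T * s))) := by
    refine ⟨?_, ?_, fun s hs => h.energy_nonneg (mul_nonneg hT.le hs),
      fun s _ => mul_nonneg hT.le (gradL2Sq_nonneg _), fun s hs => ?_, fun s hs => ?_,
      fun s hs => ?_⟩
    · exact h.continuousOn_energy.comp (f := fun s => T * s) (by fun_prop) hmaps
    · exact continuousOn_const.mul
        (h.continuousOn_gradL2Sq.comp (f := fun s => T * s) (by fun_prop) hmaps)
    · have h1 := h.hasDerivAt_energy (mul_pos hT hs)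
      have h2 : HasDerivAt (fun s => T * s) T s := by
        simpa using (hasDerivAt_id s).const_mul T
      refine (h1.comp s h2).congr_deriv ?_
      ring
    · have h1 := (key ρ u P h hU hmean h0 T hT hDT hUT (T * s) (by positivity) _ _ _ rfl rfl
        rfl).1
      rw [e1] at h1
      simp only [mul_zero]
      refine le_of_mul_le_mul_left ?_ (by positivity : 0 < T ^ 2)
      linarith
    · have h1 := (key ρ u P h hU hmean h0 T hT hDT hUT (T * s) (by positivity) _ _ _ rfl rfl
        rfl).2
      have e3 : (T * s + T) * (∫ r in 0..T * s, √(E₀ (ρ r) (u r) * gradL2Sq (u r))) ^ 2 =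
        (s + 1) * (T * (∫ r in 0..T * s, √(E₀ (ρ r) (u r) * gradL2Sq (u r))) ^ 2) := by ring
      rw [e1, e3, e2] at h1
      simp only [mul_zero]
      refine le_of_mul_le_mul_left ?_ (by positivity : 0 < T ^ 2)
      linarith
  have := pair.sq_mul_le hK.le (by positivity : 0 ≤ t / T)
  simp only [mul_zero] at this
  rwa [mul_div_cancel₀ t hT.ne'] at this

end IsSmoothSolution

lemma one_le_decayConst {K z : ℝ} (hK : 0 ≤ K) (hz : 0 ≤ z) : 1 ≤ decayConst K z := by
  have h1 : 0 ≤ preDecayConst K z := by unfold preDecayConst; positivity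
  have h2 : 0 ≤ improvedDecayConst K (preDecayConst K z) z := by
    unfold improvedDecayConst; positivity
  rw [decayConst, improvedDecayConst]
  exact le_add_of_nonneg_right (by positivity)

lemma decayConst_mono {K z w : ℝ} (hK : 0 ≤ K) (hz : 0 ≤ z) (hzw : z ≤ w) :
    decayConst K z ≤ decayConst K w := by
  have hw : 0 ≤ w := hz.trans hzw
  have hp : 0 ≤ preDecayConst K z := by unfold preDecayConst; positivity
  have h1 : preDecayConst K z ≤ preDecayConst K w := by unfold preDecayConst; gcongr
  have himp : ∀ c d, 0 ≤ c → c ≤ d → 0 ≤ improvedDecayConst K c z ∧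
      improvedDecayConst K c z ≤ improvedDecayConst K d w := fun c d hc hcd => by
    unfold improvedDecayConst
    exact ⟨by positivity, by gcongr⟩
  obtain ⟨h2, h3⟩ := himp _ _ hp h1
  exact (himp _ _ h2 h3).2

/-- The velocity vanishes if its first moment does. -/
lemma energy_eq_zero_of_moment {ρ₀ : Plane → ℝ} {u₀ : Plane → Plane}
    (hU : Integrable (fun x => ‖x‖ * ‖u₀ x‖)) (hz : U₀ u₀ = 0) : E₀ ρ₀ u₀ = 0 := by
  have h1 : (fun x => ‖x‖ * ‖u₀ x‖) =ᵐ[volume] 0 :=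
    (integral_eq_zero_iff_of_nonneg (fun x => by positivity) hU).1 hz
  have hae : ∀ᵐ x : Plane, x ≠ 0 := by
    simp [ae_iff]
  refine integral_eq_zero_of_ae ?_
  filter_upwards [h1, hae] with x hx hx0
  have : ‖u₀ x‖ = 0 := (mul_eq_zero.1 hx).resolve_left (norm_ne_zero_iff.2 hx0)
  simp [this]


lemma bracket_pos {T t : ℝ} (hT : 0 ≤ T) (ht : 0 ≤ t) : 0 < bracket T t := by
  unfold bracket
  have := Real.exp_pos 1
  positivity

end INS2D

end

theorem stmt_7 :
    ∃ C : ℝ → ℝ, Monotone C ∧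
      ∀ (ρ : ℝ → INS2D.Plane → ℝ) (u : ℝ → INS2D.Plane → INS2D.Plane) (P : ℝ → INS2D.Plane → ℝ),
        INS2D.IsSmoothSolution ρ u P →
        Integrable (fun x => ‖x‖ * ‖u 0 x‖) volume →
        (∫ x, ρ 0 x • u 0 x) = 0 →
        (∀ x, 3 / 4 ≤ ρ 0 x ∧ ρ 0 x ≤ 5 / 4) →
        (∀ T, INS2D.T₀ (ρ 0) (u 0) ≤ T → ∀ t, 0 ≤ t →
          INS2D.l2Sq (u t) ≤
            C (INS2D.E₀ (ρ 0) (u 0)) *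
              (INS2D.E₀ (ρ 0) (u 0) * INS2D.bracket T t ^ (-2 : ℤ))) ∧
        (∀ T, INS2D.T₁ (ρ 0) (u 0) ≤ T → ∀ t, 0 ≤ t →
          INS2D.gradL2Sq (u t) ≤
            C (INS2D.E₀ (ρ 0) (u 0)) *
              (INS2D.E₁ (u 0) * INS2D.bracket T t ^ (-3 : ℤ))) := by
  obtain ⟨K, hK, hdecay⟩ := INS2D.IsSmoothSolution.exists_energy_le
  obtain ⟨L, hL, hgrad⟩ := INS2D.IsSmoothSolution.exists_mul_gradL2Sq_le
  refine ⟨fun z => 64 * (Real.exp (L * max z 0 ^ 2) * INS2D.decayConst K (max z 0)),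
    fun z w hzw => ?_, fun ρ u P h hU hmean h0 => ?_⟩
  · have h1 : max z 0 ≤ max w 0 := max_le_max_right 0 hzw
    have h2 := INS2D.decayConst_mono hK.le (le_max_right z 0) h1
    have h3 := INS2D.one_le_decayConst hK.le (le_max_right z 0)
    have h4 := le_max_right z 0
    have h5 : 0 ≤ INS2D.decayConst K (max z 0) := by linarith
    simp only
    gcongr
  have hexp : Real.exp 1 < 3 := Real.exp_one_lt_three
  have he0 : 0 ≤ INS2D.E₀ (ρ 0) (u 0) := h.energy_nonneg le_rfl
  have hdec := hdecay ρ u P h hU hmean h0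
  have hgr := hgrad ρ u P h h0
  set e := INS2D.E₀ (ρ 0) (u 0) with he
  simp only [max_eq_left he0]
  set c := INS2D.decayConst K e with hc
  have hc1 : 1 ≤ c := INS2D.one_le_decayConst hK.le he0
  set k := Real.exp (L * e ^ 2) with hk
  have hk1 : 1 ≤ k := Real.one_le_exp (by positivity)
  have hkc : 1 ≤ k * c := one_le_mul_of_one_le_of_one_le hk1 hc1
  have hU0 : 0 ≤ INS2D.U₀ (u 0) := integral_nonneg fun x => by positivity
  have hd0 : 0 ≤ INS2D.l2Sq (fun x => ρ 0 x - 1) := INS2D.l2Sq_nonneg _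
  have hE1 : 0 ≤ INS2D.E₁ (u 0) := INS2D.gradL2Sq_nonneg _
  have hT0 : ∀ T, INS2D.T₀ (ρ 0) (u 0) ≤ T → 0 ≤ T ∧ INS2D.l2Sq (fun x => ρ 0 x - 1) ≤ T ∧
      (0 < e → 0 < T ∧ INS2D.U₀ (u 0) ≤ e * T) := fun T hT => by
    have h1 : INS2D.U₀ (u 0) / e ≤ T := (le_max_left _ _).trans hT
    have h2 : INS2D.l2Sq (fun x => ρ 0 x - 1) ≤ T := (le_max_right _ _).trans hT
    refine ⟨hd0.trans h2, h2, fun hpos => ⟨?_, ?_⟩⟩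
    · have hUpos : 0 < INS2D.U₀ (u 0) := hU0.lt_of_ne fun hz =>
        hpos.ne' (INS2D.energy_eq_zero_of_moment hU hz.symm)
      exact (div_pos hUpos hpos).trans_le h1
    · rw [div_le_iff₀ hpos] at h1
      linarith
  have hYE : ∀ t, 0 ≤ t → INS2D.l2Sq (u t) ≤ 4 / 3 * INS2D.E₀ (ρ t) (u t) := fun t ht => by
    linarith [(h.energy_bounds h0 ht).1]
  have hzero : e = 0 → ∀ t, 0 ≤ t → INS2D.E₀ (ρ t) (u t) = 0 := fun hz t ht =>
    le_antisymm (hz ▸ h.energy_antitone le_rfl ht) (h.energy_nonneg ht)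
  constructor
  · intro T hT t ht
    obtain ⟨hTn, hDT, hTp⟩ := hT0 T hT
    rcases he0.eq_or_lt with hz | hpos
    · have h1 := hYE t ht
      rw [hzero hz.symm t ht] at h1
      rw [← hz]
      linarith
    · obtain ⟨hTpos, hUT⟩ := hTp hpos
      have h1 := hdec T hTpos hDT hUT t ht
      have h2 := hYE t ht
      have hx : 0 ≤ t / T := by positivity
      have hb : INS2D.bracket T t ≤ 3 * (1 + t / T) := by
        unfold INS2D.bracket; linarith
      have hb0 := INS2D.bracket_pos hTn ht
      have hEt := h.energy_nonneg ht
      rw [zpow_neg, ← div_eq_mul_inv, ← mul_div_assoc, le_div_iff₀ (by positivity)]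
      norm_cast
      have hb2 : INS2D.bracket T t ^ 2 ≤ 9 * (1 + t / T) ^ 2 := by
        refine (pow_le_pow_left₀ hb0.le hb 2).trans_eq ?_
        ring
      have hce : 0 ≤ c * e := by positivity
      calc INS2D.l2Sq (u t) * INS2D.bracket T t ^ 2
          ≤ (4 / 3 * INS2D.E₀ (ρ t) (u t)) * (9 * (1 + t / T) ^ 2) :=
            mul_le_mul h2 hb2 (by positivity) (by positivity)
        _ = 12 * ((1 + t / T) ^ 2 * INS2D.E₀ (ρ t) (u t)) := by ring
        _ ≤ 12 * (c * e) := by linarith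
        _ ≤ 64 * (1 * c) * e := by linarith
        _ ≤ 64 * (k * c) * e := by gcongr
  · intro T hT t ht
    have hT' : INS2D.T₀ (ρ 0) (u 0) ≤ T := (le_max_left _ _).trans hT
    have hT1 : e / INS2D.E₁ (u 0) ≤ T := (le_max_right _ _).trans hT
    obtain ⟨hTn, hDT, hTp⟩ := hT0 T hT'
    obtain ⟨g1, g2⟩ := hgr t ht
    have hb0 := INS2D.bracket_pos hTn ht
    change INS2D.gradL2Sq (u t) ≤ k * INS2D.E₁ (u 0) at g1
    have hXt := INS2D.gradL2Sq_nonneg (u t)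
    have short : INS2D.bracket T t ≤ 4 → INS2D.gradL2Sq (u t) ≤
        64 * (k * c) * (INS2D.E₁ (u 0) * INS2D.bracket T t ^ (-3 : ℤ)) := fun hb => by
      rw [zpow_neg, ← div_eq_mul_inv, ← mul_div_assoc, le_div_iff₀ (by positivity)]
      norm_cast
      have hb3 : INS2D.bracket T t ^ 3 ≤ 64 := by
        refine (pow_le_pow_left₀ hb0.le hb 3).trans_eq ?_
        norm_num
      calc INS2D.gradL2Sq (u t) * INS2D.bracket T t ^ 3 ≤ k * INS2D.E₁ (u 0) * 64 :=
            mul_le_mul g1 hb3 (by positivity) (by positivity)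
        _ = 64 * (k * 1) * INS2D.E₁ (u 0) := by ring
        _ ≤ 64 * (k * c) * INS2D.E₁ (u 0) := by gcongr
    rcases le_or_gt t T with htT | htT
    · refine short ?_
      have : t / T ≤ 1 := div_le_one_of_le₀ htT hTn
      unfold INS2D.bracket
      linarith
    have htpos : 0 < t := hTn.trans_lt htT
    have hRHS : 0 ≤ 64 * (k * c) * (INS2D.E₁ (u 0) * INS2D.bracket T t ^ (-3 : ℤ)) := by
      positivity
    rcases he0.eq_or_lt with hz | hpos
    · rw [hzero hz.symm (t / 2) (by positivity), mul_zero] at g2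
      have : INS2D.gradL2Sq (u t) ≤ 0 := by
        by_contra hcon
        exact absurd g2 (not_le.2 (mul_pos htpos (not_le.1 hcon)))
      exact this.trans hRHS
    rcases hE1.eq_or_lt with hE1z | hE1p
    · rw [← hE1z, mul_zero] at g1
      exact g1.trans hRHS
    obtain ⟨hTpos, hUT⟩ := hTp hpos
    have h1 := hdec T hTpos hDT hUT (t / 2) (by positivity)
    have heT : e ≤ T * INS2D.E₁ (u 0) := (div_le_iff₀ hE1p).1 hT1
    set x := t / T with hx
    have hx1 : 1 ≤ x := (one_le_div hTpos).2 htT.le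
    have htx : t = T * x := by rw [hx]; field_simp
    have hx2 : t / 2 / T = x / 2 := by rw [hx]; ring
    rw [hx2] at h1
    have hb : INS2D.bracket T t = Real.exp 1 + x := rfl
    have hb3 : INS2D.bracket T t ^ 3 ≤ 36 * (x * (1 + x / 2) ^ 2) := by
      have b1 : INS2D.bracket T t ≤ 4 * x := by rw [hb]; linarith
      have b2 : INS2D.bracket T t ≤ 3 * (1 + x / 2) := by rw [hb]; linarith
      calc INS2D.bracket T t ^ 3 = INS2D.bracket T t * INS2D.bracket T t ^ 2 := by ring
        _ ≤ (4 * x) * (3 * (1 + x / 2)) ^ 2 :=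
            mul_le_mul b1 (pow_le_pow_left₀ hb0.le b2 2) (by positivity) (by positivity)
        _ = _ := by ring
    rw [zpow_neg, ← div_eq_mul_inv, ← mul_div_assoc, le_div_iff₀ (by positivity)]
    norm_cast
    refine le_of_mul_le_mul_left ?_ hTpos
    calc T * (INS2D.gradL2Sq (u t) * INS2D.bracket T t ^ 3)
        ≤ T * (INS2D.gradL2Sq (u t) * (36 * (x * (1 + x / 2) ^ 2))) := by gcongr
      _ = 36 * (1 + x / 2) ^ 2 * (t * INS2D.gradL2Sq (u t)) := by rw [htx]; ring
      _ ≤ 36 * (1 + x / 2) ^ 2 * (k * INS2D.E₀ (ρ (t / 2)) (u (t / 2))) := by gcongr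
      _ = 36 * k * ((1 + x / 2) ^ 2 * INS2D.E₀ (ρ (t / 2)) (u (t / 2))) := by ring
      _ ≤ 36 * k * (c * (T * INS2D.E₁ (u 0))) := by
          refine mul_le_mul_of_nonneg_left (h1.trans ?_) (by positivity)
          gcongr
      _ = T * (36 * (k * c) * INS2D.E₁ (u 0)) := by ring
      _ ≤ T * (64 * (k * c) * INS2D.E₁ (u 0)) := by
          gcongr
          norm_num
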